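/- arXiv:1512.06848 — 6 statements merged into one kernel-verified Lean document; each statement's English description precedes it below -/
import Mathlib

section
/- Fix an integer n ≥ 1. There is a bijection Φ from the set of all partitions onto the product (set of (n+1)-cores) × (set of (n+1)-tuples of partitions) such that whenever Φ(λ) = (κ, (μ_1, …, μ_{n+1})), one has wt_r(λ) = wt_r(κ) + |μ_1| + … + |μ_{n+1}| for every residue r modulo n+1; in particular |λ| = |κ| + (n+1)(|μ_1| + … + |μ_{n+1}|). -/
/-- A partition: a weakly decreasing sequence of nonnegative integers with finitely
many nonzero terms. `parts i` denotes `λ_{i+1}` (0-indexed). -/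
structure IntPartition where
  parts : ℕ → ℕ
  antitone : ∀ ⦃i j : ℕ⦄, i ≤ j → parts j ≤ parts i
  finite_support : ∃ N : ℕ, ∀ i : ℕ, N ≤ i → parts i = 0

namespace IntPartition

/-- The Young diagram `Y(λ) = {(i,j) : j < λ_{i+1}}`. -/
def diagram (l : IntPartition) : Set (ℕ × ℕ) := {c : ℕ × ℕ | c.2 < l.parts c.1}

/-- The bead set (Maya diagram) `B(λ) = {λ_i − i + 1 : i = 1, 2, …} ⊆ ℤ`. -/
def beadSet (l : IntPartition) : Set ℤ := Set.range fun i : ℕ => (l.parts i : ℤ) - (i : ℤ)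

/-- The total number of cells of the partition. -/
noncomputable def size (l : IntPartition) : ℕ := l.diagram.ncard

/-- `wt n r l` is the number of cells `(i,j)` of `l` with `i − j ≡ r (mod n+1)`. -/
noncomputable def wt (n : ℕ) (r : ℤ) (l : IntPartition) : ℕ :=
  {c : ℕ × ℕ | c ∈ l.diagram ∧ ((c.1 : ℤ) - (c.2 : ℤ)) ≡ r [ZMOD ((n : ℤ) + 1)]}.ncard

end IntPartition

/-- A subset `S ⊆ ℤ` is balanced if `S ∩ ℤ_{>0}` and `ℤ_{≤0} ∖ S` are finite of the
same cardinality. -/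
def IsBalanced (S : Set ℤ) : Prop :=
  (S ∩ {p : ℤ | 0 < p}).Finite ∧ ({p : ℤ | p ≤ 0} \ S).Finite ∧
    (S ∩ {p : ℤ | 0 < p}).ncard = ({p : ℤ | p ≤ 0} \ S).ncard

/-- Two cells share an edge. -/
def CellAdj (p q : ℕ × ℕ) : Prop :=
  (p.1 = q.1 ∧ (p.2 + 1 = q.2 ∨ q.2 + 1 = p.2)) ∨
  (p.2 = q.2 ∧ (p.1 + 1 = q.1 ∨ q.1 + 1 = p.1))

/-- A set of cells is connected through shared edges. -/
def CellConnected (S : Set (ℕ × ℕ)) : Prop :=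
  ∀ p ∈ S, ∀ q ∈ S,
    Relation.ReflTransGen (fun a b => a ∈ S ∧ b ∈ S ∧ CellAdj a b) p q

/-- The set of cells contains no 2×2 square. -/
def NoTwoByTwo (S : Set (ℕ × ℕ)) : Prop :=
  ¬ ∃ i j : ℕ, (i, j) ∈ S ∧ (i + 1, j) ∈ S ∧ (i, j + 1) ∈ S ∧ (i + 1, j + 1) ∈ S

/-- A border strip of length `m`: exactly `m` cells, edge-connected, no 2×2 square. -/
def IsBorderStrip (S : Set (ℕ × ℕ)) (m : ℕ) : Prop :=
  S.Finite ∧ S.ncard = m ∧ CellConnected S ∧ NoTwoByTwo S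

/-- `l` is an `(n+1)`-core: no border strip of length `n+1` can be removed from it. -/
def IsCore (n : ℕ) (l : IntPartition) : Prop :=
  ¬ ∃ m : IntPartition, m.diagram ⊆ l.diagram ∧
      IsBorderStrip (l.diagram \ m.diagram) (n + 1)

/-- A cell `c ∉ Y(l)` is addable if `Y(l) ∪ {c}` is again a Young diagram. -/
def Addable (l : IntPartition) (c : ℕ × ℕ) : Prop :=
  c ∉ l.diagram ∧ ∃ m : IntPartition, m.diagram = l.diagram ∪ {c}

/-- `l` is 0-generated: every addable cell has content `≡ 0 (mod n+1)`. -/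
def ZeroGenerated (n : ℕ) (l : IntPartition) : Prop :=
  ∀ c : ℕ × ℕ, Addable l c → ((c.1 : ℤ) - (c.2 : ℤ)) ≡ 0 [ZMOD ((n : ℤ) + 1)]

/-- The abacus parameter `a_r(λ)`: the number of positive beads congruent to `r`
minus the number of absent nonpositive positions congruent to `r` (mod `n+1`). -/
noncomputable def abacusParam (n : ℕ) (r : ℤ) (l : IntPartition) : ℤ :=
  ({p : ℤ | p ∈ l.beadSet ∧ 0 < p ∧ p ≡ r [ZMOD ((n : ℤ) + 1)]}.ncard : ℤ) -
  ({p : ℤ | p ≤ 0 ∧ p ∉ l.beadSet ∧ p ≡ r [ZMOD ((n : ℤ) + 1)]}.ncard : ℤ)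

namespace CQ

open IntPartition

theorem ext' {l m : IntPartition} (h : ∀ i, l.parts i = m.parts i) : l = m := by
  cases l; cases m
  have := funext h
  simp only at this
  subst this
  rfl

def emp : IntPartition := ⟨fun _ => 0, fun _ _ _ => le_rfl, 0, fun _ _ => rfl⟩

theorem bead_anti (l : IntPartition) {i j : ℕ} (h : i < j) :
    (l.parts j : ℤ) - j < (l.parts i : ℤ) - i := by
  have := l.antitone h.le
  omega

theorem exF (l : IntPartition) (x : ℤ) : ∃ i : ℕ, (l.parts i : ℤ) - i ≤ x := by
  obtain ⟨N, hN⟩ := l.finite_support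
  refine ⟨N + x.natAbs, ?_⟩
  rw [hN _ (by omega)]
  omega

open Classical in
noncomputable def F (l : IntPartition) (x : ℤ) : ℕ := Nat.find (exF l x)

theorem lt_F (l : IntPartition) (x : ℤ) (i : ℕ) : i < F l x ↔ x < (l.parts i : ℤ) - i := by
  classical
  unfold F
  rw [Nat.lt_find_iff]
  constructor
  · intro h; have := h i le_rfl; omega
  · intro h m hm
    rcases hm.eq_or_lt with rfl | hm
    · omega
    · have := bead_anti l hm; omega

theorem F_eq {l : IntPartition} {x : ℤ} {k : ℕ} (h : ∀ i : ℕ, x < (l.parts i : ℤ) - i ↔ i < k) :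
    F l x = k := by
  have h2 : ∀ i, i < F l x ↔ i < k := fun i => (lt_F l x i).trans (h i)
  have h3 := h2 k
  have h4 := h2 (F l x)
  omega

theorem F_emp (x : ℤ) : F emp x = (-x).toNat := by
  apply F_eq
  intro i
  simp only [emp]
  omega

theorem F_ge (l : IntPartition) (x : ℤ) : (-x).toNat ≤ F l x := by
  by_contra h
  push Not at h
  have := (lt_F l x (F l x))
  omega

theorem F_small (l : IntPartition) : ∃ m : ℤ, ∀ x ≤ m, (F l x : ℤ) = - x := by
  obtain ⟨N, hN⟩ := l.finite_support
  refine ⟨-N, fun x hx => ?_⟩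
  have : F l x = (-x).toNat := by
    apply F_eq
    intro i
    constructor
    · intro h
      by_contra h2
      rw [hN i (by omega)] at h
      omega
    · intro h
      omega
  omega

theorem mem_diag (l : IntPartition) (i j : ℕ) : (i, j) ∈ l.diagram ↔ i < F l ((j : ℤ) - i) := by
  rw [lt_F]
  simp only [diagram, Set.mem_ofPred_eq]
  omega

theorem diag_finite (l : IntPartition) : l.diagram.Finite := by
  obtain ⟨N, hN⟩ := l.finite_support
  apply Set.Finite.subset ((Set.finite_Iio N).prod (Set.finite_Iio (l.parts 0)))
  rintro ⟨i, j⟩ h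
  simp only [diagram, Set.mem_ofPred_eq] at h
  have := l.antitone (Nat.zero_le i)
  simp only [Set.mem_prod, Set.mem_Iio]
  constructor
  · by_contra h2
    rw [hN i (by omega)] at h; omega
  · omega

/-! Maya sets -/

def IsMaya (S : Set ℤ) : Prop := (∃ M, ∀ x ∈ S, x ≤ M) ∧ ∃ m, ∀ x ≤ m, x ∈ S

noncomputable def cnt (S : Set ℤ) (x : ℤ) : ℕ := (S ∩ Set.Ioi x).ncard

theorem IsMaya.fin {S : Set ℤ} (h : IsMaya S) (x : ℤ) : (S ∩ Set.Ioi x).Finite := by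
  obtain ⟨M, hM⟩ := h.1
  apply (Set.finite_Icc x M).subset
  rintro y ⟨h1, h2⟩
  exact ⟨le_of_lt h2, hM y h1⟩

def bd (c : ℤ) (l : IntPartition) : Set ℤ := Set.range fun i : ℕ => (l.parts i : ℤ) - i + c

theorem isMaya_bd (c : ℤ) (l : IntPartition) : IsMaya (bd c l) := by
  constructor
  · refine ⟨l.parts 0 + c, ?_⟩
    rintro _ ⟨i, rfl⟩
    have := l.antitone (Nat.zero_le i)
    dsimp only
    omega
  · obtain ⟨N, hN⟩ := l.finite_support
    refine ⟨c - N, fun x hx => ⟨(c - x).toNat, ?_⟩⟩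
    dsimp only
    rw [hN _ (by omega)]
    omega

theorem bd_inj {c c' : ℤ} {l l' : IntPartition} (h : bd c l = bd c' l') : c = c' ∧ l = l' := by
  have key : ∀ (c : ℤ) (l : IntPartition),
      StrictMono (fun i : ℕ => OrderDual.toDual ((l.parts i : ℤ) - i + c)) := by
    intro c l i j hij
    have := bead_anti l hij
    rw [OrderDual.toDual_lt_toDual]
    omega
  have h2 := ((key c l).range_inj (key c' l')).1 h
  have h3 : ∀ i : ℕ, (l.parts i : ℤ) - i + c = (l'.parts i : ℤ) - i + c' := fun i => congrFun h2 i
  obtain ⟨N, hN⟩ := l.finite_support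
  obtain ⟨N', hN'⟩ := l'.finite_support
  have hc : c = c' := by
    have := h3 (N + N')
    rw [hN _ (by omega), hN' _ (by omega)] at this
    omega
  refine ⟨hc, ext' fun i => ?_⟩
  have := h3 i
  omega

theorem bd_surj {S : Set ℤ} (h : IsMaya S) : ∃ c l, S = bd c l := by
  obtain ⟨⟨M, hM⟩, m, hm⟩ := h
  let T : Set ℕ := {k : ℕ | M - (k : ℤ) ∈ S}
  have hT : ∀ k : ℕ, (M - m).toNat ≤ k → k ∈ T := fun k hk => hm _ (by omega)
  have hinf : T.Infinite := by
    apply Set.infinite_of_not_bddAbove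
    rintro ⟨B, hB⟩
    have := hB (hT (B + 1 + (M - m).toNat) (by omega))
    omega
  have hinf' : (Set.ofPred (fun k => k ∈ T)).Infinite := hinf
  let f : ℕ → ℕ := Nat.nth (· ∈ T)
  have hf : StrictMono f := Nat.nth_strictMono hinf'
  have hr : Set.range f = T := Nat.range_nth_of_infinite hinf'
  have hge : ∀ i, i ≤ f i := fun i => hf.le_apply
  have hmono : ∀ i d, f i + d ≤ f (i + d) := by
    intro i d
    induction d with
    | zero => simp
    | succ d ih =>
      have := hf (show i + d < i + (d + 1) by omega)
      omega
  set k0 := (M - m).toNat with hk0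
  have hstep : ∀ d, f (k0 + d) = f k0 + d := by
    intro d
    induction d with
    | zero => simp
    | succ d ih =>
      have h1 : f k0 + d + 1 ∈ T := hT _ (by have := hge k0; omega)
      rw [← hr] at h1
      obtain ⟨j, hj⟩ := h1
      have h2 : k0 + d < j := by
        rw [← hf.lt_iff_lt]; omega
      have h3 := hf.monotone (show k0 + (d + 1) ≤ j by omega)
      have h4 := hmono k0 (d + 1)
      omega
  have hval : ∀ i, f i + k0 ≤ f k0 + i := by
    intro i
    rcases le_total i k0 with hi | hi
    · have := hmono i (k0 - i)
      rw [show i + (k0 - i) = k0 by omega] at this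
      omega
    · have := hstep (i - k0)
      rw [show k0 + (i - k0) = i by omega] at this
      omega
  refine ⟨M - f k0 + k0, ⟨fun i => (f k0 + i) - (f i + k0), ?_, k0, ?_⟩, ?_⟩
  · intro i j hij
    have := hmono i (j - i)
    rw [show i + (j - i) = j by omega] at this
    omega
  · intro i hi
    have := hstep (i - k0)
    rw [show k0 + (i - k0) = i by omega] at this
    omega
  · have e : ∀ i : ℕ, (((f k0 + i) - (f i + k0) : ℕ) : ℤ) - i + (M - f k0 + k0) = M - f i := by
      intro i
      have := hval i
      omega
    unfold bd
    simp only [e]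
    ext x
    constructor
    · intro hx
      have h1 : (M - x).toNat ∈ T := by
        have := hM x hx
        change M - ((M - x).toNat : ℤ) ∈ S
        rw [show M - ((M - x).toNat : ℤ) = x by omega]
        exact hx
      rw [← hr] at h1
      obtain ⟨i, hi⟩ := h1
      refine ⟨i, ?_⟩
      have := hM x hx
      simp only [hi]
      omega
    · rintro ⟨i, rfl⟩
      have : f i ∈ T := by rw [← hr]; exact ⟨i, rfl⟩
      exact this

theorem cnt_bd (c : ℤ) (l : IntPartition) (x : ℤ) : cnt (bd c l) x = F l (x - c) := by
  unfold cnt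
  have : bd c l ∩ Set.Ioi x = (fun i : ℕ => (l.parts i : ℤ) - i + c) '' (Finset.range (F l (x - c))) := by
    ext y
    simp only [bd, Set.mem_inter_iff, Set.mem_range, Set.mem_Ioi, Set.mem_image, Finset.coe_range, Set.mem_Iio, lt_F]
    constructor
    · rintro ⟨⟨i, rfl⟩, h⟩
      exact ⟨i, by omega, rfl⟩
    · rintro ⟨i, h, rfl⟩
      exact ⟨⟨i, rfl⟩, by omega⟩
  rw [this, Set.ncard_image_of_injective, Set.ncard_coe_finset, Finset.card_range]
  intro i j hij
  dsimp only at hij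
  rcases lt_trichotomy i j with h | h | h
  · have := bead_anti l h; omega
  · exact h
  · have := bead_anti l h; omega

theorem cnt_pred {S : Set ℤ} (h : IsMaya S) (x : ℤ) :
    (x ∈ S → cnt S (x - 1) = cnt S x + 1) ∧ (x ∉ S → cnt S (x - 1) = cnt S x) := by
  unfold cnt
  constructor
  · intro hx
    have : S ∩ Set.Ioi (x - 1) = insert x (S ∩ Set.Ioi x) := by
      ext y
      simp only [Set.mem_inter_iff, Set.mem_Ioi, Set.mem_insert_iff]
      constructor
      · rintro ⟨h1, h2⟩
        by_cases e : y = x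
        · exact Or.inl e
        · exact Or.inr ⟨h1, by omega⟩
      · rintro (rfl | ⟨h1, h2⟩)
        · exact ⟨hx, by omega⟩
        · exact ⟨h1, by omega⟩
    rw [this, Set.ncard_insert_of_notMem (by simp) (h.fin x)]
  · intro hx
    congr 1
    ext y
    simp only [Set.mem_inter_iff, Set.mem_Ioi]
    constructor
    · rintro ⟨h1, h2⟩
      refine ⟨h1, ?_⟩
      have : y ≠ x := by rintro rfl; exact hx h1
      omega
    · rintro ⟨h1, h2⟩
      exact ⟨h1, by omega⟩

/-! slices -/

def slice (N : ℕ) (s : Fin N) (S : Set ℤ) : Set ℤ := {k | (N : ℤ) * k - (s : ℕ) ∈ S}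

theorem isMaya_slice {N : ℕ} (s : Fin N) {S : Set ℤ} (h : IsMaya S) : IsMaya (slice N s S) := by
  obtain ⟨⟨M, hM⟩, m, hm⟩ := h
  have hs := s.2
  have hN : (1 : ℤ) ≤ N := by omega
  constructor
  · refine ⟨|M| + N, fun x hx => ?_⟩
    have := hM _ hx
    by_contra hc
    push Not at hc
    have h1 := le_abs_self M
    have h2 := abs_nonneg M
    nlinarith
  · refine ⟨-|m|, fun x hx => hm _ ?_⟩
    have h1 := neg_abs_le m
    have h2 := abs_nonneg m
    nlinarith

theorem resid {N : ℕ} (hN : 0 < N) (x : ℤ) : ∃ (s : Fin N) (k : ℤ), x = (N : ℤ) * k - (s : ℕ) := by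
  have h1 := Int.emod_nonneg (-x) (show (N : ℤ) ≠ 0 by omega)
  have h2 := Int.emod_lt_of_pos (-x) (show (0 : ℤ) < N by omega)
  have h3 := Int.mul_ediv_add_emod (-x) N
  refine ⟨⟨((-x) % N).toNat, by omega⟩, -((-x) / N), ?_⟩
  simp only [mul_neg]
  omega

theorem resid_uniq {N : ℕ} {s t : Fin N} {k j : ℤ}
    (h : (N : ℤ) * k - (s : ℕ) = (N : ℤ) * j - (t : ℕ)) : s = t ∧ k = j := by
  have hs := s.2
  have ht := t.2
  have hkj : k = j := by
    rcases lt_trichotomy k j with h1 | h1 | h1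
    · have : (N : ℤ) * (k + 1) ≤ N * j := by gcongr; omega
      rw [mul_add] at this; omega
    · exact h1
    · have : (N : ℤ) * (j + 1) ≤ N * k := by gcongr; omega
      rw [mul_add] at this; omega
  subst hkj
  exact ⟨Fin.ext (by omega), rfl⟩

theorem slice_inj {N : ℕ} (hN : 0 < N) {S S' : Set ℤ} (h : ∀ s, slice N s S = slice N s S') : S = S' := by
  ext x
  obtain ⟨s, k, rfl⟩ := resid hN x
  exact Set.ext_iff.1 (h s) k

theorem slice_surj {N : ℕ} (hN : 0 < N) (T : Fin N → Set ℤ) (hT : ∀ s, IsMaya (T s)) :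
    ∃ S, IsMaya S ∧ ∀ s, slice N s S = T s := by
  refine ⟨{x | ∃ s : Fin N, ∃ k ∈ T s, x = (N : ℤ) * k - (s : ℕ)}, ⟨?_, ?_⟩, ?_⟩
  · choose M hM using fun s => (hT s).1
    refine ⟨N * ∑ s, |M s|, ?_⟩
    rintro x ⟨s, k, hk, rfl⟩
    have h1 := hM s k hk
    have h2 := Finset.single_le_sum (f := fun s => |M s|) (fun i _ => abs_nonneg _) (Finset.mem_univ s)
    have h3 := le_abs_self (M s)
    have : (N : ℤ) * k ≤ N * ∑ s, |M s| := by gcongr; omega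
    omega
  · choose m hm using fun s => (hT s).2
    refine ⟨N * (- ∑ s, |m s|) - N, ?_⟩
    intro x hx
    obtain ⟨s, k, rfl⟩ := resid hN x
    refine ⟨s, k, hm s k ?_, rfl⟩
    have h2 := Finset.single_le_sum (f := fun s => |m s|) (fun i _ => abs_nonneg _) (Finset.mem_univ s)
    have h3 := neg_abs_le (m s)
    have hs := s.2
    have : (N : ℤ) * k ≤ N * (- ∑ s, |m s|) := by omega
    have := le_of_mul_le_mul_left this (by omega)
    omega
  · intro s
    ext k
    constructor
    · rintro ⟨t, j, hj, e⟩
      obtain ⟨rfl, rfl⟩ := resid_uniq e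
      exact hj
    · intro hk
      exact ⟨s, k, hk, rfl⟩

theorem cnt_slice {N : ℕ} (hN : 0 < N) {S : Set ℤ} (h : IsMaya S) (x : ℤ) :
    cnt S x = ∑ s : Fin N, cnt (slice N s S) ((x + (s : ℕ)) / N) := by
  unfold cnt
  simp only [← Nat.card_coe_set_eq]
  have hfin : ∀ s : Fin N, Finite ↥(slice N s S ∩ Set.Ioi ((x + (s : ℕ)) / (N : ℤ))) :=
    fun s => ((isMaya_slice s h).fin _).to_subtype
  rw [← Nat.card_sigma]
  symm
  have hlt : ∀ (s : Fin N) (k : ℤ), (x + (s : ℕ)) / (N : ℤ) < k ↔ x < (N : ℤ) * k - (s : ℕ) := by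
    intro s k
    rw [Int.ediv_lt_iff_lt_mul (by omega), mul_comm]
    omega
  apply Nat.card_congr
  refine Equiv.ofBijective
    (fun p => ⟨(N : ℤ) * p.2.1 - (p.1 : ℕ), p.2.2.1, (hlt _ _).1 p.2.2.2⟩) ⟨?_, ?_⟩
  · rintro ⟨s, k, hk⟩ ⟨t, j, hj⟩ e
    obtain ⟨rfl, rfl⟩ := resid_uniq (Subtype.ext_iff.1 e)
    rfl
  · rintro ⟨y, hy1, hy2⟩
    obtain ⟨s, k, rfl⟩ := resid hN y
    exact ⟨⟨s, k, hy1, (hlt _ _).2 hy2⟩, rfl⟩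

theorem mem_bd_F (l : IntPartition) (x : ℤ) :
    (x ∈ bd 0 l → F l (x - 1) = F l x + 1) ∧ (x ∉ bd 0 l → F l (x - 1) = F l x) := by
  have := cnt_pred (isMaya_bd 0 l) x
  simpa only [cnt_bd, sub_zero] using this

theorem F_pred (l : IntPartition) (x : ℤ) : F l (x - 1) = F l x + 1 ∨ F l (x - 1) = F l x := by
  have := mem_bd_F l x
  by_cases h : x ∈ bd 0 l
  · exact Or.inl (this.1 h)
  · exact Or.inr (this.2 h)

theorem cnt_insert {S : Set ℤ} (h : IsMaya S) {a : ℤ} (ha : a ∉ S) (x : ℤ) :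
    cnt (insert a S) x = cnt S x + if x < a then 1 else 0 := by
  unfold cnt
  split_ifs with hx
  · rw [Set.insert_inter_of_mem (by exact hx), Set.ncard_insert_of_notMem (fun hh => ha hh.1) (h.fin x)]
  · rw [Set.insert_inter_of_notMem (by exact hx)]; rfl

theorem charge_eq {c c' : ℤ} {l l' : IntPartition} {m : ℤ}
    (h : ∀ x ≤ m, cnt (bd c l) x = cnt (bd c' l') x) : c = c' := by
  obtain ⟨a, ha⟩ := F_small l
  obtain ⟨b, hb⟩ := F_small l'
  simp only [cnt_bd] at h
  let x := -|m| - |a| - |b| - |c| - |c'|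
  have h1 := neg_abs_le m
  have h2 := neg_abs_le a
  have h3 := neg_abs_le b
  have h4 := neg_abs_le c
  have h5 := neg_abs_le c'
  have h1' := abs_nonneg m
  have h2' := abs_nonneg a
  have h3' := abs_nonneg b
  have h4' := abs_nonneg c
  have h5' := abs_nonneg c'
  have e1 := h x (by simp only [x]; linarith)
  have e2 := ha (x - c) (by simp only [x]; linarith)
  have e3 := hb (x - c') (by simp only [x]; linarith)
  omega

theorem strip_of_F {l m : IntPartition} {p : ℤ} {N : ℕ}
    (h : ∀ x, F l x = F m x + if p ≤ x ∧ x < p + N then 1 else 0) :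
    m.diagram ⊆ l.diagram ∧ IsBorderStrip (l.diagram \ m.diagram) N := by
  have hsub : m.diagram ⊆ l.diagram := by
    rintro ⟨i, j⟩ hij
    rw [mem_diag] at hij ⊢
    have := h (j - i)
    omega
  have hD : ∀ i j : ℕ, (i, j) ∈ l.diagram \ m.diagram ↔
      i = F m ((j : ℤ) - i) ∧ p ≤ (j : ℤ) - i ∧ (j : ℤ) - i < p + N := by
    intro i j
    rw [Set.mem_sdiff, mem_diag, mem_diag, h]
    split_ifs with hc
    · omega
    · omega
  let g : ℤ → ℕ × ℕ := fun x => (F m x, ((F m x : ℤ) + x).toNat)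
  have hg : ∀ x, ((F m x : ℤ) + x).toNat = (F m x : ℤ) + x := by
    intro x
    have := F_ge m x
    omega
  have himg : l.diagram \ m.diagram = g '' (Finset.Ico p (p + N)) := by
    ext ⟨i, j⟩
    rw [hD]
    simp only [Set.mem_image, Finset.coe_Ico, Set.mem_Ico, g, Prod.mk.injEq]
    constructor
    · rintro ⟨h1, h2⟩
      exact ⟨(j : ℤ) - i, h2, h1.symm, by omega⟩
    · rintro ⟨x, hx, rfl, rfl⟩
      have := hg x
      rw [this]
      rw [show (F m x : ℤ) + x - F m x = x by ring]
      exact ⟨rfl, hx⟩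
  have hginj : Function.Injective g := by
    intro x y hxy
    simp only [g, Prod.mk.injEq] at hxy
    have h1 := hg x
    have h2 := hg y
    omega
  refine ⟨hsub, (diag_finite l).subset Set.sdiff_subset, ?_, ?_, ?_⟩
  · rw [himg, Set.ncard_image_of_injective _ hginj, Set.ncard_coe_finset, Int.card_Ico]
    omega
  · have hsymm : Std.Symm (fun a b => a ∈ l.diagram \ m.diagram ∧ b ∈ l.diagram \ m.diagram ∧ CellAdj a b) := by
      constructor
      rintro a b ⟨h1, h2, h3⟩
      refine ⟨h2, h1, ?_⟩
      unfold CellAdj at h3 ⊢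
      omega
    have key : ∀ (d : ℕ) (x : ℤ), p ≤ x → x + d < p + N → Relation.ReflTransGen
        (fun a b => a ∈ l.diagram \ m.diagram ∧ b ∈ l.diagram \ m.diagram ∧ CellAdj a b) (g x) (g (x + d)) := by
      intro d x hx
      induction d with
      | zero => intro _; simp only [Nat.cast_zero, add_zero]; exact Relation.ReflTransGen.refl
      | succ d ih =>
        intro hd
        push_cast at hd
        refine (ih (by omega)).tail ⟨?_, ?_, ?_⟩
        · rw [himg]; exact ⟨x + d, by simp; omega, rfl⟩
        · rw [himg]; exact ⟨x + (d + 1 : ℕ), by simp; omega, rfl⟩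
        · have h1 := F_pred m (x + (d + 1 : ℕ))
          have h2 := hg (x + d)
          have h3 := hg (x + (d + 1 : ℕ))
          rw [show x + ((d + 1 : ℕ) : ℤ) - 1 = x + d by push_cast; ring] at h1
          simp only [CellAdj, g]
          omega
    intro a ha b hb
    have ha' := ha
    have hb' := hb
    rw [himg] at ha' hb'
    obtain ⟨x, hx, rfl⟩ := ha'
    obtain ⟨y, hy, rfl⟩ := hb'
    simp only [Finset.coe_Ico, Set.mem_Ico] at hx hy
    rcases le_total x y with hxy | hxy
    · have := key (y - x).toNat x hx.1 (by omega)
      rwa [show x + ((y - x).toNat : ℤ) = y by omega] at this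
    · have := key (x - y).toNat y hy.1 (by omega)
      rw [show y + ((x - y).toNat : ℤ) = x by omega] at this
      exact Relation.ReflTransGen.stdSymm.symm _ _ this
  · rintro ⟨i, j, h1, -, -, h2⟩
    rw [hD] at h1 h2
    have e : ((j + 1 : ℕ) : ℤ) - ((i + 1 : ℕ) : ℤ) = (j : ℤ) - i := by push_cast; ring
    rw [e] at h2
    omega

theorem bead_of_strip {l m : IntPartition} {N : ℕ} (hN : 0 < N) (hsub : m.diagram ⊆ l.diagram)
    (h : IsBorderStrip (l.diagram \ m.diagram) N) : ∃ b ∈ bd 0 l, b - N ∉ bd 0 l := by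
  obtain ⟨hfin, hcard, hconn, h22⟩ := h
  set D := l.diagram \ m.diagram with hDdef
  have hD : ∀ i j : ℕ, (i, j) ∈ D ↔ F m ((j : ℤ) - i) ≤ i ∧ i < F l ((j : ℤ) - i) := by
    intro i j
    rw [hDdef, Set.mem_sdiff, mem_diag, mem_diag]
    omega
  have hD' : ∀ i j : ℕ, (i, j) ∈ D ↔ m.parts i ≤ j ∧ j < l.parts i := by
    intro i j
    rw [hDdef, Set.mem_sdiff]
    simp only [diagram, Set.mem_ofPred_eq]
    omega
  have hle : ∀ x, F m x ≤ F l x := by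
    intro x
    by_contra hc
    push Not at hc
    have h1 := F_ge l x
    have e : (((F l x : ℤ) + x).toNat : ℤ) - (F l x : ℕ) = x := by omega
    have h2 := @hsub (F l x, ((F l x : ℤ) + x).toNat)
    rw [mem_diag, mem_diag, e] at h2
    have := h2 hc
    omega
  have hle1 : ∀ x, F l x ≤ F m x + 1 := by
    intro x
    by_contra hc
    push Not at hc
    have h1 := F_ge m x
    obtain ⟨j, hj⟩ : ∃ j : ℕ, (j : ℤ) - (F m x : ℕ) = x := ⟨((F m x : ℤ) + x).toNat, by omega⟩
    have c1 : (F m x, j) ∈ D := by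
      rw [hD, hj]; omega
    have c2 : (F m x + 1, j + 1) ∈ D := by
      rw [hD, show ((j + 1 : ℕ) : ℤ) - ((F m x + 1 : ℕ) : ℤ) = x by push_cast; linarith]; omega
    refine h22 ⟨F m x, j, c1, ?_, ?_, c2⟩
    all_goals
      rw [hD'] at c1 c2 ⊢
      have a1 := m.antitone (Nat.le_succ (F m x))
      have a2 := l.antitone (Nat.le_succ (F m x))
      simp only [Nat.succ_eq_add_one] at a1 a2
      omega
  let ct : ℕ × ℕ → ℤ := fun c => (c.2 : ℤ) - c.1
  let X : Set ℤ := {x | F m x < F l x}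
  have hXD : X = ct '' D := by
    ext x
    constructor
    · intro hx
      change F m x < F l x at hx
      have h1 := F_ge m x
      obtain ⟨j, hj⟩ : ∃ j : ℕ, (j : ℤ) - (F m x : ℕ) = x := ⟨((F m x : ℤ) + x).toNat, by omega⟩
      exact ⟨(F m x, j), by rw [hD, hj]; omega, hj⟩
    · rintro ⟨⟨i, j⟩, hc, rfl⟩
      rw [hD] at hc
      change F m ((j : ℤ) - i) < F l ((j : ℤ) - i)
      omega
  have hinj : Set.InjOn ct D := by
    rintro ⟨i, j⟩ h1 ⟨i', j'⟩ h2 e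
    simp only [ct] at e
    rw [hD] at h1 h2
    rw [e] at h1
    have := hle1 ((j' : ℤ) - i')
    ext <;> simp only <;> omega
  have hXcard : X.ncard = N := by rw [hXD, hinj.ncard_image, hcard]
  have hXfin : X.Finite := by rw [hXD]; exact hfin.image _
  have hXne : X.Nonempty := by
    rw [← Set.ncard_pos hXfin]; omega
  have hconv : ∀ a ∈ D, ∀ b ∈ D, ∀ y, ct a ≤ y → y ≤ ct b → y ∈ X := by
    intro a ha b hb
    have := hconn a ha b hb
    clear hb
    induction this with
    | refl =>
      intro y h1 h2
      rw [hXD]; exact ⟨a, ha, by omega⟩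
    | @tail b c _ hbc ih =>
      intro y h1 h2
      by_cases hy : y ≤ ct b
      · exact ih y h1 hy
      · rw [hXD]
        refine ⟨c, hbc.2.1, ?_⟩
        have := hbc.2.2
        simp only [CellAdj, ct] at *
        omega
  obtain ⟨p, hp, hpmin⟩ := hXfin.exists_minimal hXne
  obtain ⟨q, hq, hqmax⟩ := hXfin.exists_maximal hXne
  have hpmin' : ∀ y ∈ X, p ≤ y := fun y hy => by
    rcases le_total p y with h | h
    · exact h
    · exact hpmin hy h
  have hqmax' : ∀ y ∈ X, y ≤ q := fun y hy => by
    rcases le_total y q with h | h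
    · exact h
    · exact hqmax hy h
  have hX : X = ↑(Finset.Icc p q) := by
    ext y
    simp only [Finset.coe_Icc, Set.mem_Icc]
    constructor
    · intro hy; exact ⟨hpmin' y hy, hqmax' y hy⟩
    · rintro ⟨h1, h2⟩
      have hp' := hp
      have hq' := hq
      rw [hXD] at hp' hq'
      obtain ⟨a, ha, rfl⟩ := hp'
      obtain ⟨b, hb, rfl⟩ := hq'
      exact hconv a ha b hb y h1 h2
  have hpq : p ≤ q := hpmin' q hq
  have hlen : q + 1 - N = p := by
    rw [hX, Set.ncard_coe_finset, Int.card_Icc] at hXcard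
    omega
  have n1 : ¬ (F m (p - 1) < F l (p - 1)) := fun hh => by
    have := hpmin' (p - 1) hh
    omega
  have n2 : ¬ (F m (q + 1) < F l (q + 1)) := fun hh => by
    have := hqmax' (q + 1) hh
    omega
  have i1 : F m p < F l p := hp
  have i2 : F m q < F l q := hq
  have j1 := F_pred m p
  have j2 := F_pred m (q + 1)
  have k2 := mem_bd_F l (q + 1)
  have k1 := mem_bd_F l p
  rw [add_sub_cancel_right] at j2 k2
  have l1 := hle (p - 1)
  have l2 := hle (q + 1)
  refine ⟨q + 1, ?_, ?_⟩
  · by_contra hc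
    have := k2.2 hc
    omega
  · rw [hlen]
    intro hc
    have := k1.1 hc
    have := hle1 p
    omega

theorem core_iff (n : ℕ) (l : IntPartition) :
    IsCore n l ↔ ∀ b ∈ bd 0 l, b - ((n + 1 : ℕ) : ℤ) ∈ bd 0 l := by
  constructor
  · intro hcore b hb
    by_contra hb'
    apply hcore
    set N := n + 1 with hNdef
    let S0 := bd 0 l \ {b}
    have hM := isMaya_bd 0 l
    have hS0 : IsMaya S0 := by
      obtain ⟨⟨M, hM⟩, m, hm⟩ := hM
      refine ⟨⟨M, fun x hx => hM x hx.1⟩, min m (b - 1), fun x hx => ⟨hm x (by omega), ?_⟩⟩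
      simp only [Set.mem_singleton_iff]
      omega
    have e1 : bd 0 l = insert b S0 := by
      simp only [S0, Set.insert_sdiff_singleton, Set.insert_eq_of_mem hb]
    have hMS : IsMaya (insert (b - (N : ℤ)) S0) := by
      obtain ⟨⟨M, hM⟩, m, hm⟩ := hS0
      refine ⟨⟨max M (b - N), ?_⟩, m, fun x hx => Or.inr (hm x hx)⟩
      rintro x (rfl | hx)
      · omega
      · have := hM x hx; omega
    obtain ⟨c, m, hm⟩ := bd_surj hMS
    have c1 : ∀ x, cnt (bd 0 l) x = cnt S0 x + if x < b then 1 else 0 := by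
      intro x; rw [e1]; exact cnt_insert hS0 (fun h => h.2 rfl) x
    have c2 : ∀ x, cnt (bd c m) x = cnt S0 x + if x < b - (N : ℤ) then 1 else 0 := by
      intro x; rw [← hm]; exact cnt_insert hS0 (fun h => hb' h.1) x
    have hc : c = 0 := by
      apply charge_eq (l := m) (l' := l) (m := b - N - 1)
      intro x hx
      rw [c1, c2, if_pos (by omega), if_pos (by omega)]
    subst hc
    refine ⟨m, strip_of_F (p := b - N) ?_⟩
    intro x
    have a1 := c1 x
    have a2 := c2 x
    simp only [cnt_bd, sub_zero] at a1 a2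
    rw [a1, a2]
    split_ifs <;> omega
  · rintro h ⟨m, hsub, hs⟩
    obtain ⟨b, hb, hb'⟩ := bead_of_strip (Nat.succ_pos n) hsub hs
    exact hb' (h b hb)

theorem mem_bd_emp (c x : ℤ) : x ∈ bd c emp ↔ x ≤ c := by
  simp only [bd, emp, Set.mem_range]
  constructor
  · rintro ⟨i, rfl⟩; push_cast; omega
  · intro h; exact ⟨(c - x).toNat, by push_cast; omega⟩

theorem emp_iff (c : ℤ) (l : IntPartition) : (∀ k ∈ bd c l, k - 1 ∈ bd c l) ↔ l = emp := by
  constructor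
  · intro h
    have h0 : ∀ d : ℕ, (l.parts 0 : ℤ) + c - d ∈ bd c l := by
      intro d
      induction d with
      | zero => exact ⟨0, by simp⟩
      | succ d ih =>
        have := h _ ih
        push_cast
        rwa [← sub_sub]
    have : bd c l = bd (l.parts 0 + c) emp := by
      ext x
      rw [mem_bd_emp]
      constructor
      · rintro ⟨i, rfl⟩
        have := l.antitone (Nat.zero_le i)
        dsimp only
        omega
      · intro hx
        have := h0 (l.parts 0 + c - x).toNat
        rwa [show (l.parts 0 : ℤ) + c - ((l.parts 0 + c - x).toNat : ℤ) = x by omega] at this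
    exact (bd_inj this).2
  · rintro rfl k hk
    rw [mem_bd_emp] at *
    omega

/-! The core-quotient relation -/

def R (N : ℕ) (l : IntPartition) (c : Fin N → ℤ) (μ : Fin N → IntPartition) : Prop :=
  ∀ s, slice N s (bd 0 l) = bd (c s) (μ s)

theorem R_ex (N : ℕ) (l : IntPartition) : ∃ c μ, R N l c μ := by
  choose c μ h using fun s : Fin N => bd_surj (isMaya_slice s (isMaya_bd 0 l))
  exact ⟨c, μ, h⟩

theorem R_uniq {N : ℕ} {l : IntPartition} {c c' μ μ'} (h : R N l c μ) (h' : R N l c' μ') :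
    c = c' ∧ μ = μ' := by
  have := fun s => bd_inj ((h s).symm.trans (h' s))
  exact ⟨funext fun s => (this s).1, funext fun s => (this s).2⟩

theorem R_uniq' {N : ℕ} (hN : 0 < N) {l l' : IntPartition} {c μ} (h : R N l c μ) (h' : R N l' c μ) :
    l = l' :=
  (bd_inj (slice_inj hN fun s => (h s).trans (h' s).symm)).2

theorem charge_sum {N : ℕ} (hN : 0 < N) {l : IntPartition} {c0 : ℤ} {c : Fin N → ℤ} {μ : Fin N → IntPartition}
    (h : ∀ s, slice N s (bd c0 l) = bd (c s) (μ s)) : c0 = ∑ s, c s := by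
  obtain ⟨a, ha⟩ := F_small l
  choose b hb using fun s => F_small (μ s)
  obtain ⟨y, hy1, hy2⟩ : ∃ y : ℤ, (N : ℤ) * y ≤ a + c0 ∧ ∀ s, y - c s ≤ b s := by
    have p1 := neg_abs_le a
    have p2 := neg_abs_le c0
    have p3 := abs_nonneg a
    have p4 := abs_nonneg c0
    have q : 0 ≤ ∑ s, (|b s| + |c s|) := Finset.sum_nonneg fun s _ => by positivity
    refine ⟨-|a| - |c0| - ∑ s, (|b s| + |c s|), ?_, ?_⟩
    · have : (1 : ℤ) ≤ N := by omega
      nlinarith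
    · intro s
      have := Finset.single_le_sum (f := fun s => |b s| + |c s|) (fun i _ => by positivity) (Finset.mem_univ s)
      have r1 := neg_abs_le (b s)
      have r2 := neg_abs_le (c s)
      omega
  have key := cnt_slice hN (isMaya_bd c0 l) (N * y)
  simp only [h, cnt_bd] at key
  have e : ∀ s : Fin N, ((N : ℤ) * y + (s : ℕ)) / N = y := by
    intro s
    have := s.2
    rw [Int.mul_add_ediv_left _ _ (by omega), Int.ediv_eq_zero_of_lt (by omega) (by omega), add_zero]
  simp only [e] at key
  have key2 := congrArg (Nat.cast : ℕ → ℤ) key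
  push_cast at key2
  rw [ha _ (by omega), Finset.sum_congr rfl (fun s _ => hb s _ (hy2 s))] at key2
  simp only [neg_sub, Finset.sum_sub_distrib, Finset.sum_const, Finset.card_univ, Fintype.card_fin,
    nsmul_eq_mul] at key2
  omega

theorem R_surj {N : ℕ} (hN : 0 < N) {c : Fin N → ℤ} (hc : ∑ s, c s = 0)
    (μ : Fin N → IntPartition) : ∃ l, R N l c μ := by
  obtain ⟨S, hS, h⟩ := slice_surj hN (fun s => bd (c s) (μ s)) (fun s => isMaya_bd _ _)
  obtain ⟨c0, l, rfl⟩ := bd_surj hS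
  have := charge_sum hN h
  rw [hc] at this
  subst this
  exact ⟨l, h⟩

theorem R_core {n : ℕ} {l : IntPartition} {c μ} (h : R (n + 1) l c μ) :
    IsCore n l ↔ μ = fun _ => emp := by
  rw [core_iff, funext_iff]
  have hE : ∀ s, μ s = emp ↔ ∀ k ∈ slice (n + 1) s (bd 0 l), k - 1 ∈ slice (n + 1) s (bd 0 l) := by
    intro s; rw [h s, emp_iff]
  simp only [hE]
  constructor
  · intro hh s k hk
    have := hh _ hk
    change _ ∈ bd 0 l
    rwa [show ((n + 1 : ℕ) : ℤ) * (k - 1) - (s : ℕ) = ((n + 1 : ℕ) : ℤ) * k - (s : ℕ) - ((n + 1 : ℕ) : ℤ) by ring]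
  · intro hh b hb
    obtain ⟨s, k, rfl⟩ := resid (Nat.succ_pos n) b
    have : _ ∈ bd 0 l := hh s k hb
    rwa [show ((n + 1 : ℕ) : ℤ) * k - (s : ℕ) - ((n + 1 : ℕ) : ℤ) = ((n + 1 : ℕ) : ℤ) * (k - 1) - (s : ℕ) by ring]

/-! Weights -/

noncomputable def G (l : IntPartition) (x : ℤ) : ℕ := F l x - (-x).toNat

theorem G_add (l : IntPartition) (x : ℤ) : F l x = G l x + (-x).toNat := by
  have := F_ge l x
  unfold G
  omega

theorem G_R {N : ℕ} (hN : 0 < N) {l k : IntPartition} {c μ} (h : R N l c μ)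
    (h' : R N k c fun _ => emp) (x : ℤ) :
    G l x = G k x + ∑ s, G (μ s) ((x + (s : ℕ)) / N - c s) := by
  have e1 := cnt_slice hN (isMaya_bd 0 l) x
  have e2 := cnt_slice hN (isMaya_bd 0 k) x
  simp only [h _] at e1
  simp only [h' _] at e2
  simp only [cnt_bd, sub_zero] at e1 e2
  simp only [F_emp] at e2
  simp only [G_add, Finset.sum_add_distrib] at e1 e2
  omega

theorem G_card (l : IntPartition) (x : ℤ) :
    {c : ℕ × ℕ | c ∈ l.diagram ∧ (c.2 : ℤ) - c.1 = x}.ncard = G l x := by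
  have : {c : ℕ × ℕ | c ∈ l.diagram ∧ (c.2 : ℤ) - c.1 = x} =
      (fun i : ℕ => (i, ((i : ℤ) + x).toNat)) '' (Finset.Ico (-x).toNat (F l x)) := by
    ext ⟨i, j⟩
    simp only [Set.mem_ofPred_eq, mem_diag, Set.mem_image, Finset.coe_Ico, Set.mem_Ico, Prod.mk.injEq]
    constructor
    · rintro ⟨h1, rfl⟩
      exact ⟨i, ⟨by omega, h1⟩, rfl, by omega⟩
    · rintro ⟨i, ⟨h1, h2⟩, rfl, rfl⟩
      have : (((i : ℤ) + x).toNat : ℤ) - i = x := by omega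
      rw [this]
      exact ⟨h2, rfl⟩
  rw [this, Set.ncard_image_of_injective, Set.ncard_coe_finset, Nat.card_Ico]
  · rfl
  · intro i j h
    simp only [Prod.mk.injEq] at h
    exact h.1

theorem fiber_sum {A : Set (ℕ × ℕ)} (hA : A.Finite) (f : ℕ × ℕ → ℤ) :
    (A.ncard : ENNReal) = ∑' y : ℤ, ({a | a ∈ A ∧ f a = y}.ncard : ENNReal) := by
  classical
  obtain ⟨B, rfl⟩ := hA.exists_finset_coe
  have e : ∀ y, {a | a ∈ (B : Set (ℕ × ℕ)) ∧ f a = y} = ((B.filter fun a => f a = y : Finset _) : Set (ℕ × ℕ)) := by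
    intro y; ext a; simp
  simp only [e, Set.ncard_coe_finset]
  rw [tsum_eq_sum (s := B.image f), ← Nat.cast_sum]
  · rw [Finset.card_eq_sum_card_image f B]
  · intro y hy
    rw [Nat.cast_eq_zero, Finset.card_eq_zero, Finset.filter_eq_empty_iff]
    intro a ha h
    exact hy (Finset.mem_image.2 ⟨a, ha, h⟩)

theorem size_eq (l : IntPartition) : (l.size : ENNReal) = ∑' y : ℤ, (G l y : ENNReal) := by
  unfold size
  rw [fiber_sum (diag_finite l) (fun c => (c.2 : ℤ) - c.1)]
  simp only [G_card]

theorem wt_eq (n : ℕ) (r : ℤ) (l : IntPartition) :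
    (wt n r l : ENNReal) = ∑' y : ℤ, (G l (((n + 1 : ℕ) : ℤ) * y - r) : ENNReal) := by
  unfold wt
  rw [fiber_sum ((diag_finite l).subset fun c hc => hc.1) (fun c => (r - ((c.1 : ℤ) - c.2)) / ((n : ℤ) + 1))]
  simp only [← G_card]
  congr 1
  ext y
  congr 2
  ext ⟨i, j⟩
  simp only [Set.mem_ofPred_eq]
  push_cast
  constructor
  · rintro ⟨⟨h1, h2⟩, rfl⟩
    refine ⟨h1, ?_⟩
    rw [Int.mul_ediv_cancel' h2.dvd]
    ring
  · rintro ⟨h1, h2⟩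
    have h3 : r - ((i : ℤ) - j) = ((n : ℤ) + 1) * y := by linarith
    refine ⟨⟨h1, ?_⟩, ?_⟩
    · exact (Int.modEq_iff_dvd.2 ⟨y, h3⟩)
    · rw [h3, Int.mul_ediv_cancel_left _ (by omega)]

theorem wt_R {n : ℕ} {l k : IntPartition} {c μ} (h : R (n + 1) l c μ)
    (h' : R (n + 1) k c fun _ => emp) (r : ℤ) : wt n r l = wt n r k + ∑ s, (μ s).size := by
  have : (wt n r l : ENNReal) = ((wt n r k + ∑ s, (μ s).size : ℕ) : ENNReal) := by
    push_cast
    simp only [size_eq, wt_eq]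
    simp only [G_R (Nat.succ_pos n) h h']
    push_cast
    rw [ENNReal.tsum_add, Summable.tsum_finsetSum (fun _ _ => ENNReal.summable)]
    congr 1
    refine Finset.sum_congr rfl fun s _ => ?_
    rw [← (Equiv.addRight ((((s : ℕ) : ℤ) - r) / ((n : ℤ) + 1) - c s)).tsum_eq (fun y => (G (μ s) y : ENNReal))]
    congr 1
    ext y
    congr 2
    simp only [Equiv.coe_addRight]
    rw [show ((n : ℤ) + 1) * y - r + ((s : ℕ) : ℤ) = ((n : ℤ) + 1) * y + (((s : ℕ) : ℤ) - r) by ring,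
      Int.mul_add_ediv_left _ _ (by omega)]
    ring
  exact_mod_cast this

theorem size_wt (n : ℕ) (l : IntPartition) : l.size = ∑ r ∈ Finset.range (n + 1), wt n r l := by
  classical
  unfold size wt
  have hA := diag_finite l
  obtain ⟨B, hB⟩ := hA.exists_finset_coe
  rw [← hB]
  have e : ∀ r : ℕ, {c : ℕ × ℕ | c ∈ (B : Set (ℕ × ℕ)) ∧ (c.1 : ℤ) - c.2 ≡ r [ZMOD ((n : ℤ) + 1)]} =
      ((B.filter fun c => (c.1 : ℤ) - c.2 ≡ r [ZMOD ((n : ℤ) + 1)] : Finset _) : Set (ℕ × ℕ)) := by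
    intro r; ext a; simp
  simp only [e, Set.ncard_coe_finset]
  rw [Finset.card_eq_sum_card_fiberwise (f := fun c => (((c.1 : ℤ) - c.2) % ((n : ℤ) + 1)).toNat)
    (t := Finset.range (n + 1))]
  · refine Finset.sum_congr rfl fun r hr => ?_
    congr 1
    ext c
    simp only [Finset.mem_filter, and_congr_right_iff]
    intro _
    have h1 := Int.emod_nonneg ((c.1 : ℤ) - c.2) (show (n : ℤ) + 1 ≠ 0 by omega)
    have hr' := Finset.mem_range.1 hr
    unfold Int.ModEq
    rw [Int.emod_eq_of_lt (a := (r : ℤ)) (by omega) (by omega)]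
    omega
  · intro c _
    have h1 := Int.emod_nonneg ((c.1 : ℤ) - c.2) (show (n : ℤ) + 1 ≠ 0 by omega)
    have h2 := Int.emod_lt_of_pos ((c.1 : ℤ) - c.2) (show 0 < (n : ℤ) + 1 by omega)
    simp only [Finset.coe_range, Set.mem_Iio]
    omega

end CQ

/-- the core–quotient bijection, compatible with all the weights
`wt_r` and with the total size. -/
theorem stmt4 (n : ℕ) (hn : 1 ≤ n) :
    ∃ Φ : IntPartition ≃ ({κ : IntPartition // IsCore n κ} × (Fin (n + 1) → IntPartition)),
      ∀ lam : IntPartition,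
        (∀ r : ℤ, IntPartition.wt n r lam
            = IntPartition.wt n r (Φ lam).1.val + ∑ i : Fin (n + 1), ((Φ lam).2 i).size) ∧
        lam.size = (Φ lam).1.val.size + (n + 1) * ∑ i : Fin (n + 1), ((Φ lam).2 i).size := by
  classical
  have hN : 0 < n + 1 := Nat.succ_pos n
  choose c μ hR using CQ.R_ex (n + 1)
  have hc : ∀ l, ∑ s, c l s = 0 := fun l => (CQ.charge_sum hN (hR l)).symm
  choose K hK using fun l => CQ.R_surj hN (hc l) (fun _ => CQ.emp)
  have hKc : ∀ l, IsCore n (K l) := fun l => (CQ.R_core (hK l)).2 rfl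
  let φ : IntPartition → {κ : IntPartition // IsCore n κ} × (Fin (n + 1) → IntPartition) :=
    fun l => (⟨K l, hKc l⟩, μ l)
  have hφ : Function.Bijective φ := by
    constructor
    · intro l l' h
      have h1 : K l = K l' := congrArg (fun p => p.1.1) h
      have h2 : μ l = μ l' := congrArg (fun p => p.2) h
      have h3 := hK l
      rw [h1] at h3
      have h4 := (CQ.R_uniq h3 (hK l')).1
      have h5 := hR l
      rw [h4, h2] at h5
      exact CQ.R_uniq' hN h5 (hR l')
    · rintro ⟨⟨κ, hκ⟩, ν⟩
      obtain ⟨l, hl⟩ := CQ.R_surj hN (hc κ) ν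
      have h1 := CQ.R_uniq (hR l) hl
      have h2 := hR κ
      rw [(CQ.R_core h2).1 hκ] at h2
      have h3 := hK l
      rw [h1.1] at h3
      refine ⟨l, Prod.ext (Subtype.ext (CQ.R_uniq' hN h3 h2)) h1.2⟩
  refine ⟨Equiv.ofBijective φ hφ, fun lam => ?_⟩
  have hw : ∀ r : ℤ, IntPartition.wt n r lam = IntPartition.wt n r (K lam) + ∑ i, (μ lam i).size :=
    fun r => CQ.wt_R (hR lam) (hK lam) r
  refine ⟨hw, ?_⟩
  change lam.size = (K lam).size + (n + 1) * ∑ i, (μ lam i).size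
  rw [CQ.size_wt n lam, CQ.size_wt n (K lam)]
  simp only [hw, Finset.sum_add_distrib, Finset.sum_const, Finset.card_range, smul_eq_mul]
end

section
/- Fix an integer n ≥ 1. For an (n+1)-core λ and r ∈ {1, …, n+1}, set a_r(λ) = #{p ∈ B(λ) : p > 0, p ≡ r (mod n+1)} − #{p ≤ 0 : p ∉ B(λ), p ≡ r (mod n+1)}. Then the map λ ↦ (a_1(λ), …, a_{n+1}(λ)) is a bijection from the set of (n+1)-cores onto the set {(a_1, …, a_{n+1}) ∈ ℤ^{n+1} : a_1 + … + a_{n+1} = 0}. -/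
namespace Aux

def bd (l : IntPartition) (k : ℕ) : ℤ := (l.parts k : ℤ) - k

theorem bd_anti (l : IntPartition) : StrictAnti (bd l) := by
  apply strictAnti_nat_of_succ_lt
  intro k
  have := l.antitone (Nat.le_succ k)
  simp only [bd]; push_cast; simp only [Nat.succ_eq_add_one] at this; omega

theorem mem_bead (l : IntPartition) (p : ℤ) : p ∈ l.beadSet ↔ ∃ k, bd l k = p := Iff.rfl

theorem range_bd (l : IntPartition) : Set.range (bd l) = l.beadSet := rfl

/-- content -/
def ct (c : ℕ × ℕ) : ℤ := (c.2 : ℤ) - c.1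

/-- If S is connected, content takes intermediate values. -/
theorem conn_interval {S : Set (ℕ × ℕ)} (x z : ℕ × ℕ) (hx : x ∈ S)
    (h : Relation.ReflTransGen (fun a b => a ∈ S ∧ b ∈ S ∧ CellAdj a b) x z) :
    ∀ t, ct x ≤ t → t ≤ ct z → ∃ w ∈ S, ct w = t := by
  induction h with
  | refl => intro t h1 h2; exact ⟨x, hx, le_antisymm h1 h2⟩
  | @tail b c _ hbc ih =>
    intro t h1 h2
    obtain ⟨hb, hc, hadj⟩ := hbc
    have : ct c ≤ ct b + 1 := by
      unfold CellAdj at hadj; simp only [ct]; omega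
    by_cases h3 : t ≤ ct b
    · exact ih t h1 h3
    · exact ⟨c, hc, by omega⟩

theorem core_of_closed (n : ℕ) (l : IntPartition)
    (h : ∀ p ∈ l.beadSet, p - ((n : ℤ) + 1) ∈ l.beadSet) : IsCore n l := by
  rintro ⟨m, hsub, hfin, hcard, hconn, h22⟩
  set S := l.diagram \ m.diagram with hS
  have hmem : ∀ i j, (i, j) ∈ S ↔ j < l.parts i ∧ m.parts i ≤ j := by
    intro i j; simp [hS, IntPartition.diagram]
  have hinj : Set.InjOn ct S := by
    have key : ∀ i j i' j', (i, j) ∈ S → (i', j') ∈ S → (j : ℤ) - i = j' - i' → ¬ i < i' := by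
      intro i j i' j' h1 h2 h3 h4
      rw [hmem] at h1 h2
      apply h22
      have a1 := l.antitone (show i + 1 ≤ i' by omega)
      have a2 := l.antitone (show i ≤ i + 1 by omega)
      have a3 := m.antitone (show i ≤ i + 1 by omega)
      refine ⟨i, j, ?_, ?_, ?_, ?_⟩ <;> rw [hmem] <;> omega
    rintro ⟨i, j⟩ h1 ⟨i', j'⟩ h2 h3
    simp only [ct] at h3
    have k1 := key i j i' j' h1 h2 h3
    have k2 := key i' j' i j h2 h1 h3.symm
    have : i = i' := by omega
    have : j = j' := by omega
    simp [*]
  have hne : S.Nonempty := by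
    apply Set.nonempty_of_ncard_ne_zero; omega
  obtain ⟨x, hx, hxmin⟩ := Set.exists_min_image S ct hfin hne
  obtain ⟨y, hy, hymax⟩ := Set.exists_max_image S ct hfin hne
  have himg : ct '' S = ↑(Finset.Icc (ct x) (ct y)) := by
    ext t
    simp only [Set.mem_image, Finset.coe_Icc, Set.mem_Icc]
    constructor
    · rintro ⟨w, hw, rfl⟩; exact ⟨hxmin w hw, hymax w hw⟩
    · rintro ⟨h1, h2⟩
      exact conn_interval x y hx (hconn x hx y hy) t h1 h2
  have hc2 := Set.ncard_image_of_injOn hinj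
  rw [himg, Set.ncard_coe_finset, Int.card_Icc, hcard] at hc2
  have hxy := hxmin y hy
  obtain ⟨i, c⟩ := y
  obtain ⟨j, d⟩ := x
  rw [hmem] at hx hy
  have hp : l.parts i = c + 1 := by
    by_contra hcon
    have := hymax (i, c + 1) (by rw [hmem]; omega)
    simp only [ct] at this; push_cast at this; omega
  have hb := h (bd l i) ⟨i, rfl⟩
  obtain ⟨k, hk⟩ := hb
  simp only [ct] at hc2 hxy
  simp only [bd] at hk
  have hq : (l.parts k : ℤ) - k = d - j := by rw [hk]; omega
  have hjk : j < k := by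
    by_contra hh
    have := l.antitone (show k ≤ j by omega)
    omega
  have a1 := l.antitone (show j + 1 ≤ k by omega)
  have a3 := m.antitone (show j ≤ j + 1 by omega)
  have := hxmin (j + 1, d) (by rw [hmem]; omega)
  simp only [ct] at this; push_cast at this; omega

theorem closed_of_core (n : ℕ) (l : IntPartition) (hcore : IsCore n l) :
    ∀ p ∈ l.beadSet, p - ((n : ℤ) + 1) ∈ l.beadSet := by
  rintro p ⟨i, hi⟩
  by_contra hq
  apply hcore
  set q := p - ((n : ℤ) + 1) with hqdef
  simp only at hi
  have hq' : ∀ k : ℕ, (l.parts k : ℤ) - k ≠ q := fun k hk => hq ⟨k, hk⟩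
  have hA : ∀ k, l.parts (k + 1) ≤ l.parts k := fun k => l.antitone (Nat.le_succ k)
  obtain ⟨N, hN⟩ := l.finite_support
  let f : ℕ → ℕ := fun k => if k < i then l.parts k else
    min (l.parts k) (max ((l.parts (k + 1) : ℤ) - 1) (q + k)).toNat
  have hf : ∀ k, f (k + 1) ≤ f k := by
    intro k
    have h1 := hA k
    have h2 := hA (k + 1)
    have h3 := hq' (k + 1)
    push_cast at h3
    simp only [f]
    push_cast
    split_ifs <;> omega
  let m : IntPartition := ⟨f, fun a b hab => antitone_nat_of_succ_le hf hab, ⟨N, fun k hk => by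
    have := hN k hk
    simp only [f]; split_ifs <;> omega⟩⟩
  have hmem : ∀ k c, (k, c) ∈ l.diagram \ m.diagram ↔
      i ≤ k ∧ c < l.parts k ∧ l.parts (k + 1) ≤ c + 1 ∧ q + k ≤ c := by
    intro k c
    simp only [IntPartition.diagram, Set.mem_diff, Set.mem_setOf_eq, m, f]
    split_ifs <;> omega
  refine ⟨m, ?_, ?_⟩
  · rintro ⟨k, c⟩ hk
    simp only [IntPartition.diagram, Set.mem_setOf_eq, m, f] at hk ⊢
    split_ifs at hk <;> omega
  set S := l.diagram \ m.diagram with hS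
  have hinj : Set.InjOn ct S := by
    have key : ∀ i j i' j', (i, j) ∈ S → (i', j') ∈ S → (j : ℤ) - i = j' - i' → ¬ i < i' := by
      intro i j i' j' h1 h2 h3 h4
      rw [hmem] at h1 h2
      have a1 := l.antitone (show i + 1 ≤ i' by omega)
      omega
    rintro ⟨i, j⟩ h1 ⟨i', j'⟩ h2 h3
    simp only [ct] at h3
    have k1 := key i j i' j' h1 h2 h3
    have k2 := key i' j' i j h2 h1 h3.symm
    have : i = i' := by omega
    have : j = j' := by omega
    simp [*]
  have hsurj : ∀ t, q ≤ t → t < p → ∃ w ∈ S, ct w = t := by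
    intro t h1 h2
    have hex : ∃ k, (l.parts k : ℤ) - k ≤ t := by
      refine ⟨max N (-t).toNat, ?_⟩
      have := hN (max N (-t).toNat) (le_max_left _ _)
      omega
    classical
    have hs := Nat.find_spec hex
    have hm := fun k => @Nat.find_min _ _ hex k
    set K := Nat.find hex
    have hiK : i < K := by
      by_contra hh
      have := l.antitone (show K ≤ i by omega)
      omega
    obtain ⟨k, hk⟩ : ∃ k, K = k + 1 := ⟨K - 1, by omega⟩
    rw [hk] at hs
    have hm' := hm k (by omega)
    have hpos : 0 ≤ t + k := by
      by_contra hneg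
      have h0 : l.parts (k + 1) = 0 := by push_cast at hs; omega
      have h5 := hq' (-q).toNat
      have h6 := l.antitone (show k + 1 ≤ (-q).toNat by push_cast at hs; omega)
      omega
    refine ⟨(k, (t + k).toNat), ?_, ?_⟩
    · rw [hmem]; push_cast at hs; omega
    · simp only [ct]; omega
  have hlt : ∀ w ∈ S, q ≤ ct w ∧ ct w < p := by
    rintro ⟨k, c⟩ hw
    rw [hmem] at hw
    have := l.antitone hw.1
    simp only [ct]; omega
  have himg : ct '' S = ↑(Finset.Ico q p) := by
    ext t
    simp only [Set.mem_image, Finset.coe_Ico, Set.mem_Ico]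
    constructor
    · rintro ⟨w, hw, rfl⟩; exact hlt w hw
    · rintro ⟨h1, h2⟩
      exact hsurj t h1 h2
  have hstep : ∀ a ∈ S, ∀ b ∈ S, ct b = ct a + 1 → CellAdj a b := by
    rintro ⟨k, c⟩ ha ⟨k', c'⟩ hb hab
    rw [hmem] at ha hb
    simp only [ct] at hab
    simp only [CellAdj]
    have e1 : ¬ k < k' := by
      intro hh
      have a1 := l.antitone (show k + 1 ≤ k' by omega)
      omega
    have e2 : ¬ k' + 1 < k := by
      intro hh
      have a1 := l.antitone (show k' + 2 ≤ k by omega)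
      have a2 := hA (k' + 1)
      have a3 := l.antitone (show k' + 1 ≤ k by omega)
      omega
    omega
  have hup : ∀ d : ℕ, ∀ a ∈ S, ∀ b ∈ S, ct b = ct a + d →
      Relation.ReflTransGen (fun a b => a ∈ S ∧ b ∈ S ∧ CellAdj a b) a b := by
    intro d
    induction d with
    | zero =>
      intro a ha b hb hab
      have : a = b := hinj ha hb (by simpa using hab.symm)
      rw [this]
    | succ d ih =>
      intro a ha b hb hab
      push_cast at hab
      have := hlt a ha
      have := hlt b hb
      obtain ⟨w, hw, hwt⟩ := hsurj (ct a + d) (by omega) (by omega)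
      exact (ih a ha w hw hwt).tail ⟨hw, hb, hstep w hw b hb (by omega)⟩
  have hsymm : ∀ a b, CellAdj a b → CellAdj b a := by
    intro a b h; unfold CellAdj at *; omega
  refine ⟨?_, ?_, ?_, ?_⟩
  · apply Set.Finite.of_finite_image _ hinj
    rw [himg]; exact Finset.finite_toSet _
  · rw [← Set.ncard_image_of_injOn hinj, himg, Set.ncard_coe_finset, Int.card_Ico]; omega
  · intro a ha b hb
    rcases le_total (ct a) (ct b) with h | h
    · exact hup (ct b - ct a).toNat a ha b hb (by omega)
    · have := hup (ct a - ct b).toNat b hb a ha (by omega)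
      rw [← Relation.reflTransGen_swap] at this
      exact Relation.ReflTransGen.mono (fun x y hxy => ⟨hxy.2.1, hxy.1, hsymm _ _ hxy.2.2⟩) _ _ this
  · rintro ⟨i, j, h1, -, -, h2⟩
    have := hinj h1 h2 (by simp [ct])
    simp at this

theorem bead_inj (l m : IntPartition) (h : l.beadSet = m.beadSet) : l = m := by
  have h1 : StrictMono (fun k => - bd l k) := (bd_anti l).neg
  have h2 : StrictMono (fun k => - bd m k) := (bd_anti m).neg
  have h3 : Set.range (fun k => - bd l k) = Set.range (fun k => - bd m k) := by
    have e : ∀ x : IntPartition, Set.range (fun k => - bd x k) = Neg.neg '' (x.beadSet) := by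
      intro x; rw [← range_bd, ← Set.range_comp]; rfl
    rw [e, e, h]
  have h4 := (StrictMono.range_inj h1 h2).1 h3
  have h5 : l.parts = m.parts := by
    funext k
    have := congrFun h4 k
    simp only [bd] at this; omega
  cases l; cases m; simp at h5; subst h5; rfl

theorem pos_iff (n : ℕ) (r : ℕ) (hr : r < n + 1) (k : ℤ) (N : ℤ) :
    -((n + 1) * N) < (r : ℤ) + 1 + (n + 1) * k ↔ -N ≤ k := by
  constructor
  · intro h; by_contra hk
    have : k + N ≤ -1 := by omega
    nlinarith
  · intro h
    have : 0 ≤ k + N := by omega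
    nlinarith

theorem param_eq (n : ℕ) (r : ℕ) (hr : r < n + 1) (l : IntPartition) (A : ℤ)
    (h : ∀ k : ℤ, (r : ℤ) + 1 + (n + 1) * k ∈ l.beadSet ↔ k < A) :
    abacusParam n (r + 1) l = A := by
  have hinj : Function.Injective (fun k : ℤ => (r : ℤ) + 1 + (n + 1) * k) := by
    intro a b hab
    have h0 : (n : ℤ) + 1 ≠ 0 := by omega
    simpa [h0] using hab
  have hpos : ∀ k, 0 < (r : ℤ) + 1 + (n + 1) * k ↔ 0 ≤ k := by
    intro k; simpa using pos_iff n r hr k 0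
  have hmod : ∀ p : ℤ, p ≡ (r : ℤ) + 1 [ZMOD ((n : ℤ) + 1)] →
      ∃ k, (r : ℤ) + 1 + (n + 1) * k = p := by
    intro p hp
    obtain ⟨k, hk⟩ := hp.symm.dvd
    exact ⟨k, by linarith⟩
  have hmod' : ∀ k : ℤ, (r : ℤ) + 1 + (n + 1) * k ≡ (r : ℤ) + 1 [ZMOD ((n : ℤ) + 1)] := by
    intro k
    apply Int.ModEq.symm
    rw [Int.modEq_iff_dvd]
    exact ⟨k, by ring⟩
  have e1 : {p : ℤ | p ∈ l.beadSet ∧ 0 < p ∧ p ≡ (r : ℤ) + 1 [ZMOD ((n : ℤ) + 1)]} =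
      ↑((Finset.Ico 0 A).image (fun k : ℤ => (r : ℤ) + 1 + (n + 1) * k)) := by
    ext p
    simp only [Set.mem_setOf_eq, Finset.coe_image, Set.mem_image, Finset.coe_Ico, Set.mem_Ico]
    constructor
    · rintro ⟨h1, h2, h3⟩
      obtain ⟨k, rfl⟩ := hmod p h3
      exact ⟨k, ⟨(hpos k).1 h2, (h k).1 h1⟩, rfl⟩
    · rintro ⟨k, ⟨h1, h2⟩, rfl⟩
      exact ⟨(h k).2 h2, (hpos k).2 h1, hmod' k⟩
  have e2 : {p : ℤ | p ≤ 0 ∧ p ∉ l.beadSet ∧ p ≡ (r : ℤ) + 1 [ZMOD ((n : ℤ) + 1)]} =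
      ↑((Finset.Ico A 0).image (fun k : ℤ => (r : ℤ) + 1 + (n + 1) * k)) := by
    ext p
    simp only [Set.mem_setOf_eq, Finset.coe_image, Set.mem_image, Finset.coe_Ico, Set.mem_Ico]
    constructor
    · rintro ⟨h1, h2, h3⟩
      obtain ⟨k, rfl⟩ := hmod p h3
      rw [h k] at h2
      have := hpos k
      exact ⟨k, ⟨by omega, by omega⟩, rfl⟩
    · rintro ⟨k, ⟨h1, h2⟩, rfl⟩
      have := hpos k
      exact ⟨by omega, by rw [h k]; omega, hmod' k⟩
  unfold abacusParam
  rw [e1, e2, Set.ncard_coe_finset, Set.ncard_coe_finset, Finset.card_image_of_injective _ hinj,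
    Finset.card_image_of_injective _ hinj, Int.card_Ico, Int.card_Ico]
  omega

theorem exists_thr (n : ℕ) (l : IntPartition)
    (h : ∀ p ∈ l.beadSet, p - ((n : ℤ) + 1) ∈ l.beadSet) (r : ℕ) (hr : r < n + 1) :
    ∃ A : ℤ, ∀ k : ℤ, (r : ℤ) + 1 + (n + 1) * k ∈ l.beadSet ↔ k < A := by
  obtain ⟨N, hN⟩ := l.finite_support
  have hdown : ∀ (j : ℕ) (k : ℤ), (r : ℤ) + 1 + (n + 1) * k ∈ l.beadSet →
      (r : ℤ) + 1 + (n + 1) * (k - j) ∈ l.beadSet := by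
    intro j
    induction j with
    | zero => intro k hk; simpa using hk
    | succ j ih =>
      intro k hk
      have := h _ (ih k hk)
      convert this using 1
      push_cast; ring
  have hbdd : ∃ b : ℤ, ∀ k : ℤ, (r : ℤ) + 1 + (n + 1) * k ∈ l.beadSet → k ≤ b := by
    refine ⟨l.parts 0, ?_⟩
    rintro k ⟨i, hi⟩
    simp only at hi
    have := l.antitone (Nat.zero_le i)
    by_contra hk
    have : (r : ℤ) + 1 + (n + 1) * k ≤ l.parts 0 := by omega
    nlinarith
  have hne : ∃ k : ℤ, (r : ℤ) + 1 + (n + 1) * k ∈ l.beadSet := by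
    refine ⟨-(N + 1), ?_⟩
    have h1 : (r : ℤ) + 1 + (n + 1) * (-(N + 1)) ≤ -N := by nlinarith
    refine ⟨(-((r : ℤ) + 1 + (n + 1) * (-(N + 1)))).toNat, ?_⟩
    simp only
    rw [hN _ (by omega)]
    omega
  obtain ⟨B, hB, hmax⟩ := Int.exists_greatest_of_bdd hbdd hne
  refine ⟨B + 1, fun k => ⟨fun hk => by have := hmax k hk; omega, fun hk => ?_⟩⟩
  have := hdown (B - k).toNat B hB
  rwa [show B - ((B - k).toNat : ℤ) = k by omega] at this

theorem repr (n : ℕ) (p : ℤ) : ∃ r : Fin (n + 1), ∃ k : ℤ, (r : ℤ) + 1 + (n + 1) * k = p := by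
  have h1 := Int.emod_nonneg (p - 1) (show (n : ℤ) + 1 ≠ 0 by omega)
  have h2 := Int.emod_lt_of_pos (p - 1) (show 0 < (n : ℤ) + 1 by omega)
  have h3 := Int.emod_add_mul_ediv (p - 1) ((n : ℤ) + 1)
  refine ⟨⟨((p - 1) % ((n : ℤ) + 1)).toNat, by omega⟩, (p - 1) / ((n : ℤ) + 1), ?_⟩
  simp only [Int.toNat_of_nonneg h1]
  linarith

theorem repr_inj (n : ℕ) (r r' : Fin (n + 1)) (k k' : ℤ)
    (h : (r : ℤ) + 1 + (n + 1) * k = (r' : ℤ) + 1 + (n + 1) * k') : r = r' ∧ k = k' := by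
  have hr := r.isLt
  have hr' := r'.isLt
  have hk : k = k' := by
    rcases lt_trichotomy k k' with hh | hh | hh
    · exfalso
      have : k + 1 ≤ k' := hh
      nlinarith
    · exact hh
    · exfalso
      have : k' + 1 ≤ k := hh
      nlinarith
  subst hk
  refine ⟨Fin.ext ?_, rfl⟩
  have : (r : ℤ) = r' := by linarith
  exact_mod_cast this

theorem charge (n : ℕ) (a : Fin (n + 1) → ℤ) (b : ℕ → ℤ) (hb : StrictAnti b) (c : ℤ) (K : ℕ)
    (hK : ∀ k, K ≤ k → b k = c - k)
    (h : ∀ (r : Fin (n + 1)) (k : ℤ), (r : ℤ) + 1 + (n + 1) * k ∈ Set.range b ↔ k < a r) :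
    c = ∑ r, a r := by
  set N : ℤ := ∑ r, |a r| + |c| + K + 1 with hN
  have hs : 0 ≤ ∑ r, |a r| := Finset.sum_nonneg (fun r _ => abs_nonneg (a r))
  have hNa : ∀ r, 0 ≤ a r + N := by
    intro r
    have h1 : |a r| ≤ ∑ r, |a r| :=
      Finset.single_le_sum (f := fun r => |a r|) (fun r _ => abs_nonneg (a r)) (Finset.mem_univ r)
    have h2 := neg_abs_le (a r)
    have h3 := abs_nonneg c
    omega
  have hMN : N ≤ (n + 1) * N := by
    have h3 := abs_nonneg c
    have : 0 ≤ N := by omega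
    nlinarith
  have hcK : (K : ℤ) < c + (n + 1) * N := by
    have := neg_abs_le c
    omega
  have hkey : (Finset.univ.sigma (fun r : Fin (n + 1) => Finset.Ico (-N) (a r))).image
      (fun x => (x.1 : ℤ) + 1 + (n + 1) * x.2) =
      (Finset.range (c + (n + 1) * N).toNat).image b := by
    have hb' : ∀ k, -((n + 1) * N) < b k ↔ k < (c + (n + 1) * N).toNat := by
      intro k
      rcases le_total K k with hk | hk
      · rw [hK k hk]; omega
      · have h1 := hb.antitone hk
        rw [hK K le_rfl] at h1
        constructor <;> intro <;> omega
    ext p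
    simp only [Finset.mem_image, Finset.mem_sigma, Finset.mem_univ, true_and, Finset.mem_Ico,
      Finset.mem_range]
    constructor
    · rintro ⟨⟨r, k⟩, ⟨h1, h2⟩, rfl⟩
      obtain ⟨i, hi⟩ := (h r k).2 h2
      refine ⟨i, ?_, hi⟩
      rw [← hb', hi]
      exact (pos_iff n r r.isLt k N).2 h1
    · rintro ⟨i, hi, rfl⟩
      obtain ⟨r, k, hrk⟩ := repr n (b i)
      rw [← hb', ← hrk] at hi
      exact ⟨⟨r, k⟩, ⟨(pos_iff n r r.isLt k N).1 hi, (h r k).1 ⟨i, hrk.symm⟩⟩, hrk⟩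
  have hcard := congrArg Finset.card hkey
  rw [Finset.card_image_of_injective _ hb.injective, Finset.card_image_of_injective,
    Finset.card_sigma, Finset.card_range] at hcard
  · have h2 := congrArg (Nat.cast : ℕ → ℤ) hcard
    rw [Int.toNat_of_nonneg (by omega)] at h2
    push_cast at h2
    have h3 : ∀ r : Fin (n + 1), ((Finset.Ico (-N) (a r)).card : ℤ) = a r + N := by
      intro r; rw [Int.card_Ico]; have := hNa r; omega
    simp only [h3, Finset.sum_add_distrib, Finset.sum_const, Finset.card_univ, Fintype.card_fin,
      nsmul_eq_mul] at h2
    push_cast at h2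
    linarith
  · rintro ⟨r, k⟩ ⟨r', k'⟩ hh
    obtain ⟨rfl, rfl⟩ := repr_inj n r r' k k' hh
    rfl

/-- Enumeration of a set of integers bounded above and containing all small integers. -/
theorem enum (S : Set ℤ) (U L : ℤ) (hU : ∀ p ∈ S, p ≤ U) (hL : ∀ p, p ≤ L → p ∈ S) :
    ∃ b : ℕ → ℤ, StrictAnti b ∧ Set.range b = S ∧ ∃ c : ℤ, ∃ K : ℕ, ∀ k, K ≤ k → b k = c - k := by
  have hinf : (setOf (fun m : ℕ => U - (m : ℤ) ∈ S)).Infinite := by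
    rw [Set.infinite_iff_exists_gt]
    intro a
    refine ⟨max (a + 1) (U - L).toNat, ?_, by omega⟩
    exact hL _ (by omega)
  refine ⟨fun k => U - (Nat.nth (fun m : ℕ => U - (m : ℤ) ∈ S) k : ℤ), ?_, ?_, ?_⟩
  · intro i j hij
    have := Nat.nth_strictMono hinf hij
    simp only; omega
  · ext p
    constructor
    · rintro ⟨k, rfl⟩
      exact Nat.nth_mem_of_infinite hinf k
    · intro hp
      have h1 : (U - p).toNat ∈ Set.range (Nat.nth (fun m : ℕ => U - (m : ℤ) ∈ S)) := by
        rw [Nat.range_nth_of_infinite hinf]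
        have := hU p hp
        simp only [Set.mem_setOf_eq]
        rwa [Int.toNat_of_nonneg (by omega), sub_sub_cancel]
      obtain ⟨k, hk⟩ := h1
      have := hU p hp
      exact ⟨k, by simp only [hk]; omega⟩
  · set g := Nat.nth (fun m : ℕ => U - (m : ℤ) ∈ S) with hg
    have hmono : StrictMono g := Nat.nth_strictMono hinf
    have hr : Set.range g = _ := Nat.range_nth_of_infinite hinf
    set K := (U - L).toNat
    have hKg : ∀ k, k ≤ g k := fun k => hmono.le_apply
    have hstep : ∀ k, K ≤ k → g (k + 1) = g k + 1 := by
      intro k hk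
      have h1 : g k + 1 ∈ Set.range g := by
        rw [hr]
        have := hKg k
        exact hL _ (by push_cast; omega)
      obtain ⟨m, hm⟩ := h1
      have h2 : k < m := by
        rw [← hmono.lt_iff_lt]; omega
      have h3 := hmono.monotone (show k + 1 ≤ m from h2)
      have h4 := hmono (Nat.lt_succ_self k)
      simp only [Nat.succ_eq_add_one] at h4
      omega
    refine ⟨U - g K + K, K, fun k hk => ?_⟩
    induction k, hk using Nat.le_induction with
    | base => simp
    | succ k hk ih =>
      simp only at ih ⊢
      rw [hstep k hk]; push_cast; linarith

theorem exists_part (n : ℕ) (a : Fin (n + 1) → ℤ) (ha : ∑ r, a r = 0) :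
    ∃ l : IntPartition, ∀ (r : Fin (n + 1)) (k : ℤ),
      (r : ℤ) + 1 + (n + 1) * k ∈ l.beadSet ↔ k < a r := by
  let S : Set ℤ := {p | ∃ (r : Fin (n + 1)) (k : ℤ), (r : ℤ) + 1 + (n + 1) * k = p ∧ k < a r}
  have hS : ∀ (r : Fin (n + 1)) (k : ℤ), (r : ℤ) + 1 + (n + 1) * k ∈ S ↔ k < a r := by
    intro r k
    constructor
    · rintro ⟨r', k', h1, h2⟩
      obtain ⟨rfl, rfl⟩ := repr_inj n _ _ _ _ h1
      exact h2
    · intro h; exact ⟨r, k, rfl, h⟩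
  set N : ℤ := ∑ r, |a r| with hN
  have hNa : ∀ r, |a r| ≤ N := fun r =>
      Finset.single_le_sum (f := fun r => |a r|) (fun r _ => abs_nonneg (a r)) (Finset.mem_univ r)
  obtain ⟨b, hb, hrange, c, K, hK⟩ := enum S ((n + 1) * N + n + 1) (-((n + 1) * N))
    (by
      rintro p ⟨r, k, rfl, hk⟩
      have := hNa r
      have := le_abs_self (a r)
      have := r.isLt
      have : k ≤ N := by omega
      nlinarith)
    (by
      intro p hp
      obtain ⟨r, k, rfl⟩ := repr n p
      rw [hS]
      have h1 := pos_iff n r r.isLt k N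
      have := hNa r
      have := neg_abs_le (a r)
      by_contra hcon
      have := h1.2 (by omega)
      omega)
  have hc : c = 0 := by
    rw [← ha]
    exact charge n a b hb c K hK (by rw [hrange]; exact hS)
  subst hc
  have hanti : Antitone (fun k : ℕ => b k + k) := by
    apply antitone_nat_of_succ_le
    intro k
    have := hb (Nat.lt_succ_self k)
    simp only [Nat.succ_eq_add_one] at this
    push_cast; omega
  have hnn : ∀ k : ℕ, 0 ≤ b k + k := by
    intro k
    have h1 := hanti (le_max_left k K)
    have h2 := hK (max k K) (le_max_right _ _)
    simp only at h1
    omega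
  let l : IntPartition := ⟨fun k => (b k + k).toNat, fun i j hij => Int.toNat_le_toNat (hanti hij),
    ⟨K, fun k hk => by simp only [hK k hk]; omega⟩⟩
  refine ⟨l, ?_⟩
  have : l.beadSet = S := by
    rw [← hrange]
    unfold IntPartition.beadSet
    congr 1
    funext k
    have := hnn k
    simp only [l]; omega
  rw [this]
  exact hS

end Aux

open Aux in
/-- the abacus parameters give a bijection from `(n+1)`-cores onto
`{(a_1, …, a_{n+1}) ∈ ℤ^{n+1} : Σ a_r = 0}`. -/
theorem stmt5 (n : ℕ) (hn : 1 ≤ n) :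
    Function.Injective (fun κ : {lam : IntPartition // IsCore n lam} =>
        fun r : Fin (n + 1) => abacusParam n ((r : ℕ) + 1) κ.val) ∧
      Set.range (fun κ : {lam : IntPartition // IsCore n lam} =>
        fun r : Fin (n + 1) => abacusParam n ((r : ℕ) + 1) κ.val)
        = {a : Fin (n + 1) → ℤ | ∑ r, a r = 0} := by
  have hthr : ∀ l : IntPartition, IsCore n l → ∀ (r : Fin (n + 1)) (k : ℤ),
      (r : ℤ) + 1 + (n + 1) * k ∈ l.beadSet ↔ k < abacusParam n ((r : ℕ) + 1) l := by
    intro l hl r k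
    obtain ⟨A, hA⟩ := exists_thr n l (closed_of_core n l hl) r r.isLt
    rw [param_eq n r r.isLt l A hA]
    exact hA k
  constructor
  · rintro ⟨l, hl⟩ ⟨m, hm⟩ h
    apply Subtype.ext
    apply bead_inj
    ext p
    obtain ⟨r, k, rfl⟩ := repr n p
    have := congrFun h r
    simp only at this
    rw [hthr l hl, hthr m hm, this]
  · ext a
    simp only [Set.mem_range, Set.mem_setOf_eq]
    constructor
    · rintro ⟨⟨l, hl⟩, rfl⟩
      obtain ⟨N, hN⟩ := l.finite_support
      refine (charge n _ (bd l) (bd_anti l) 0 N ?_ (hthr l hl)).symm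
      intro k hk
      simp [bd, hN k hk]
    · intro ha
      obtain ⟨l, hl⟩ := exists_part n a ha
      refine ⟨⟨l, core_of_closed n l ?_⟩, ?_⟩
      · intro p hp
        obtain ⟨r, k, rfl⟩ := repr n p
        rw [hl] at hp
        have := (hl r (k - 1)).2 (by omega)
        convert this using 1
        ring
      · funext r
        exact param_eq n r r.isLt l (a r) (hl r)
end

section
/- For every integer n ≥ 1 and every integer m ≥ 0, the set of partitions λ with wt_0(λ) = m is finite; that is, there are only finitely many partitions having exactly m cells (i,j) with i ≡ j (mod n+1). -/
theorem IntPartition.diagram_finite (l : IntPartition) : l.diagram.Finite := by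
  obtain ⟨N, hN⟩ := l.finite_support
  refine ((Set.finite_Iio N).prod (Set.finite_Iio (l.parts 0))).subset ?_
  rintro ⟨i, j⟩ h
  have h' : j < l.parts i := h
  have h0 := l.antitone (Nat.zero_le i)
  refine ⟨?_, ?_⟩
  · by_contra hc
    have := hN i (not_lt.mp hc)
    omega
  · show j < l.parts 0
    omega

theorem IntPartition.lt_wt (n m : ℕ) (l : IntPartition) (f : ℕ → ℕ × ℕ)
    (hf : Function.Injective f) (hd : ∀ k ≤ m, f k ∈ l.diagram)
    (hc : ∀ k, (((f k).1 : ℤ) - ((f k).2 : ℤ)) ≡ 0 [ZMOD ((n : ℤ) + 1)]) :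
    m < IntPartition.wt n 0 l := by
  have h1 : (f '' (Set.Iic m)).ncard = m + 1 := by
    rw [Set.ncard_image_of_injective _ hf, ← Finset.coe_Iic, Set.ncard_coe_finset]
    simp
  have h2 : (f '' (Set.Iic m)).ncard ≤ IntPartition.wt n 0 l := by
    apply Set.ncard_le_ncard _ (l.diagram_finite.subset fun c hc => hc.1)
    rintro _ ⟨k, hk, rfl⟩
    exact ⟨hd k hk, hc k⟩
  omega

/-- for every `m` there are only finitely many partitions with
exactly `m` cells of content `≡ 0 (mod n+1)`. -/
theorem stmt7 (n : ℕ) (hn : 1 ≤ n) (m : ℕ) :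
    {lam : IntPartition | IntPartition.wt n 0 lam = m}.Finite := by
  have key : ∀ lam : IntPartition, IntPartition.wt n 0 lam = m →
      lam.parts 0 ≤ m * (n + 1) ∧ lam.parts (m * (n + 1)) = 0 := by
    intro lam h
    constructor
    · by_contra hc
      have := IntPartition.lt_wt n m lam (fun k => (0, k * (n + 1)))
        (fun a b hab => by simpa using hab)
        (fun k hk => by
          show k * (n + 1) < lam.parts 0
          have := Nat.mul_le_mul_right (n + 1) hk
          omega)
        (fun k => (Int.modEq_zero_iff_dvd).2 ⟨-k, by push_cast; ring⟩)
      omega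
    · by_contra hc
      have := IntPartition.lt_wt n m lam (fun k => (k * (n + 1), 0))
        (fun a b hab => by simpa using hab)
        (fun k hk => by
          show 0 < lam.parts (k * (n + 1))
          have := lam.antitone (Nat.mul_le_mul_right (n + 1) hk)
          omega)
        (fun k => (Int.modEq_zero_iff_dvd).2 ⟨k, by push_cast; ring⟩)
      omega
  generalize m * (n + 1) = M at key
  refine Set.Finite.of_finite_image
    (f := fun (lam : IntPartition) (i : Fin M) => lam.parts i) ?_ ?_
  · refine (Set.Finite.pi' (fun _ : Fin M => Set.finite_Iic M)).subset ?_
    rintro _ ⟨lam, h, rfl⟩ i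
    exact (lam.antitone (Nat.zero_le _)).trans (key lam h).1
  · intro a ha b hb hab
    have : a.parts = b.parts := by
      funext i
      by_cases hi : i < M
      · exact congrFun hab ⟨i, hi⟩
      · have h1 := a.antitone (not_lt.mp hi)
        have h2 := b.antitone (not_lt.mp hi)
        have h3 := (key a ha).2
        have h4 := (key b hb).2
        omega
    cases a
    cases b
    cases this
    rfl
end

section
/- Let n ≥ 1 and let ξ ∈ ℂ be a primitive (n+2)-nd root of unity. For every integer m ≥ 0, the sum over the (finite) set of all partitions λ with wt_0(λ) = m of ξ raised to the power (wt_1(λ) + wt_2(λ) + … + wt_n(λ)) − n·m equals the number of 0-generated partitions λ with wt_0(λ) = m. (This is the coefficient-wise form of the substitution identity Z⁰_Δ(q) = Z_Δ(q_0,…,q_n) at q_0 = ξ^{−n}q, q_1 = … = q_n = ξ.) -/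
namespace Stmt9

open IntPartition Finset

theorem lower_exists (P : ℕ → Prop) (hd : ∀ j, P (j+1) → P j) (L : ℕ) (hL : ¬ P L) :
    ∃ b, ∀ j, P j ↔ j < b := by
  classical
  have hex : ∃ b, ¬ P b := ⟨L, hL⟩
  refine ⟨Nat.find hex, fun j => ⟨fun hj => ?_, fun hj => ?_⟩⟩
  · by_contra hlt
    have hle : Nat.find hex ≤ j := by omega
    have : ∀ k, P (Nat.find hex + k) → P (Nat.find hex) := by
      intro k
      induction k with
      | zero => exact id
      | succ k ih => exact fun h => ih (hd _ h)
    exact Nat.find_spec hex (this (j - Nat.find hex) (by rwa [Nat.add_sub_cancel' hle]))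
  · exact not_not.mp (Nat.find_min hex hj)

theorem mem_diagram (l : IntPartition) (i j : ℕ) : (i, j) ∈ l.diagram ↔ j < l.parts i := Iff.rfl

theorem diag_lower (l : IntPartition) {i j i' j' : ℕ} (h : (i, j) ∈ l.diagram)
    (hi : i' ≤ i) (hj : j' ≤ j) : (i', j') ∈ l.diagram := by
  rw [mem_diagram] at *
  have := l.antitone hi
  omega

theorem diag_box (l : IntPartition) : ∃ L : ℕ, ∀ i j, (i, j) ∈ l.diagram → i < L ∧ j < L := by
  obtain ⟨N, hN⟩ := l.finite_support
  refine ⟨N + l.parts 0, fun i j h => ?_⟩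
  rw [mem_diagram] at h
  have h0 := l.antitone (Nat.zero_le i)
  have : i < N := by
    by_contra hc
    have := hN i (by omega)
    omega
  omega

theorem diag_finite (l : IntPartition) : l.diagram.Finite := by
  obtain ⟨L, hL⟩ := diag_box l
  refine Set.Finite.subset (Finset.finite_toSet (range L ×ˢ range L)) ?_
  rintro ⟨i, j⟩ h
  have := hL i j h
  simp [this]

theorem diag_inj {l m : IntPartition} (h : l.diagram = m.diagram) : l = m := by
  have : l.parts = m.parts := by
    funext i
    have key : ∀ j, j < l.parts i ↔ j < m.parts i := fun j => by
      rw [← mem_diagram, ← mem_diagram, h]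
    have h1 := key (l.parts i)
    have h2 := key (m.parts i)
    omega
  cases l; cases m; simp_all

theorem exists_of_lower (S : Set (ℕ × ℕ)) (L : ℕ) (hL : ∀ i j, (i, j) ∈ S → i < L ∧ j < L)
    (h1 : ∀ i j, (i+1, j) ∈ S → (i, j) ∈ S) (h2 : ∀ i j, (i, j+1) ∈ S → (i, j) ∈ S) :
    ∃ l : IntPartition, l.diagram = S := by
  have : ∀ i, ∃ b, ∀ j, (i, j) ∈ S ↔ j < b := fun i =>
    lower_exists (fun j => (i, j) ∈ S) (h2 i) L (fun h => by have := hL _ _ h; omega)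
  choose p hp using this
  refine ⟨⟨p, ?_, L, ?_⟩, ?_⟩
  · apply antitone_nat_of_succ_le
    intro i
    by_contra hc
    have := (hp i (p i)).1 (h1 _ _ ((hp (i+1) (p i)).2 (by omega)))
    omega
  · intro i hi
    by_contra hc
    have := hL _ _ ((hp i 0).2 (by omega))
    omega
  · ext ⟨i, j⟩
    rw [mem_diagram]
    exact (hp i j).symm

theorem ht_exists (l : IntPartition) (c : ℤ) :
    ∃ b, ∀ t : ℕ, (t + c.toNat, t + (-c).toNat) ∈ l.diagram ↔ t < b := by
  obtain ⟨L, hL⟩ := diag_box l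
  exact lower_exists (fun t : ℕ => (t + c.toNat, t + (-c).toNat) ∈ l.diagram)
    (fun j h => diag_lower l h (by omega) (by omega)) L
    (fun h => by have := hL _ _ h; omega)

noncomputable def ht (l : IntPartition) (c : ℤ) : ℕ := (ht_exists l c).choose

theorem ht_spec (l : IntPartition) (c : ℤ) (t : ℕ) :
    (t + c.toNat, t + (-c).toNat) ∈ l.diagram ↔ t < ht l c := (ht_exists l c).choose_spec t

theorem mem_iff (l : IntPartition) (i j : ℕ) :
    (i, j) ∈ l.diagram ↔ min i j < ht l ((i:ℤ) - j) := by
  rw [← ht_spec]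
  have h1 : min i j + ((i:ℤ) - j).toNat = i := by omega
  have h2 : min i j + (-((i:ℤ) - j)).toNat = j := by omega
  rw [h1, h2]

theorem ht_unique (l : IntPartition) (d : ℤ → ℕ)
    (h : ∀ i j : ℕ, (i, j) ∈ l.diagram ↔ min i j < d ((i:ℤ) - j)) (c : ℤ) : ht l c = d c := by
  have key : ∀ t, t < ht l c ↔ t < d c := by
    intro t
    rw [← ht_spec, h]
    have h1 : min (t + c.toNat) (t + (-c).toNat) = t := by omega
    have h2 : ((t + c.toNat : ℕ) : ℤ) - ((t + (-c).toNat : ℕ) : ℤ) = c := by omega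
    rw [h1, h2]
  have h1 := key (ht l c)
  have h2 := key (d c)
  omega

theorem ht_inj {l m : IntPartition} (h : ∀ c, ht l c = ht m c) : l = m := by
  apply diag_inj
  ext ⟨i, j⟩
  rw [mem_iff, mem_iff, h]

/-- indicator of nonnegative -/
def nn (c : ℤ) : ℤ := if 0 ≤ c then 1 else 0

theorem ht_step (l : IntPartition) (c : ℤ) :
    (ht l (c+1) : ℤ) - ht l c + nn c = 0 ∨ (ht l (c+1) : ℤ) - ht l c + nn c = 1 := by
  unfold nn
  split_ifs with hc
  · have a1 : ht l (c+1) ≤ ht l c := by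
      by_contra hlt
      have := (ht_spec l (c+1) (ht l c)).2 (by omega)
      have := (ht_spec l c (ht l c)).1 (diag_lower l this (by omega) (by omega))
      omega
    have a2 : ht l c ≤ ht l (c+1) + 1 := by
      by_contra hlt
      have := (ht_spec l c (ht l (c+1) + 1)).2 (by omega)
      have := (ht_spec l (c+1) (ht l (c+1))).1 (diag_lower l this (by omega) (by omega))
      omega
    omega
  · have a1 : ht l c ≤ ht l (c+1) := by
      by_contra hlt
      have := (ht_spec l c (ht l (c+1))).2 (by omega)
      have := (ht_spec l (c+1) (ht l (c+1))).1 (diag_lower l this (by omega) (by omega))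
      omega
    have a2 : ht l (c+1) ≤ ht l c + 1 := by
      by_contra hlt
      have := (ht_spec l (c+1) (ht l c + 1)).2 (by omega)
      have := (ht_spec l c (ht l c)).1 (diag_lower l this (by omega) (by omega))
      omega
    omega

theorem exists_of_ht (d : ℤ → ℕ) (L : ℕ) (h0 : ∀ c : ℤ, (L:ℤ) ≤ |c| → d c = 0)
    (hs : ∀ c, (d (c+1) : ℤ) - d c + nn c = 0 ∨ (d (c+1) : ℤ) - d c + nn c = 1) :
    ∃ l : IntPartition, ∀ c, ht l c = d c := by
  obtain ⟨B, hB⟩ : ∃ B : ℕ, ∀ c, d c ≤ B := by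
    refine ⟨∑ c ∈ Finset.Icc (-(L:ℤ)) L, d c, fun c => ?_⟩
    by_cases hc : c ∈ Finset.Icc (-(L:ℤ)) L
    · exact Finset.single_le_sum (f := d) (fun _ _ => Nat.zero_le _) hc
    · rw [h0 c]
      · exact Nat.zero_le _
      · rw [Finset.mem_Icc] at hc
        by_contra hlt
        push Not at hlt
        rw [abs_lt] at hlt
        omega
  obtain ⟨l, hl⟩ : ∃ l : IntPartition, l.diagram = {p : ℕ × ℕ | min p.1 p.2 < d ((p.1:ℤ) - p.2)} := by
    refine exists_of_lower _ (B + L) ?_ ?_ ?_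
    · intro i j h
      simp only [Set.mem_ofPred_eq] at h
      have h1 := hB ((i:ℤ) - j)
      have h2 : |(i:ℤ) - j| < L := by
        by_contra hc
        have := h0 _ (not_lt.1 hc)
        omega
      rw [abs_lt] at h2
      omega
    · intro i j h
      simp only [Set.mem_ofPred_eq] at h ⊢
      have := hs ((i:ℤ) - j)
      have e : ((i+1:ℕ):ℤ) - j = (i:ℤ) - j + 1 := by push_cast; ring
      rw [e] at h
      unfold nn at this
      split_ifs at this <;> omega
    · intro i j h
      simp only [Set.mem_ofPred_eq] at h ⊢
      have := hs ((i:ℤ) - (j+1:ℕ))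
      have e : (i:ℤ) - (j+1:ℕ) + 1 = (i:ℤ) - j := by push_cast; ring
      rw [e] at this
      unfold nn at this
      split_ifs at this <;> omega
  refine ⟨l, ht_unique l d fun i j => ?_⟩
  rw [hl]; rfl

/-! weights -/

theorem ht_card (l : IntPartition) (c : ℤ) :
    ((diag_finite l).toFinset.filter (fun p => (p.1:ℤ) - p.2 = c)).card = ht l c := by
  rw [← Finset.card_range (ht l c)]
  symm
  apply Finset.card_bij (fun t _ => (t + c.toNat, t + (-c).toNat))
  · intro t ht'
    simp only [Finset.mem_filter, Set.Finite.mem_toFinset]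
    refine ⟨(ht_spec l c t).2 (by simpa using ht'), by push_cast; omega⟩
  · intro a _ b _ h
    simpa using h
  · rintro ⟨i, j⟩ h
    simp only [Finset.mem_filter, Set.Finite.mem_toFinset] at h
    obtain ⟨h1, h2⟩ := h
    refine ⟨min i j, ?_, ?_⟩
    · rw [mem_iff, h2] at h1; simpa using h1
    · ext <;> simp only <;> omega

theorem wt_eq (n M : ℕ) (l : IntPartition) (h0 : ∀ c : ℤ, (M * (n + 1) : ℤ) ≤ |c| → ht l c = 0)
    (r : ℕ) (hr : r ≤ n) :
    IntPartition.wt n r l = ∑ k ∈ Finset.Ico (-(M:ℤ)) M, ht l (k * (n+1) + r) := by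
  have e : {c : ℕ × ℕ | c ∈ l.diagram ∧ ((c.1 : ℤ) - (c.2 : ℤ)) ≡ r [ZMOD ((n : ℤ) + 1)]}
      = ((diag_finite l).toFinset.filter
        (fun c => ((c.1 : ℤ) - (c.2 : ℤ)) ≡ r [ZMOD ((n : ℤ) + 1)]) : Finset _) := by
    ext c; simp
  unfold IntPartition.wt
  rw [e, Set.ncard_coe_finset,
    Finset.card_eq_sum_card_fiberwise (f := fun p : ℕ × ℕ => ((p.1:ℤ) - p.2) / ((n:ℤ)+1))
      (t := Finset.Ico (-(M:ℤ)) M)]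
  · refine Finset.sum_congr rfl fun k _ => ?_
    rw [← ht_card, Finset.filter_filter]
    congr 1
    ext ⟨i, j⟩
    simp only [Finset.mem_filter, and_congr_right_iff]
    intro _
    have hr' : (r:ℤ) % (n+1) = r := Int.emod_eq_of_lt (by omega) (by omega)
    constructor
    · rintro ⟨h1, h2⟩
      unfold Int.ModEq at h1
      rw [hr'] at h1
      rw [← Int.mul_ediv_add_emod ((i:ℤ) - j) (n+1), h1, h2]; ring
    · intro h
      rw [h]
      constructor
      · simp [Int.ModEq]
      · rw [add_comm, Int.add_mul_ediv_right _ _ (by omega), Int.ediv_eq_zero_of_lt (by omega) (by omega)]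
        simp
  · rintro ⟨i, j⟩ h
    simp only [Finset.coe_filter, Set.mem_ofPred_eq, Set.Finite.mem_toFinset] at h
    have h1 := h.1
    rw [mem_iff] at h1
    have h2 : |(i:ℤ) - j| < M * (n+1) := by
      by_contra hc
      have := h0 _ (not_lt.1 hc)
      omega
    rw [abs_lt] at h2
    simp only [Finset.coe_Ico, Set.mem_Ico]
    constructor
    · rw [Int.le_ediv_iff_mul_le (by omega)]; linarith
    · rw [Int.ediv_lt_iff_lt_mul (by omega)]; linarith

theorem ht_zero (n m : ℕ) (l : IntPartition) (h : IntPartition.wt n 0 l = m) (c : ℤ)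
    (hc : (m * (n + 1) : ℤ) ≤ |c|) : ht l c = 0 := by
  by_contra hne
  have hmem := (ht_spec l c 0).2 (by omega)
  have hfin : {c : ℕ × ℕ | c ∈ l.diagram ∧ ((c.1 : ℤ) - (c.2 : ℤ)) ≡ 0 [ZMOD ((n : ℤ) + 1)]}.Finite :=
    (diag_finite l).subset fun _ h => h.1
  have hc' : m * (n+1) ≤ c.natAbs := by zify; exact hc
  unfold IntPartition.wt at h
  have hle : ∀ k ∈ range (m+1), k * (n+1) ≤ c.natAbs := fun k hk =>
    le_trans (Nat.mul_le_mul_right _ (by simp at hk; omega)) hc'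
  have : (range (m+1)).card ≤ m := by
    refine le_trans ?_ h.le
    rcases le_total 0 c with h0 | h0
    · rw [← Set.ncard_coe_finset]
      refine Set.ncard_le_ncard_of_injOn (fun k : ℕ => (k * (n+1), 0)) ?_ ?_ hfin
      · intro k hk
        refine ⟨diag_lower l hmem ?_ (by omega), ?_⟩
        · have := hle k (Finset.mem_coe.1 hk); omega
        · simp [Int.ModEq]
      · intro a _ b _ hab
        simpa using hab
    · rw [← Set.ncard_coe_finset]
      refine Set.ncard_le_ncard_of_injOn (fun k : ℕ => (0, k * (n+1))) ?_ ?_ hfin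
      · intro k hk
        refine ⟨diag_lower l hmem (by omega) ?_, ?_⟩
        · have := hle k (Finset.mem_coe.1 hk); omega
        · simp [Int.ModEq]
      · intro a _ b _ hab
        simpa using hab
  simp at this

theorem T_finite (n m : ℕ) : {l : IntPartition | IntPartition.wt n 0 l = m}.Finite := by
  have : (IntPartition.diagram '' {l : IntPartition | IntPartition.wt n 0 l = m}).Finite := by
    refine Set.Finite.subset (Set.Finite.finite_subsets
      (Finset.finite_toSet (range (m*(n+1)) ×ˢ range (m*(n+1))))) ?_
    rintro _ ⟨l, hl, rfl⟩
    rintro ⟨i, j⟩ hij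
    have a1 := diag_lower l hij (le_refl i) (Nat.zero_le j)
    have a2 := diag_lower l hij (Nat.zero_le i) (le_refl j)
    rw [mem_iff] at a1 a2
    simp only [Finset.coe_product, Finset.coe_range, Set.mem_prod, Set.mem_Iio]
    constructor
    · by_contra hc
      have := ht_zero n m l hl ((i:ℤ) - (0:ℕ)) (by
        simp only [Nat.cast_zero, sub_zero, Nat.abs_cast]; exact_mod_cast not_lt.1 hc)
      omega
    · by_contra hc
      have := ht_zero n m l hl (((0:ℕ):ℤ) - j) (by
        simp only [Nat.cast_zero, zero_sub, abs_neg, Nat.abs_cast]; exact_mod_cast not_lt.1 hc)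
      omega
  exact Set.Finite.of_finite_image this (fun a _ b _ h => diag_inj h)

/-! zero generated -/

theorem zg_sub (n : ℕ) {l m : IntPartition} (hl : ZeroGenerated n l)
    (h : ∀ k : ℤ, ht l (k * (n+1)) = ht m (k * (n+1))) : m.diagram ⊆ l.diagram := by
  have key : ∀ s i j : ℕ, i + j = s → (i, j) ∈ m.diagram → (i, j) ∈ l.diagram := by
    intro s
    induction s using Nat.strong_induction_on with
    | _ s ih =>
      intro i j hs hm
      by_contra hnl
      have hadd : Addable l (i, j) := by
        refine ⟨hnl, ?_⟩
        obtain ⟨L, hL⟩ := diag_box l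
        apply exists_of_lower _ (L + i + j + 1)
        · rintro a b (hab | hab)
          · have := hL _ _ hab; omega
          · simp only [Set.mem_singleton_iff, Prod.mk.injEq] at hab; omega
        · rintro a b (hab | hab)
          · exact Or.inl (diag_lower l hab (by omega) le_rfl)
          · simp only [Set.mem_singleton_iff, Prod.mk.injEq] at hab
            obtain ⟨rfl, rfl⟩ := hab
            exact Or.inl (ih (a + b) (by omega) a b rfl (diag_lower m hm (by omega) le_rfl))
        · rintro a b (hab | hab)
          · exact Or.inl (diag_lower l hab le_rfl (by omega))
          · simp only [Set.mem_singleton_iff, Prod.mk.injEq] at hab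
            obtain ⟨rfl, rfl⟩ := hab
            exact Or.inl (ih (a + b) (by omega) a b rfl (diag_lower m hm le_rfl (by omega)))
      have h0 := hl _ hadd
      obtain ⟨k, hk⟩ := (Int.modEq_zero_iff_dvd.1 h0)
      simp only at hk
      rw [mem_iff, hk, mul_comm, h k, mul_comm, ← hk, ← mem_iff] at hnl
      exact hnl hm
  rintro ⟨i, j⟩ hm
  exact key _ i j rfl hm

theorem zg_exists (n m : ℕ) (l : IntPartition) (hl : IntPartition.wt n 0 l = m) :
    ∃ l', ZeroGenerated n l' ∧ IntPartition.wt n 0 l' = m ∧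
      ∀ k : ℤ, ht l' (k * (n+1)) = ht l (k * (n+1)) := by
  have hfin : {l' : IntPartition | IntPartition.wt n 0 l' = m ∧
      ∀ k : ℤ, ht l' (k * (n+1)) = ht l (k * (n+1))}.Finite :=
    (T_finite n m).subset fun _ h => h.1
  obtain ⟨l', ⟨h1, h2⟩, h3⟩ := Set.exists_max_image _ (fun l' => l'.diagram.ncard) hfin
    ⟨l, hl, fun _ => rfl⟩
  refine ⟨l', ?_, h1, h2⟩
  rintro ⟨i, j⟩ ⟨hn, l'', hl''⟩
  by_contra hne
  have hin : ∀ a b : ℕ, ((a:ℤ) - b) ≡ 0 [ZMOD ((n : ℤ) + 1)] →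
      ((a, b) ∈ l''.diagram ↔ (a, b) ∈ l'.diagram) := by
    intro a b hab
    rw [hl'']
    constructor
    · rintro (h | h)
      · exact h
      · simp only [Set.mem_singleton_iff, Prod.mk.injEq] at h
        obtain ⟨rfl, rfl⟩ := h
        exact absurd hab hne
    · exact Or.inl
  have := h3 l'' ⟨?_, ?_⟩
  · rw [hl'', Set.union_singleton, Set.ncard_insert_of_notMem hn (diag_finite l')] at this
    omega
  · rw [← h1]
    unfold IntPartition.wt
    congr 1
    ext ⟨a, b⟩
    simp only [Set.mem_ofPred_eq]
    constructor
    · rintro ⟨x, y⟩; exact ⟨(hin a b y).1 x, y⟩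
    · rintro ⟨x, y⟩; exact ⟨(hin a b y).2 x, y⟩
  · intro k
    rw [← h2 k]
    have key : ∀ t, t < ht l'' (k * (n+1)) ↔ t < ht l' (k * (n+1)) := by
      intro t
      rw [← ht_spec, ← ht_spec]
      apply hin
      have : ((t + (k * ((n:ℤ)+1)).toNat : ℕ) : ℤ) - ((t + (-(k * ((n:ℤ)+1))).toNat : ℕ) : ℤ)
          = k * (n+1) := by omega
      rw [this]
      simp [Int.ModEq]
    have h1 := key (ht l' (k * (n+1)))
    have h2 := key (ht l'' (k * (n+1)))
    omega
/-! root of unity sums -/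

theorem coeff_prod (f : ℕ → ℂ) (s : Finset ℕ) (a : ℕ) :
    (∏ i ∈ s, (1 + Polynomial.C (f i) * Polynomial.X)).coeff a
      = ∑ E ∈ s.powersetCard a, ∏ i ∈ E, f i := by
  rw [Finset.prod_one_add, Polynomial.finsetSum_coeff]
  have : ∀ E ∈ s.powerset, (∏ i ∈ E, (Polynomial.C (f i) * Polynomial.X)).coeff a
      = if E.card = a then ∏ i ∈ E, f i else 0 := by
    intro E _
    rw [Finset.prod_mul_distrib, Finset.prod_const, ← map_prod, Polynomial.coeff_C_mul_X_pow]
    simp [eq_comm]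
  rw [Finset.sum_congr rfl this, ← Finset.sum_filter]
  congr 1
  ext E
  simp [Finset.mem_powersetCard]

theorem esymm_root (n : ℕ) (ξ : ℂ) (hξ : IsPrimitiveRoot ξ (n + 2)) (a : ℕ) (ha : a ≤ n + 1) :
    ∑ E ∈ (range (n+1)).powersetCard a, ∏ p ∈ E, ξ ^ p = (-ξ⁻¹) ^ a := by
  have hξ0 : ξ ≠ 0 := hξ.ne_zero (by omega)
  have hinv : ξ ^ (n+1) = ξ⁻¹ := by
    apply eq_inv_of_mul_eq_one_left; rw [← pow_succ]; exact hξ.pow_eq_one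
  rw [← coeff_prod]
  set P : Polynomial ℂ := ∏ i ∈ range (n+1), (1 + Polynomial.C (ξ^i) * Polynomial.X) with hP
  have hcomp : (1 + Polynomial.X) * P.comp (Polynomial.C ξ * Polynomial.X)
      = (1 + Polynomial.C (ξ^(n+1)) * Polynomial.X) * P := by
    have e1 := Finset.prod_range_succ' (fun i => (1 + Polynomial.C (ξ^i) * Polynomial.X)) (n+1)
    have e2 := Finset.prod_range_succ (fun i => (1 + Polynomial.C (ξ^i) * Polynomial.X)) (n+1)
    rw [mul_comm _ P, hP, ← e2, e1, mul_comm, Polynomial.prod_comp]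
    congr 1
    · refine Finset.prod_congr rfl fun i _ => ?_
      simp [pow_succ, mul_assoc]
    · simp
  induction a with
  | zero =>
    rw [hP, coeff_prod]; simp
  | succ a ih =>
    have ih := ih (by omega)
    have h := congrArg (fun q => Polynomial.coeff q (a+1)) hcomp
    simp only [add_mul, one_mul, Polynomial.coeff_add, Polynomial.coeff_X_mul, mul_assoc,
      Polynomial.coeff_C_mul, Polynomial.comp_C_mul_X_coeff, ih, hinv] at h
    have hne : 1 - ξ ^ (a+1) ≠ 0 := by
      rw [sub_ne_zero]
      exact (hξ.pow_ne_one_of_pos_of_lt (by omega) (by omega)).symm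
    apply mul_left_cancel₀ hne
    rw [pow_succ (-ξ⁻¹) a]
    have h2 : ξ ^ (a+1) * ξ⁻¹ = ξ ^ a := by rw [pow_succ]; field_simp
    linear_combination -h - (-ξ⁻¹)^a * h2

theorem segment (n : ℕ) (ξ : ℂ) (hξ : IsPrimitiveRoot ξ (n + 2)) (a : ℕ) (ha : a ≤ n + 1) :
    ∑ E ∈ (range (n+1)).powersetCard a,
      ξ ^ (∑ r ∈ Finset.Icc 1 n, (E.filter (· < r)).card) = (-ξ⁻¹) ^ a := by
  have h1 : ∀ E ∈ (range (n+1)).powersetCard a,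
      ξ ^ (∑ r ∈ Finset.Icc 1 n, (E.filter (· < r)).card) = ∏ p ∈ E, ξ ^ (n + 1 - 1 - p) := by
    intro E _
    rw [Finset.prod_pow_eq_pow_sum]
    congr 1
    simp_rw [Finset.card_filter]
    rw [Finset.sum_comm]
    refine Finset.sum_congr rfl fun p _ => ?_
    rw [← Finset.card_filter]
    have : (Finset.Icc 1 n).filter (p < ·) = Finset.Ioc p n := by
      ext r; simp; omega
    rw [this, Nat.card_Ioc]
    omega
  rw [Finset.sum_congr rfl h1, ← esymm_root n ξ hξ a ha, ← coeff_prod, ← coeff_prod]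
  congr 1
  exact Finset.prod_range_reflect (fun i => (1 + Polynomial.C (ξ^i) * Polynomial.X)) (n+1)

/-- sum with the twist -/
theorem segment' (n : ℕ) (ξ : ℂ) (hξ : IsPrimitiveRoot ξ (n + 2)) (a : ℕ) (ha : a ≤ n + 1)
    (k g g' : ℤ) (hg : (a : ℤ) = g' - g + (n+1) * nn k) :
    ∑ E ∈ (range (n+1)).powersetCard a,
      ξ ^ (∑ r ∈ Finset.Icc 1 n, (((E.filter (· < r)).card : ℤ) - r * nn k)) =
        (-ξ⁻¹) ^ g' / (-ξ⁻¹) ^ g := by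
  have hξ0 : ξ ≠ 0 := hξ.ne_zero (by omega)
  have hξ1 : -ξ⁻¹ ≠ 0 := by simpa using hξ0
  have hfull : ξ ^ (∑ r ∈ Finset.Icc 1 n, r) = (-ξ⁻¹) ^ (n+1) := by
    rw [← segment n ξ hξ (n+1) le_rfl]
    have : (range (n+1)).powersetCard (n+1) = {range (n+1)} := by
      have h := Finset.powersetCard_self (range (n+1))
      rwa [Finset.card_range] at h
    rw [this, Finset.sum_singleton]
    congr 1
    refine Finset.sum_congr rfl fun r hr => ?_
    have : (range (n+1)).filter (· < r) = range r := by
      ext x; simp at hr ⊢; omega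
    rw [this, Finset.card_range]
  have h1 : ∀ E ∈ (range (n+1)).powersetCard a,
      ξ ^ (∑ r ∈ Finset.Icc 1 n, (((E.filter (· < r)).card : ℤ) - r * nn k))
      = ξ ^ (∑ r ∈ Finset.Icc 1 n, (E.filter (· < r)).card) * (-ξ⁻¹) ^ (-((n+1) * nn k)) := by
    intro E _
    rw [Finset.sum_sub_distrib, zpow_sub₀ hξ0, ← Finset.sum_mul, div_eq_mul_inv, zpow_neg]
    have t1 : ξ ^ (∑ r ∈ Finset.Icc 1 n, ((E.filter (· < r)).card : ℤ))
        = ξ ^ (∑ r ∈ Finset.Icc 1 n, (E.filter (· < r)).card) := by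
      rw [← Nat.cast_sum, zpow_natCast]
    have t2 : ξ ^ ((∑ r ∈ Finset.Icc 1 n, (r:ℤ)) * nn k) = (-ξ⁻¹) ^ (((n:ℤ)+1) * nn k) := by
      rw [zpow_mul, zpow_mul]
      congr 1
      rw [← Nat.cast_sum, zpow_natCast, hfull, ← zpow_natCast]
      push_cast; rfl
    rw [t1, t2]
  rw [Finset.sum_congr rfl h1, ← Finset.sum_mul, segment n ξ hξ a ha, ← zpow_natCast,
    ← zpow_add₀ hξ1, ← zpow_sub₀ hξ1, hg]
  congr 1
  ring

/-! edge sets -/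

theorem nn_block (n : ℕ) (k : ℤ) (j : ℕ) (hj : j < n + 1) : nn (k * (n+1) + j) = nn k := by
  unfold nn
  congr 1
  apply propext
  constructor
  · intro h
    by_contra hk
    have : (k+1) * ((n:ℤ)+1) ≤ 0 := mul_nonpos_of_nonpos_of_nonneg (by omega) (by omega)
    linarith [(by exact_mod_cast hj : (j:ℤ) < n + 1)]
  · intro h
    positivity

noncomputable def edge (n : ℕ) (l : IntPartition) (k : ℤ) : Finset ℕ :=
  (range (n+1)).filter fun j =>
    (ht l (k * (n+1) + j + 1) : ℤ) - ht l (k * (n+1) + j) + nn k = 1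

theorem edge_card (n : ℕ) (l : IntPartition) (k : ℤ) (j : ℕ) (hj : j ≤ n + 1) :
    (((edge n l k).filter (· < j)).card : ℤ)
      = ht l (k * (n+1) + j) - ht l (k * (n+1)) + j * nn k := by
  induction j with
  | zero => simp
  | succ j ih =>
    have ih := ih (by omega)
    have hs := ht_step l (k * (n+1) + j)
    rw [nn_block n k j (by omega)] at hs
    have e1 : k * ((n:ℤ)+1) + ((j+1:ℕ):ℤ) = k * (n+1) + j + 1 := by push_cast; ring
    rw [e1]
    have e2 : ((j+1:ℕ):ℤ) * nn k = j * nn k + nn k := by push_cast; ring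
    rw [e2]
    by_cases hm : j ∈ edge n l k
    · have : (edge n l k).filter (· < j+1) = insert j ((edge n l k).filter (· < j)) := by
        ext x; simp only [Finset.mem_filter, Finset.mem_insert]
        constructor
        · rintro ⟨h1, h2⟩
          rcases Nat.lt_succ_iff_lt_or_eq.1 h2 with h | h
          · exact Or.inr ⟨h1, h⟩
          · exact Or.inl h
        · rintro (rfl | ⟨h1, h2⟩)
          · exact ⟨hm, by omega⟩
          · exact ⟨h1, by omega⟩
      rw [this, Finset.card_insert_of_notMem (by simp)]
      unfold edge at hm
      rw [Finset.mem_filter] at hm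
      push_cast
      unfold edge at ih ⊢
      linarith [hm.2]
    · have : (edge n l k).filter (· < j+1) = (edge n l k).filter (· < j) := by
        ext x; simp only [Finset.mem_filter]
        constructor
        · rintro ⟨h1, h2⟩
          rcases Nat.lt_succ_iff_lt_or_eq.1 h2 with h | h
          · exact ⟨h1, h⟩
          · exact absurd (h ▸ h1) hm
        · rintro ⟨h1, h2⟩
          exact ⟨h1, by omega⟩
      rw [this]
      have h0 : ¬ ((ht l (k * (n+1) + j + 1) : ℤ) - ht l (k * (n+1) + j) + nn k = 1) := by
        intro h
        apply hm
        unfold edge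
        rw [Finset.mem_filter]
        exact ⟨by simp; omega, h⟩
      rcases hs with h | h
      · linarith
      · exact absurd h h0

theorem edge_sub (n : ℕ) (l : IntPartition) (k : ℤ) : edge n l k ⊆ range (n+1) :=
  Finset.filter_subset _ _

theorem edge_card' (n : ℕ) (l : IntPartition) (k : ℤ) :
    ((edge n l k).card : ℤ) = ht l ((k+1) * (n+1)) - ht l (k * (n+1)) + (n+1) * nn k := by
  have h := edge_card n l k (n+1) le_rfl
  have e : (edge n l k).filter (· < n+1) = edge n l k := by
    apply Finset.filter_true_of_mem
    intro x hx
    simpa using edge_sub n l k hx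
  rw [e] at h
  rw [h]
  have : k * ((n:ℤ)+1) + ((n+1:ℕ):ℤ) = (k+1) * (n+1) := by push_cast; ring
  rw [this]
  push_cast; ring

/-- existence of a partition with given edge sets -/
theorem exists_of_edge (n M : ℕ) (g : ℤ → ℕ) (E : ℤ → Finset ℕ)
    (hsub : ∀ k, E k ⊆ range (n+1))
    (hg : ∀ k : ℤ, (M:ℤ) ≤ |k| → g k = 0)
    (hcard : ∀ k, ((E k).card : ℤ) = g (k+1) - g k + (n+1) * nn k) :
    ∃ l : IntPartition, (∀ k : ℤ, ht l (k * (n+1)) = g k) ∧ (∀ k, edge n l k = E k) ∧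
      (∀ c : ℤ, (M * (n + 1) : ℤ) ≤ |c| → ht l c = 0) := by
  set D : ℤ → ℤ → ℤ := fun k j => g k + ((E k).filter (fun x : ℕ => (x:ℤ) < j)).card - j * nn k with hD
  have hD0 : ∀ k, D k 0 = g k := fun k => by
    simp only [hD]
    rw [Finset.filter_false_of_mem (fun x _ => by omega)]
    simp
  have hDN : ∀ k, D k (n+1) = g (k+1) := fun k => by
    simp only [hD]
    rw [Finset.filter_true_of_mem (fun x hx => by have := hsub k hx; simp at this; omega), hcard]
    ring
  have hDs : ∀ k (j : ℕ), D k (j+1) - D k j + nn k = if j ∈ E k then 1 else 0 := by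
    intro k j
    simp only [hD]
    have : (E k).filter (fun x : ℕ => (x:ℤ) < j + 1)
        = (E k).filter (fun x : ℕ => (x:ℤ) < j) ∪ (E k).filter (fun x : ℕ => x = j) := by
      rw [← Finset.filter_or]
      apply Finset.filter_congr
      intro x _
      omega
    rw [this, Finset.card_union_of_disjoint]
    · rw [Finset.filter_eq']
      split_ifs <;> simp <;> ring
    · rw [Finset.disjoint_left]
      intro x h1 h2
      simp only [Finset.mem_filter] at h1 h2
      omega
  have hDnn : ∀ k (j : ℕ), j ≤ n + 1 → 0 ≤ D k j := by
    intro k j hj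
    by_cases hk : 0 ≤ k
    · have hmono : ∀ i : ℕ, D k (n+1) ≤ D k ((n + 1 - i : ℕ)) := by
        intro i
        induction i with
        | zero => simp
        | succ i ih =>
          by_cases hi : i < n + 1
          · have := hDs k (n + 1 - (i+1))
            have e : ((n + 1 - (i+1) : ℕ) : ℤ) + 1 = ((n + 1 - i : ℕ) : ℤ) := by omega
            rw [e] at this
            have e3 : nn k = 1 := by simp [nn, hk]
            rw [e3] at this
            split_ifs at this <;> linarith
          · have e : n + 1 - (i+1) = n + 1 - i := by omega
            rw [e]; exact ih
      have := hmono (n + 1 - j)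
      rw [Nat.sub_sub_self hj, hDN] at this
      omega
    · simp only [hD]
      have e3 : nn k = 0 := by simp [nn, hk]
      rw [e3, mul_zero, sub_zero]
      positivity
  have hN : (0:ℤ) < n + 1 := by omega
  have hdm : ∀ c : ℤ, ∃ k : ℤ, ∃ j : ℕ, j < n + 1 ∧ c = k * (n+1) + j := by
    intro c
    refine ⟨c / (n+1), (c % (n+1)).toNat, ?_, ?_⟩
    · have := Int.emod_lt_of_pos c hN
      omega
    · have := Int.emod_nonneg c hN.ne'
      rw [Int.toNat_of_nonneg this, mul_comm]
      exact (Int.mul_ediv_add_emod c _).symm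
  set d : ℤ → ℕ := fun c => (D (c / (n+1)) (c % (n+1))).toNat with hd
  have hdv' : ∀ (k : ℤ) (j : ℕ), j < n + 1 → (d (k * (n+1) + j) : ℤ) = D k j := by
    intro k j hj
    simp only [hd]
    have e1 : (k * ((n:ℤ)+1) + j) / (n+1) = k := by
      rw [add_comm, Int.add_mul_ediv_right _ _ hN.ne', Int.ediv_eq_zero_of_lt (by omega) (by omega)]
      simp
    have e2 : (k * ((n:ℤ)+1) + j) % (n+1) = j := by
      rw [add_comm, Int.add_mul_emod_self_right]
      exact Int.emod_eq_of_lt (by omega) (by omega)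
    rw [e1, e2, Int.toNat_of_nonneg (hDnn k j hj.le)]
  have hdv : ∀ (k : ℤ) (j : ℕ), j ≤ n + 1 → (d (k * (n+1) + j) : ℤ) = D k j := by
    intro k j hj
    rcases Nat.lt_or_eq_of_le hj with h | rfl
    · exact hdv' k j h
    · have := hdv' (k+1) 0 (by omega)
      have e : k * ((n:ℤ)+1) + ((n+1:ℕ):ℤ) = (k+1) * (n+1) + ((0:ℕ):ℤ) := by push_cast; ring
      rw [e, this]
      push_cast
      rw [hD0, hDN]
  have hds : ∀ (k : ℤ) (j : ℕ), j < n + 1 →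
      (d (k * (n+1) + j + 1) : ℤ) - d (k * (n+1) + j) + nn k = if j ∈ E k then 1 else 0 := by
    intro k j hj
    rw [← hDs, hdv k j hj.le]
    have := hdv k (j+1) hj
    push_cast at this
    rw [← add_assoc] at this
    rw [this]
  have hzero : ∀ c : ℤ, (M * (n + 1) : ℤ) ≤ |c| → d c = 0 := by
    intro c hc
    obtain ⟨k, j, hj, rfl⟩ := hdm c
    have hv := hdv k j hj.le
    have hj' : (j:ℤ) < n + 1 := by exact_mod_cast hj
    by_cases hk : 0 ≤ k
    · have hMk : (M:ℤ) ≤ k := by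
        rw [abs_of_nonneg (by positivity)] at hc
        by_contra hlt
        have : (k + 1) * ((n:ℤ)+1) ≤ M * (n+1) := mul_le_mul_of_nonneg_right (by omega) (by omega)
        linarith
      have g1 := hg k (by rw [abs_of_nonneg hk]; exact hMk)
      have g2 := hg (k+1) (by rw [abs_of_nonneg (by omega)]; omega)
      have hfull : E k = range (n+1) := by
        apply Finset.eq_of_subset_of_card_le (hsub k)
        have := hcard k
        simp [g1, g2, nn, hk] at this
        simp; omega
      have : D k j = 0 := by
        simp only [hD]
        have : (E k).filter (fun x : ℕ => (x:ℤ) < j) = range j := by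
          rw [hfull]; ext x; simp; omega
        rw [this]
        simp [g1, nn, hk]
      omega
    · have hMk : k ≤ -(M:ℤ) := by
        have : (k + 1) * ((n:ℤ)+1) ≤ 0 := mul_nonpos_of_nonpos_of_nonneg (by omega) (by omega)
        rw [abs_of_nonpos (by linarith)] at hc
        by_contra hlt
        have : (-(M:ℤ) + 1) * ((n:ℤ)+1) ≤ k * (n+1) :=
          mul_le_mul_of_nonneg_right (by omega) (by omega)
        have hj0 : 0 ≤ (j:ℤ) := by omega
        linarith
      have g1 := hg k (by rw [abs_of_nonpos (by omega)]; omega)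
      have hz : D k j = 0 := by
        rcases Nat.eq_zero_or_pos j with rfl | hjp
        · have := hD0 k
          rw [g1] at this
          exact_mod_cast this
        · have h1 : k ≠ -(M:ℤ) := by
            rintro rfl
            have : (-(M:ℤ) + 1) * ((n:ℤ)+1) ≤ 0 :=
              mul_nonpos_of_nonpos_of_nonneg (by omega) (by omega)
            rw [abs_of_nonpos (by linarith)] at hc
            have : (0:ℤ) < j := by exact_mod_cast hjp
            linarith
          have g2 := hg (k+1) (by rw [abs_of_nonpos (by omega)]; omega)
          have := hcard k
          simp [g1, g2, nn, hk] at this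
          simp [hD, g1, this, nn, hk]
      omega
  obtain ⟨l, hl⟩ : ∃ l : IntPartition, ∀ c, ht l c = d c := by
    refine exists_of_ht d (M * (n+1)) ?_ ?_
    · intro c hc; exact hzero c (by push_cast at hc; exact hc)
    · intro c
      obtain ⟨k, j, hj, rfl⟩ := hdm c
      rw [nn_block n k j hj, hds k j hj]
      split_ifs <;> simp
  · refine ⟨l, fun k => ?_, fun k => ?_, fun c hc => by rw [hl]; exact hzero c hc⟩
    · have := hdv k 0 (by omega)
      rw [hl]
      push_cast at this
      rw [hD0, add_zero] at this
      exact_mod_cast this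
    · ext j
      unfold edge
      rw [Finset.mem_filter, hl, hl]
      constructor
      · rintro ⟨h1, h2⟩
        rw [hds k j (by simpa using h1)] at h2
        by_contra hc
        simp [hc] at h2
      · intro h
        have h1 := hsub k h
        refine ⟨h1, ?_⟩
        rw [hds k j (by simpa using h1)]
        simp [h]
theorem abs_mul_le (n M : ℕ) (k : ℤ) (h : (M:ℤ) ≤ |k|) : (M * (n+1) : ℤ) ≤ |k * (n+1)| := by
  rw [abs_mul, abs_of_nonneg (by omega : (0:ℤ) ≤ n + 1)]
  exact mul_le_mul_of_nonneg_right h (by omega)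

theorem prod_telescope (f : ℤ → ℂ) (hf : ∀ k, f k ≠ 0) (a : ℤ) (L : ℕ) :
    ∏ k ∈ Finset.Ico a (a + L), f (k+1) / f k = f (a + L) / f a := by
  induction L with
  | zero => simp [div_self (hf a)]
  | succ L ih =>
    have : Finset.Ico a (a + ((L+1 : ℕ):ℤ)) = insert (a + (L:ℤ)) (Finset.Ico a (a + L)) := by
      ext x; simp only [Finset.mem_Ico, Finset.mem_insert]; omega
    rw [this, Finset.prod_insert (by simp), ih]
    have e : a + ((L+1 : ℕ):ℤ) = a + L + 1 := by push_cast; ring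
    rw [e]
    field_simp [hf]

theorem weight_eq (n m : ℕ) (l : IntPartition) (hl : IntPartition.wt n 0 l = m) :
    (∑ r ∈ Finset.Icc 1 n, (IntPartition.wt n (r : ℤ) l : ℤ)) - (n : ℤ) * m
      = ∑ k ∈ Finset.Ico (-(m:ℤ)) m, ∑ r ∈ Finset.Icc 1 n,
        ((((edge n l k).filter (· < r)).card : ℤ) - r * nn k) := by
  have h0 := ht_zero n m l hl
  have hm := wt_eq n m l h0 0 (by omega)
  have hm' : (m : ℤ) = ∑ k ∈ Finset.Ico (-(m:ℤ)) m, (ht l (k * (n+1)) : ℤ) := by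
    rw [← Nat.cast_sum]
    simp only [Nat.cast_zero, add_zero] at hm
    rw [← hm, hl]
  have h1 : ∀ r ∈ Finset.Icc 1 n, (IntPartition.wt n (r : ℤ) l : ℤ)
      = ∑ k ∈ Finset.Ico (-(m:ℤ)) m, (ht l (k * (n+1) + r) : ℤ) := by
    intro r hr
    rw [wt_eq n m l h0 r (by simp at hr; omega)]
    push_cast; rfl
  rw [Finset.sum_congr rfl h1, Finset.sum_comm]
  conv_lhs => rw [hm']
  rw [Finset.mul_sum, ← hm', ← Finset.sum_sub_distrib]
  refine Finset.sum_congr rfl fun k _ => ?_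
  have h2 : ∀ r ∈ Finset.Icc 1 n, ((((edge n l k).filter (· < r)).card : ℤ) - r * nn k)
      = ht l (k * (n+1) + r) - ht l (k * (n+1)) := by
    intro r hr
    rw [edge_card n l k r (by simp at hr; omega)]
    ring
  rw [Finset.sum_congr rfl h2, Finset.sum_sub_distrib]
  simp

theorem fiber_sum (n m : ℕ) (ξ : ℂ) (hξ : IsPrimitiveRoot ξ (n + 2))
    (l₀ : IntPartition) (hl₀ : IntPartition.wt n 0 l₀ = m) (F : Finset IntPartition)
    (hF : ∀ l, l ∈ F ↔ IntPartition.wt n 0 l = m ∧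
      ∀ k : ℤ, ht l (k * (n+1)) = ht l₀ (k * (n+1))) :
    ∑ l ∈ F, ξ ^ ((∑ r ∈ Finset.Icc 1 n, (IntPartition.wt n (r : ℤ) l : ℤ)) - (n : ℤ) * m) = 1 := by
  have hξ0 : ξ ≠ 0 := hξ.ne_zero (by omega)
  have hξ1 : -ξ⁻¹ ≠ 0 := by simpa using hξ0
  have hcard : ∀ l ∈ F, ∀ k, (edge n l k).card = (edge n l₀ k).card := by
    intro l hl k
    zify
    rw [edge_card', edge_card', ((hF l).1 hl).2, ((hF l).1 hl).2]
  set W : ℤ → Finset ℕ → ℂ := fun k E =>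
    ξ ^ (∑ r ∈ Finset.Icc 1 n, (((E.filter (· < r)).card : ℤ) - r * nn k)) with hW
  set I := Finset.Ico (-(m:ℤ)) m with hI
  have step1 : ∑ l ∈ F, ξ ^ ((∑ r ∈ Finset.Icc 1 n, (IntPartition.wt n (r : ℤ) l : ℤ)) - (n : ℤ) * m)
      = ∑ E ∈ Fintype.piFinset (fun k : I => (range (n+1)).powersetCard (edge n l₀ k).card),
        ∏ k : I, W k (E k) := by
    refine Finset.sum_bij (fun l _ => fun k : I => edge n l k) ?_ ?_ ?_ ?_
    · intro l hl
      rw [Fintype.mem_piFinset]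
      intro k
      rw [Finset.mem_powersetCard]
      exact ⟨edge_sub _ _ _, hcard l hl k⟩
    · intro a ha b hb hab
      have ha' := (hF a).1 ha
      have hb' := (hF b).1 hb
      apply ht_inj
      intro c
      by_cases hc : (m * (n+1) : ℤ) ≤ |c|
      · rw [ht_zero n m a ha'.1 c hc, ht_zero n m b hb'.1 c hc]
      · have hN : (0:ℤ) < n + 1 := by omega
        rw [not_le, abs_lt] at hc
        have hk : c / (n+1) ∈ I := by
          rw [hI, Finset.mem_Ico]
          constructor
          · rw [Int.le_ediv_iff_mul_le hN]; linarith
          · rw [Int.ediv_lt_iff_lt_mul hN]; linarith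
        have he : edge n a (c / (n+1)) = edge n b (c / (n+1)) := congrFun hab ⟨_, hk⟩
        have hj1 := Int.emod_lt_of_pos c hN
        have hj0 := Int.emod_nonneg c hN.ne'
        have h1 := edge_card n a (c / (n+1)) (c % (n+1)).toNat (by omega)
        have h2 := edge_card n b (c / (n+1)) (c % (n+1)).toNat (by omega)
        have e : c / ((n:ℤ)+1) * (n+1) + ((c % ((n:ℤ)+1)).toNat : ℤ) = c := by
          rw [Int.toNat_of_nonneg hj0, mul_comm]
          exact Int.mul_ediv_add_emod c _
        rw [e] at h1 h2
        rw [he, h2, ha'.2, hb'.2] at h1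
        have : (ht a c : ℤ) = ht b c := by linarith
        exact_mod_cast this
    · intro E hE
      rw [Fintype.mem_piFinset] at hE
      obtain ⟨l, h1, h2, hz⟩ := exists_of_edge n m (fun k => ht l₀ (k * (n+1)))
        (fun k => if h : k ∈ I then E ⟨k, h⟩ else edge n l₀ k)
        (by
          intro k
          split_ifs with h
          · exact (Finset.mem_powersetCard.1 (hE ⟨k, h⟩)).1
          · exact edge_sub _ _ _)
        (fun k hk => ht_zero n m l₀ hl₀ _ (abs_mul_le n m k hk))
        (by
          intro k
          rw [← edge_card']
          split_ifs with h
          · rw [(Finset.mem_powersetCard.1 (hE ⟨k, h⟩)).2]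
          · rfl)
      have hwt : IntPartition.wt n 0 l = m := by
        rw [← hl₀]
        have e1 := wt_eq n m l hz 0 (by omega)
        have e2 := wt_eq n m l₀ (ht_zero n m l₀ hl₀) 0 (by omega)
        simp only [Nat.cast_zero, add_zero] at e1 e2
        rw [e1, e2]
        exact Finset.sum_congr rfl fun k _ => h1 k
      refine ⟨l, (hF l).2 ⟨hwt, h1⟩, ?_⟩
      funext k
      rw [h2, dif_pos k.2]
    · intro l hl
      rw [weight_eq n m l ((hF l).1 hl).1, Finset.prod_coe_sort I (fun k => W k (edge n l k))]
      simp only [hW]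
      rw [← hI]
      generalize I = J
      induction J using Finset.induction_on with
      | empty => simp
      | insert a s ha ih => rw [Finset.sum_insert ha, Finset.prod_insert ha, zpow_add₀ hξ0, ih]
  rw [step1, ← Finset.prod_univ_sum]
  have step2 : ∀ k : I, ∑ E ∈ (range (n+1)).powersetCard (edge n l₀ k).card, W k E
      = (fun k : ℤ => (-ξ⁻¹) ^ ((ht l₀ ((k+1) * (n+1)) : ℤ)) / (-ξ⁻¹) ^ ((ht l₀ (k * (n+1)) : ℤ))) k :=
    fun k => segment' n ξ hξ _ (by simpa using Finset.card_le_card (edge_sub n l₀ k)) k _ _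
      (edge_card' n l₀ k)
  rw [Finset.prod_congr rfl (fun k _ => step2 k), Finset.prod_coe_sort I
    (fun k : ℤ => (-ξ⁻¹) ^ ((ht l₀ ((k+1) * (n+1)) : ℤ)) / (-ξ⁻¹) ^ ((ht l₀ (k * (n+1)) : ℤ)))]
  have := prod_telescope (fun k : ℤ => (-ξ⁻¹) ^ ((ht l₀ (k * (n+1)) : ℤ)))
    (fun k => zpow_ne_zero _ hξ1) (-(m:ℤ)) (2*m)
  have e : -(m:ℤ) + ((2*m:ℕ):ℤ) = m := by push_cast; ring
  rw [e] at this
  rw [hI, this, ht_zero n m l₀ hl₀ _ (abs_mul_le n m _ (by simp)),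
    ht_zero n m l₀ hl₀ _ (abs_mul_le n m _ (by simp))]
  simp

end Stmt9

/-- coefficient-wise form of the substitution identity
`Z⁰_Δ(q) = Z_Δ(q_0,…,q_n)` at `q_0 = ξ^{−n} q`, `q_1 = … = q_n = ξ`. -/
theorem stmt9 (n : ℕ) (hn : 1 ≤ n) (ξ : ℂ) (hξ : IsPrimitiveRoot ξ (n + 2)) (m : ℕ) :
    (∑ᶠ (lam : IntPartition) (_ : IntPartition.wt n 0 lam = m),
        ξ ^ ((∑ r ∈ Finset.Icc 1 n, (IntPartition.wt n (r : ℤ) lam : ℤ)) - (n : ℤ) * m))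
      = ({lam : IntPartition | ZeroGenerated n lam ∧ IntPartition.wt n 0 lam = m}.ncard : ℂ) := by
  classical
  set T := (Stmt9.T_finite n m).toFinset with hT
  have hTm : ∀ l, l ∈ T ↔ IntPartition.wt n 0 l = m := by intro l; simp [hT]
  set G : IntPartition → ℤ → ℕ := fun l k => Stmt9.ht l (k * (n+1)) with hG
  have h1 : (∑ᶠ (lam : IntPartition) (_ : IntPartition.wt n 0 lam = m),
        ξ ^ ((∑ r ∈ Finset.Icc 1 n, (IntPartition.wt n (r : ℤ) lam : ℤ)) - (n : ℤ) * m))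
      = ∑ lam ∈ T, ξ ^ ((∑ r ∈ Finset.Icc 1 n, (IntPartition.wt n (r : ℤ) lam : ℤ)) - (n : ℤ) * m) := by
    rw [← finsum_mem_finset_eq_sum]
    refine finsum_congr fun l => ?_
    rw [hTm l]
  rw [h1, ← Finset.sum_fiberwise_of_maps_to (g := G) (t := T.image G)
    (fun l hl => Finset.mem_image_of_mem G hl)]
  have h2 : ∀ g ∈ T.image G, ∑ lam ∈ T with G lam = g,
      ξ ^ ((∑ r ∈ Finset.Icc 1 n, (IntPartition.wt n (r : ℤ) lam : ℤ)) - (n : ℤ) * m) = 1 := by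
    intro g hg
    obtain ⟨l₀, hl₀, rfl⟩ := Finset.mem_image.1 hg
    refine Stmt9.fiber_sum n m ξ hξ l₀ ((hTm l₀).1 hl₀) _ fun l => ?_
    rw [Finset.mem_filter, hTm]
    simp only [hG, funext_iff]
  rw [Finset.sum_congr rfl h2, Finset.sum_const, nsmul_eq_mul, mul_one]
  congr 1
  rw [← Set.ncard_coe_finset]
  symm
  refine Set.ncard_congr (fun l _ => G l) ?_ ?_ ?_
  · rintro l ⟨_, hl⟩
    exact Finset.mem_coe.2 (Finset.mem_image_of_mem G ((hTm l).2 hl))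
  · rintro a b ⟨ha, _⟩ ⟨hb, _⟩ hab
    exact Stmt9.diag_inj (Set.Subset.antisymm
      (Stmt9.zg_sub n hb fun k => (congrFun hab k).symm)
      (Stmt9.zg_sub n ha fun k => congrFun hab k))
  · intro g hg
    obtain ⟨l, hl, rfl⟩ := Finset.mem_image.1 (Finset.mem_coe.1 hg)
    obtain ⟨l', h1, h2, h3⟩ := Stmt9.zg_exists n m l ((hTm l).1 hl)
    exact ⟨l', ⟨h1, h2⟩, funext h3⟩
end

section
/- Let n ≥ 1 and let ξ ∈ ℂ be a primitive (n+2)-nd root of unity. For every integer m ≥ 0, the number of 0-generated partitions λ with wt_0(λ) = m equals Σ p_{n+1}(k) · ξ^{Σ_{s=2}^{n+1} (s−1)·a_s}, where the (finite) sum is over all pairs (a, k) with a = (a_1, …, a_{n+1}) ∈ ℤ^{n+1}, a_1 + … + a_{n+1} = 0, k an integer ≥ 0, and (1/2)·Σ_{s=1}^{n+1} a_s² + k = m, and where p_{n+1}(k) denotes the number of (n+1)-tuples (μ_1, …, μ_{n+1}) of partitions with |μ_1| + … + |μ_{n+1}| = k. -/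
namespace ZG

/-- Shifted bead positions. -/
def bead (c : ℤ) (l : IntPartition) (i : ℕ) : ℤ := (l.parts i : ℤ) - i - 1 + c

def B (t : ℤ × IntPartition) : Set ℤ := Set.range (bead t.1 t.2)

/-- `S` is trivial outside the window `[-K, K)`. -/
def Triv (K : ℕ) (S : Set ℤ) : Prop := (∀ k : ℤ, k < -(K : ℤ) → k ∈ S) ∧ ∀ k : ℤ, (K : ℤ) ≤ k → k ∉ S

theorem Triv.mono {K K' : ℕ} {S : Set ℤ} (h : Triv K S) (hK : K ≤ K') : Triv K' S :=
  ⟨fun k hk => h.1 k (by omega), fun k hk => h.2 k (by omega)⟩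

theorem ncard_cells (l : IntPartition) (Q : ℕ × ℕ → Prop) [DecidablePred Q] (L : ℕ)
    (hL : ∀ i, L ≤ i → l.parts i = 0) :
    {c : ℕ × ℕ | c ∈ l.diagram ∧ Q c}.ncard
      = ∑ i ∈ Finset.range L, ((Finset.range (l.parts i)).filter (fun j => Q (i, j))).card := by
  classical
  rw [← Finset.card_sigma]
  rw [← Finset.card_map (Equiv.sigmaEquivProd ℕ ℕ).toEmbedding, ← Set.ncard_coe_finset]
  congr 1
  ext ⟨i, j⟩
  simp only [IntPartition.diagram, Set.mem_ofPred_eq, Finset.coe_map, Set.mem_image, Finset.mem_coe,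
    Finset.mem_sigma, Finset.mem_range, Finset.mem_filter]
  constructor
  · rintro ⟨h1, h2⟩
    refine ⟨⟨i, j⟩, ⟨?_, h1, h2⟩, rfl⟩
    by_contra h
    change ¬ (i < L) at h
    change j < l.parts i at h1
    have := hL i (by omega)
    omega
  · rintro ⟨⟨i', j'⟩, ⟨h0, h1, h2⟩, h3⟩
    simp [Equiv.sigmaEquivProd] at h3
    obtain ⟨rfl, rfl⟩ := h3
    exact ⟨h1, h2⟩

theorem size_eq (l : IntPartition) (L : ℕ) (hL : ∀ i, L ≤ i → l.parts i = 0) :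
    l.size = ∑ i ∈ Finset.range L, l.parts i := by
  have := ncard_cells l (fun _ => True) L hL
  simpa [IntPartition.size] using this

theorem count_div (N : ℕ) (hN : 0 < N) (i p : ℕ) :
    (((Finset.range p).filter (fun j : ℕ => ((i : ℤ) - (j : ℤ)) ≡ 0 [ZMOD (N : ℤ)])).card : ℤ)
      = ((p : ℤ) - i - 1) / N - (-(i : ℤ) - 1) / N := by
  induction p with
  | zero => simp
  | succ p ih =>
    rw [Finset.range_add_one, Finset.filter_insert]
    have hN' : (0 : ℤ) < N := by exact_mod_cast hN
    have e : (((p + 1 : ℕ) : ℤ) - i - 1) = (p : ℤ) - i := by push_cast; ring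
    rw [e]
    by_cases h : ((i : ℤ) - (p : ℤ)) ≡ 0 [ZMOD (N : ℤ)]
    · rw [if_pos h, Finset.card_insert_of_notMem (by simp)]
      push_cast
      rw [ih]
      obtain ⟨q, hq⟩ := (Int.modEq_zero_iff_dvd.1 h)
      have e1 : ((p : ℤ) - i) / N = -q := by
        rw [show (p : ℤ) - i = N * (-q) by linarith]
        exact Int.mul_ediv_cancel_left _ hN'.ne'
      have e2 : ((p : ℤ) - i - 1) / N = -q - 1 := by
        refine (Int.ediv_eq_iff_of_pos hN').2 ⟨?_, ?_⟩ <;> nlinarith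
      omega
    · rw [if_neg h, ih]
      congr 1
      have h' : ((p : ℤ) - i) % N ≠ 0 := by
        intro h0
        apply h
        rw [Int.modEq_zero_iff_dvd]
        have := Int.dvd_of_emod_eq_zero h0
        rw [← neg_sub]
        exact (dvd_neg).2 this
      have a1 := Int.emod_nonneg ((p : ℤ) - i) hN'.ne'
      have a2 := Int.emod_lt_of_pos ((p : ℤ) - i) hN'
      have a3 := Int.mul_ediv_add_emod ((p : ℤ) - i) N
      have a4 : 1 ≤ ((p : ℤ) - i) % N := by omega
      refine (Int.ediv_eq_iff_of_pos hN').2 ⟨?_, ?_⟩ <;> nlinarith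
end ZG

namespace ZG
open Finset

theorem esum (N : ℕ) (ξ : ℂ) (hξ : IsPrimitiveRoot ξ (N + 1)) (c : ℕ) (hc : c ≤ N) :
    ∑ s ∈ powersetCard c (univ : Finset (Fin N)), ∏ x ∈ s, ξ ^ ((x : ℕ) + 1) = (-1) ^ c := by
  classical
  have h1 : (Polynomial.X ^ (N + 1) - 1 : Polynomial ℂ)
      = ∏ i ∈ range (N + 1), (Polynomial.X - Polynomial.C (ξ ^ i)) := by
    rw [Polynomial.X_pow_sub_one_eq_prod (Nat.succ_pos N) hξ]
    symm
    apply Finset.prod_nbij (fun i => ξ ^ i)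
    · intro i _
      rw [Polynomial.mem_nthRootsFinset (Nat.succ_pos N), ← pow_mul, mul_comm, pow_mul, hξ.pow_eq_one, one_pow]
    · intro i hi j hj hij
      simp only [coe_range, Set.mem_Iio] at hi hj
      exact hξ.pow_inj hi hj hij
    · intro z hz
      have hz' : z ^ (N+1) = 1 := (Polynomial.mem_nthRootsFinset (Nat.succ_pos N) 1).1 hz
      obtain ⟨i, hi, rfl⟩ := hξ.eq_pow_of_pow_eq_one hz'
      exact ⟨i, by simpa using hi, rfl⟩
    · intros; rfl
  have h2 : (∏ x : Fin N, (Polynomial.X - Polynomial.C (ξ ^ ((x : ℕ) + 1))) : Polynomial ℂ)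
      = ∑ i ∈ range (N + 1), Polynomial.X ^ i := by
    have h3 : (Polynomial.X - 1 : Polynomial ℂ) ≠ 0 := by
      simpa using Polynomial.X_sub_C_ne_zero (1 : ℂ)
    apply mul_right_cancel₀ h3
    rw [geom_sum_mul, h1, prod_range_succ', Finset.prod_range (n := N)]
    simp
  have h4 := Multiset.prod_X_sub_C_coeff
    (Multiset.map (fun x : Fin N => ξ ^ ((x : ℕ) + 1)) univ.val) (k := N - c) (by simp)
  rw [Multiset.map_map] at h4
  change (∏ x : Fin N, (Polynomial.X - Polynomial.C (ξ ^ ((x : ℕ) + 1))) : Polynomial ℂ).coeff _ = _ at h4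
  rw [h2, Finset.esymm_map_val] at h4
  simp only [Polynomial.finsetSum_coeff, Polynomial.coeff_X_pow, Multiset.card_map, Finset.card_val,
    Finset.card_univ, Fintype.card_fin] at h4
  rw [Finset.sum_ite_eq, if_pos (by simp), Nat.sub_sub_self hc] at h4
  have h5 : ((-1 : ℂ) ^ c) * (-1) ^ c = 1 := by
    rw [← mul_pow]; simp
  calc _ = ((-1 : ℂ) ^ c * (-1) ^ c) * ∑ s ∈ powersetCard c (univ : Finset (Fin N)), ∏ x ∈ s, ξ ^ ((x : ℕ) + 1) := by rw [h5, one_mul]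
    _ = _ := by rw [mul_assoc, ← h4, mul_one]

theorem usum (N c : ℕ) (hc : c ≤ N) [DecidablePred fun s : Finset (Fin N) => IsUpperSet (s : Set (Fin N))] :
    ∑ s ∈ powersetCard c (univ : Finset (Fin N)),
      (if IsUpperSet (s : Set (Fin N)) then (-1 : ℂ) ^ s.card else 0) = (-1) ^ c := by
  classical
  have hex : ∃ s : Finset (Fin N), IsUpperSet (s : Set (Fin N)) ∧ s.card = c := by
    refine ⟨univ.filter (fun x => N - c ≤ (x : ℕ)), ?_, ?_⟩
    · intro a b hab ha
      simp only [coe_filter, mem_univ, true_and, Set.mem_ofPred_eq] at ha ⊢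
      exact ha.trans hab
    · rw [Finset.card_filter, Fin.sum_univ_eq_sum_range (fun x => if N - c ≤ x then 1 else 0) N,
        ← Finset.card_filter]
      have : (range N).filter (fun x => N - c ≤ x) = Finset.Ico (N - c) N := by
        ext x; simp only [mem_filter, mem_range, Finset.mem_Ico]; omega
      rw [this, Nat.card_Ico]; omega
  obtain ⟨s, hs, hsc⟩ := hex
  rw [Finset.sum_eq_single s]
  · rw [if_pos hs, hsc]
  · intro t ht hne
    rw [if_neg]
    intro htu
    apply hne
    rw [mem_powersetCard] at ht
    rcases hs.total htu with h | h
    · exact (Finset.eq_of_subset_of_card_le (by exact_mod_cast h) (by omega)).symm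
    · exact (Finset.eq_of_subset_of_card_le (by exact_mod_cast h) (by omega))
  · intro h
    exact absurd (by simp [mem_powersetCard, hsc]) h

theorem swap_sum {N : ℕ} {W : Type} [Fintype W] [DecidableEq W] (P : (W → ℕ) → Prop) [DecidablePred P]
    (w v : Finset (Fin N) → ℂ)
    (h : ∀ c, ∑ s ∈ powersetCard c univ, w s = ∑ s ∈ powersetCard c univ, v s) :
    ∑ g : W → Finset (Fin N) with P (fun k => (g k).card), ∏ k, w (g k)
      = ∑ g : W → Finset (Fin N) with P (fun k => (g k).card), ∏ k, v (g k) := by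
  classical
  have key : ∀ u : Finset (Fin N) → ℂ,
      ∑ g : W → Finset (Fin N) with P (fun k => (g k).card), ∏ k, u (g k)
      = ∑ c : W → Fin (N + 1), if P (fun k => (c k : ℕ)) then
          ∏ k, ∑ s ∈ powersetCard (c k) univ, u s else 0 := by
    intro u
    let φ : (W → Finset (Fin N)) → (W → Fin (N + 1)) := fun g k =>
      ⟨(g k).card, by have := Finset.card_le_univ (g k); simp at this; omega⟩
    rw [← Finset.sum_fiberwise _ φ]
    refine Finset.sum_congr rfl fun c _ => ?_
    have hφ : ∀ g, φ g = c ↔ ∀ k, (g k).card = c k := by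
      intro g
      constructor
      · rintro rfl k; rfl
      · intro hh; funext k; exact Fin.ext (hh k)
    by_cases hP : P (fun k => (c k : ℕ))
    · rw [if_pos hP, Finset.prod_univ_sum]
      refine Finset.sum_congr ?_ fun _ _ => rfl
      ext g
      simp only [mem_filter, mem_univ, true_and, Fintype.mem_piFinset, mem_powersetCard, subset_univ, hφ]
      constructor
      · exact fun h => h.2
      · intro hh
        refine ⟨?_, hh⟩
        simpa only [hh] using hP
    · rw [if_neg hP]
      apply Finset.sum_eq_zero
      intro g hg
      simp only [mem_filter, mem_univ, true_and, hφ] at hg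
      exfalso
      apply hP
      simpa only [hg.2] using hg.1
  rw [key, key]
  simp only [h]

end ZG

namespace ZG
open Finset

theorem bead_strictAnti (c : ℤ) (l : IntPartition) : StrictAnti (bead c l) := by
  apply strictAnti_nat_of_succ_lt
  intro i
  have := l.antitone (Nat.le_succ i)
  simp only [bead, Nat.succ_eq_add_one] at *
  push_cast
  omega

theorem part_ext {l l' : IntPartition} (h : l.parts = l'.parts) : l = l' := by
  cases l; cases l'; simp only at h; subst h; rfl

theorem B_inj : Function.Injective B := by
  rintro ⟨c, l⟩ ⟨c', l'⟩ h
  have h1 : bead c l = bead c' l' := by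
    have a1 : StrictMono (fun i => - bead c l i) := fun i j hij => neg_lt_neg (bead_strictAnti c l hij)
    have a2 : StrictMono (fun i => - bead c' l' i) := fun i j hij => neg_lt_neg (bead_strictAnti c' l' hij)
    have a3 := (StrictMono.range_inj a1 a2).1 (by
      have e : ∀ f : ℕ → ℤ, Set.range (fun i => - f i) = Neg.neg '' (Set.range f) := by
        intro f; ext x; simp [neg_eq_iff_eq_neg]
      rw [e, e]
      exact congrArg _ h)
    funext i
    exact neg_injective (congrFun a3 i)
  obtain ⟨L, hL⟩ := l.finite_support
  obtain ⟨L', hL'⟩ := l'.finite_support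
  have hc : c = c' := by
    have := congrFun h1 (max L L')
    simp only [bead, hL _ (le_max_left _ _), hL' _ (le_max_right _ _)] at this
    omega
  subst hc
  have : l = l' := by
    apply part_ext
    funext i
    have := congrFun h1 i
    simp only [bead] at this
    omega
  rw [this]

theorem B_triv (t : ℤ × IntPartition) : ∃ K, Triv K (B t) := by
  obtain ⟨c, l⟩ := t
  obtain ⟨L, hL⟩ := l.finite_support
  refine ⟨L + c.natAbs + l.parts 0, ?_, ?_⟩
  · intro k hk
    refine ⟨(c - 1 - k).toNat, ?_⟩
    have : L ≤ (c - 1 - k).toNat := by omega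
    simp only [bead, hL _ this]
    omega
  · rintro k hk ⟨i, rfl⟩
    have := l.antitone (Nat.zero_le i)
    simp only [bead] at hk
    omega

theorem exists_of_triv (K : ℕ) (S : Set ℤ) (h : Triv K S) : ∃ t, B t = S := by
  classical
  let p : ℕ → Prop := fun j => (K : ℤ) - 1 - j ∈ S
  have hp : ∀ j, 2 * K ≤ j → p j := fun j hj => h.1 _ (by omega)
  have hinf : (Set.ofPred p).Infinite := by
    apply Set.infinite_of_not_bddAbove
    rintro ⟨b, hb⟩
    have := hb (show max (b+1) (2 * K) ∈ Set.ofPred p from hp _ (le_max_right _ _))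
    have := le_max_left (b+1) (2*K)
    omega
  have hcount : ∀ d, Nat.count p (2 * K + d) = Nat.count p (2 * K) + d := by
    intro d
    induction d with
    | zero => rfl
    | succ d ih =>
      rw [← add_assoc, Nat.count_succ, ih, if_pos (hp _ (by omega))]; omega
  set n0 := Nat.count p (2 * K) with hn0
  have hn0le : n0 ≤ 2 * K := Nat.count_le p
  have hnth : ∀ i, n0 ≤ i → Nat.nth p i = 2 * K + (i - n0) := by
    intro i hi
    have := Nat.nth_count (hp (2 * K + (i - n0)) (by omega))
    rw [hcount, Nat.add_sub_cancel' hi] at this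
    exact this
  have hmono := Nat.nth_strictMono hinf
  -- nth i ≤ i + (2K - n0)
  have hanti : ∀ i j, i ≤ j → (j - i) + Nat.nth p i ≤ Nat.nth p j := by
    intro i j hij
    induction j, hij using Nat.le_induction with
    | base => simp
    | succ j hij ih =>
      have := hmono (Nat.lt_succ_self j)
      simp only [Nat.succ_eq_add_one] at this
      omega
  have hle : ∀ i, Nat.nth p i ≤ i + (2 * K - n0) := by
    intro i
    have h1 := hanti i (i + n0) (by omega)
    have h2 := hnth (i + n0) (by omega)
    omega
  refine ⟨((n0 : ℤ) - K, ⟨fun i => i + (2 * K - n0) - Nat.nth p i, ?_, ?_⟩), ?_⟩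
  · intro i j hij
    have := hanti i j hij
    have := hle i
    omega
  · exact ⟨n0, fun i hi => by rw [hnth i hi]; omega⟩
  · have hb : bead ((n0 : ℤ) - K) ⟨fun i => i + (2 * K - n0) - Nat.nth p i, by
        intro i j hij
        have := hanti i j hij
        have := hle i
        omega, ⟨n0, fun i hi => by rw [hnth i hi]; omega⟩⟩ = fun i => (K : ℤ) - 1 - (Nat.nth p i : ℕ) := by
      funext i
      simp only [bead]
      have := hle i
      omega
    change Set.range (bead _ _) = S
    rw [hb]
    ext k
    constructor
    · rintro ⟨i, rfl⟩
      exact Nat.nth_mem_of_infinite hinf i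
    · intro hk
      have hkK : k < K := by
        by_contra h'
        exact h.2 k (by omega) hk
      have : p (K - 1 - k).toNat := by
        change (K : ℤ) - 1 - ((K - 1 - k).toNat : ℕ) ∈ S
        rw [show (K : ℤ) - 1 - ((K - 1 - k).toNat : ℕ) = k by omega]
        exact hk
      refine ⟨Nat.count p (K - 1 - k).toNat, ?_⟩
      simp only
      rw [Nat.nth_count this]
      omega

open Classical in
/-- Sum over the beads in a window, for large windows. -/
theorem window_sum (c : ℤ) (l : IntPartition) (K L : ℕ) (hL : ∀ i, L ≤ i → l.parts i = 0)
    (h1 : (L : ℤ) ≤ K + c) (h2 : (l.parts 0 : ℤ) + c ≤ K) (f : ℤ → ℤ) :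
    ∑ k ∈ Finset.Ico (-(K : ℤ)) K with k ∈ B (c, l), f k
      = ∑ i ∈ range (K + c).toNat, f (bead c l i) := by
  symm
  rw [← Finset.sum_image (s := range (K + c).toNat) (g := bead c l) (f := f)
    (fun i _ j _ h => (bead_strictAnti c l).injective h)]
  refine Finset.sum_congr ?_ fun _ _ => rfl
  ext k
  simp only [mem_image, mem_range, mem_filter, Finset.mem_Ico]
  constructor
  · rintro ⟨i, hi, rfl⟩
    refine ⟨?_, ⟨i, rfl⟩⟩
    have := l.antitone (Nat.zero_le i)
    simp only [bead]
    omega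
  · rintro ⟨hk, i, rfl⟩
    refine ⟨i, ?_, rfl⟩
    by_contra hi
    simp only [bead] at hk
    rw [hL i (by omega)] at hk
    omega

theorem sum_lin (n : ℕ) (a : ℤ) : 2 * ∑ i ∈ range n, (a - 1 - (i : ℤ)) = n * (2 * a - 1 - n) := by
  induction n with
  | zero => simp
  | succ n ih => rw [sum_range_succ, mul_add, ih]; push_cast; ring

open Classical in
theorem window_triv (c : ℤ) (l : IntPartition) (K : ℕ) (hK : Triv K (B (c, l))) :
    ∑ k ∈ Finset.Ico (-(K : ℤ)) K with k ∈ B (c, l), (1 : ℤ) = K + c ∧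
    2 * ∑ k ∈ Finset.Ico (-(K : ℤ)) K with k ∈ B (c, l), k = 2 * l.size + c ^ 2 - c - K ^ 2 - K := by
  obtain ⟨L, hL⟩ := l.finite_support
  have main : ∀ d : ℕ, Triv K (B (c, l)) →
      (∑ k ∈ Finset.Ico (-((K + d : ℕ) : ℤ)) (K + d : ℕ) with k ∈ B (c, l), (1 : ℤ) = (K + d : ℕ) + c ∧
    2 * ∑ k ∈ Finset.Ico (-((K + d : ℕ) : ℤ)) (K + d : ℕ) with k ∈ B (c, l), k = 2 * l.size + c ^ 2 - c - (K + d : ℕ) ^ 2 - (K + d : ℕ)) →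
     ∑ k ∈ Finset.Ico (-(K : ℤ)) K with k ∈ B (c, l), (1 : ℤ) = K + c ∧
    2 * ∑ k ∈ Finset.Ico (-(K : ℤ)) K with k ∈ B (c, l), k = 2 * l.size + c ^ 2 - c - K ^ 2 - K := by
    intro d hT
    induction d with
    | zero => exact id
    | succ d ih =>
      intro hd
      apply ih
      have hT' := hT.mono (Nat.le_add_right K d)
      have hins : (Finset.Ico (-((K + (d + 1) : ℕ) : ℤ)) (K + (d + 1) : ℕ)).filter (· ∈ B (c, l))
          = insert (-((K + d : ℕ) : ℤ) - 1) ((Finset.Ico (-((K + d : ℕ) : ℤ)) (K + d : ℕ)).filter (· ∈ B (c, l))) := by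
        ext k
        simp only [mem_filter, Finset.mem_Ico, mem_insert]
        constructor
        · rintro ⟨h1, h2⟩
          have := hT'.2 k
          by_cases hk : (((K + d : ℕ) : ℤ) ≤ k)
          · exact absurd h2 (this hk)
          · by_cases hk' : k = -((K + d : ℕ) : ℤ) - 1
            · exact Or.inl hk'
            · refine Or.inr ⟨?_, h2⟩
              push_cast at *
              omega
        · rintro (rfl | ⟨h1, h2⟩)
          · refine ⟨?_, hT'.1 _ (by omega)⟩
            push_cast
            omega
          · refine ⟨?_, h2⟩
            push_cast at *
            omega
      rw [hins, Finset.sum_insert (by simp), Finset.sum_insert (by simp)] at hd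
      obtain ⟨hd1, hd2⟩ := hd
      push_cast at *
      constructor
      · linarith
      · linarith
  apply main (L + c.natAbs + l.parts 0) hK
  have hle : (L : ℤ) ≤ (K + (L + c.natAbs + l.parts 0) : ℕ) + c := by omega
  rw [window_sum c l _ L hL hle (by omega),
    window_sum c l _ L hL hle (by omega) (fun k => k)]
  generalize (K + (L + c.natAbs + l.parts 0) : ℕ) = K' at *
  have hn : (((K' + c).toNat : ℕ) : ℤ) = K' + c := by omega
  constructor
  · simp only [sum_const, card_range, nsmul_eq_mul, mul_one]
    exact hn
  · rw [size_eq l (K' + c).toNat (fun i hi => hL i (by omega))]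
    have : ∀ i ∈ range (K' + c).toNat, bead c l i = (l.parts i : ℤ) + (c - 1 - i) := by
      intro i _; simp only [bead]; ring
    rw [Finset.sum_congr rfl this, sum_add_distrib, mul_add, sum_lin, hn]
    push_cast
    ring

end ZG

namespace ZG
open Finset

/-- `t` is the family of runners of the Maya diagram of `s`. -/
def R (N : ℕ) (s : ℤ × IntPartition) (t : Fin N → ℤ × IntPartition) : Prop :=
  ∀ (k : ℤ) (x : Fin N), k ∈ B (t x) ↔ (N : ℤ) * k + (x : ℕ) ∈ B s

theorem R_exists_right {N : ℕ} (hN : 0 < N) (s : ℤ × IntPartition) : ∃ t, R N s t := by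
  obtain ⟨K, hK⟩ := B_triv s
  have : ∀ x : Fin N, ∃ t, B t = {k : ℤ | (N : ℤ) * k + (x : ℕ) ∈ B s} := by
    intro x
    apply exists_of_triv (K + 1)
    have hx := x.2
    have hx' : ((x : ℕ) : ℤ) < N := by exact_mod_cast hx
    have hN' : (1 : ℤ) ≤ N := by exact_mod_cast hN
    constructor
    · intro k hk
      apply hK.1
      push_cast at hk
      nlinarith
    · intro k hk
      apply hK.2
      push_cast at hk
      nlinarith
  choose t ht using this
  exact ⟨t, fun k x => by rw [ht]; rfl⟩

theorem R_exists_left {N : ℕ} (hN : 0 < N) (t : Fin N → ℤ × IntPartition) : ∃ s, R N s t := by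
  choose K hK using fun x => B_triv (t x)
  have hN' : (0 : ℤ) < N := by exact_mod_cast hN
  have hT : ∀ x, Triv (∑ x, K x) (B (t x)) := fun x =>
    (hK x).mono (Finset.single_le_sum (f := K) (fun _ _ => Nat.zero_le _) (mem_univ x))
  generalize ∑ x, K x = M at hT
  have hlt : ∀ p : ℤ, (p % N).toNat < N := fun p => by
    have := Int.emod_nonneg p hN'.ne'
    have := Int.emod_lt_of_pos p hN'
    omega
  obtain ⟨s, hs⟩ := exists_of_triv (N * M) {p : ℤ | p / N ∈ B (t ⟨(p % N).toNat, hlt p⟩)} (by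
    constructor
    · intro p hp
      apply (hT _).1
      apply Int.ediv_lt_of_lt_mul hN'
      push_cast at hp
      nlinarith
    · intro p hp
      apply (hT _).2
      apply Int.le_ediv_of_mul_le hN'
      push_cast at hp
      nlinarith)
  refine ⟨s, fun k x => ?_⟩
  rw [hs]
  have hx : ((x : ℕ) : ℤ) < N := by exact_mod_cast x.2
  have h := (Int.ediv_emod_unique (a := (N : ℤ) * k + (x : ℕ)) (r := (x : ℕ)) (q := k) hN').2
    ⟨by ring, by omega, hx⟩
  have h1 : (⟨(((N : ℤ) * k + (x : ℕ)) % N).toNat, hlt _⟩ : Fin N) = x := by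
    apply Fin.ext
    simp only [h.2, Int.toNat_natCast]
  rw [Set.mem_ofPred_eq, h1, h.1]

theorem R_inj_right {N : ℕ} {s t t'} (h : R N s t) (h' : R N s t') : t = t' := by
  funext x
  apply B_inj
  ext k
  rw [h, h']

theorem R_inj_left {N : ℕ} (hN : 0 < N) {s s' t} (h : R N s t) (h' : R N s' t) : s = s' := by
  have hN' : (0 : ℤ) < N := by exact_mod_cast hN
  apply B_inj
  ext p
  have h1 := Int.emod_nonneg p hN'.ne'
  have h2 := Int.emod_lt_of_pos p hN'
  have a := h (p / N) ⟨(p % N).toNat, by omega⟩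
  have b := h' (p / N) ⟨(p % N).toNat, by omega⟩
  have e : (N : ℤ) * (p / N) + ((p % N).toNat : ℕ) = p := by
    rw [Int.toNat_of_nonneg h1]; exact Int.mul_ediv_add_emod p N
  simp only [e] at a b
  rw [← a, b]

theorem block_sum {N : ℕ} (hN : 0 < N) (K : ℕ) (F : ℤ → ℤ) :
    ∑ p ∈ Finset.Ico (-((N * K : ℕ) : ℤ)) (N * K : ℕ), F p
      = ∑ x : Fin N, ∑ k ∈ Finset.Ico (-(K : ℤ)) K, F ((N : ℤ) * k + (x : ℕ)) := by
  have hN' : (0 : ℤ) < N := by exact_mod_cast hN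
  have hlt : ∀ p : ℤ, (p % N).toNat < N := fun p => by
    have := Int.emod_nonneg p hN'.ne'
    have := Int.emod_lt_of_pos p hN'
    omega
  rw [← Finset.sum_product' (univ : Finset (Fin N)) (Finset.Ico (-(K : ℤ)) K)
    (fun x k => F ((N : ℤ) * k + (x : ℕ)))]
  have e : ∀ p : ℤ, (N : ℤ) * (p / N) + ((p % N).toNat : ℕ) = p := fun p => by
    rw [Int.toNat_of_nonneg (Int.emod_nonneg p hN'.ne')]; exact Int.mul_ediv_add_emod p N
  refine Finset.sum_nbij' (fun p => (⟨(p % N).toNat, hlt p⟩, p / N))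
    (fun q => (N : ℤ) * q.2 + (q.1 : ℕ)) ?_ ?_ ?_ ?_ ?_
  · intro p hp
    simp only [mem_product, mem_univ, true_and, Finset.mem_Ico] at hp ⊢
    push_cast at hp
    exact ⟨Int.le_ediv_of_mul_le hN' (by nlinarith), Int.ediv_lt_of_lt_mul hN' (by nlinarith)⟩
  · rintro ⟨x, k⟩ hq
    simp only [mem_product, mem_univ, true_and, Finset.mem_Ico] at hq ⊢
    have hx : ((x : ℕ) : ℤ) < N := by exact_mod_cast x.2
    push_cast
    constructor <;> nlinarith
  · intro p _
    exact e p
  · rintro ⟨x, k⟩ _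
    have hx : ((x : ℕ) : ℤ) < N := by exact_mod_cast x.2
    have h := (Int.ediv_emod_unique (a := (N : ℤ) * k + (x : ℕ)) (r := (x : ℕ)) (q := k) hN').2
      ⟨by ring, by omega, hx⟩
    simp only [h.1, h.2, Int.toNat_natCast]
  · intro p _
    simp only [e]

theorem vac_sum {N : ℕ} (hN : 0 < N) (K : ℕ) :
    2 * ∑ i ∈ range (N * K), (-(i : ℤ) - 1) / (N : ℤ) = - (N * (K ^ 2 + K)) := by
  have hN' : (0 : ℤ) < N := by exact_mod_cast hN
  induction K with
  | zero => simp
  | succ K ih =>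
    rw [Nat.mul_succ, sum_range_add, mul_add, ih]
    have : ∀ x ∈ range N, (-((N * K + x : ℕ) : ℤ) - 1) / (N : ℤ) = -(K : ℤ) - 1 := by
      intro x hx
      have hx' : (x : ℤ) < N := by exact_mod_cast mem_range.1 hx
      refine (Int.ediv_eq_iff_of_pos hN').2 ⟨?_, ?_⟩ <;> push_cast <;> nlinarith
    rw [sum_congr rfl this]
    simp only [sum_const, card_range, nsmul_eq_mul]
    push_cast
    ring

theorem R_facts {N : ℕ} (hN : 0 < N) {c : ℤ} {l : IntPartition} {t} (h : R N (c, l) t) :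
    c = ∑ x, (t x).1 ∧ (c = 0 →
      2 * (({q : ℕ × ℕ | q ∈ l.diagram ∧ ((q.1 : ℤ) - (q.2 : ℤ)) ≡ 0 [ZMOD (N : ℤ)]}.ncard : ℕ) : ℤ)
        = ∑ x, (t x).1 ^ 2 + 2 * ∑ x, ((t x).2.size : ℤ)) := by
  classical
  have hN' : (0 : ℤ) < N := by exact_mod_cast hN
  obtain ⟨L, hL⟩ := l.finite_support
  choose K0 hK0 using fun x => B_triv (t x)
  set K := (∑ x, K0 x) + L + c.natAbs + l.parts 0 with hKdef
  have hT : ∀ x, Triv K (B (t x)) := fun x =>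
    (hK0 x).mono (by
      have := (Finset.single_le_sum (f := K0) (fun _ _ => Nat.zero_le _) (mem_univ x))
      omega)
  have hKN : K ≤ N * K := Nat.le_mul_of_pos_left _ hN
  have hw := window_sum c l (N * K) L hL (by omega) (by omega)
  have hb : ∀ f : ℤ → ℤ, ∑ k ∈ Finset.Ico (-((N * K : ℕ) : ℤ)) (N * K : ℕ) with k ∈ B (c, l), f k
      = ∑ x : Fin N, ∑ k ∈ Finset.Ico (-(K : ℤ)) K with k ∈ B (t x), f ((N : ℤ) * k + (x : ℕ)) := by
    intro f
    rw [sum_filter, block_sum hN]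
    refine sum_congr rfl fun x _ => ?_
    rw [sum_filter]
    refine sum_congr rfl fun k _ => ?_
    simp only [h k x]
  have hc : c = ∑ x, (t x).1 := by
    have h1 := (hw (fun _ => 1)).symm.trans (hb (fun _ => 1))
    rw [sum_congr rfl (fun x _ => (window_triv (t x).1 (t x).2 K (hT x)).1)] at h1
    simp only [sum_const, card_range, sum_add_distrib, card_univ, Fintype.card_fin, nsmul_eq_mul,
      mul_one] at h1
    have : ((((N * K : ℕ) : ℤ) + c).toNat : ℤ) = N * K + c := by push_cast at *; omega
    push_cast at *
    linarith
  refine ⟨hc, fun hc0 => ?_⟩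
  subst hc0
  have h1 := (hw (fun p => p / N)).symm.trans (hb (fun p => p / N))
  have e : ∀ (x : Fin N) (k : ℤ), ((N : ℤ) * k + (x : ℕ)) / N = k := by
    intro x k
    have hx : ((x : ℕ) : ℤ) < N := by exact_mod_cast x.2
    exact ((Int.ediv_emod_unique (a := (N : ℤ) * k + (x : ℕ)) (r := (x : ℕ)) (q := k) hN').2
      ⟨by ring, by omega, hx⟩).1
  simp only [e, add_zero, Int.toNat_natCast] at h1
  have h2 : 2 * ∑ i ∈ range (N * K), bead 0 l i / (N : ℤ) = ∑ x, (2 * ((t x).2.size : ℤ) + (t x).1 ^ 2 - (t x).1 - K ^ 2 - K) := by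
    rw [h1, mul_sum]
    exact sum_congr rfl (fun x _ => (window_triv (t x).1 (t x).2 K (hT x)).2)
  rw [ncard_cells l _ (N * K) (fun i hi => hL i (by omega))]
  push_cast
  rw [sum_congr rfl (fun i _ => count_div N hN i (l.parts i)), sum_sub_distrib, mul_sub, vac_sum hN]
  have h3 : ∀ i, ((l.parts i : ℤ) - i - 1) = bead 0 l i := by
    intro i; simp [bead]
  simp only [h3]
  rw [h2]
  simp only [sum_sub_distrib, sum_add_distrib, ← mul_sum, ← hc, sum_const, card_univ, Fintype.card_fin,
    nsmul_eq_mul]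
  ring

theorem addable_iff (l : IntPartition) (c : ℕ × ℕ) :
    Addable l c ↔ c.2 = l.parts c.1 ∧ (c.1 = 0 ∨ l.parts c.1 < l.parts (c.1 - 1)) := by
  obtain ⟨i, j⟩ := c
  constructor
  · rintro ⟨h1, m, hm⟩
    have hm' : ∀ a b, b < m.parts a ↔ (b < l.parts a ∨ (a = i ∧ b = j)) := by
      intro a b
      have := Set.ext_iff.1 hm (a, b)
      rw [or_comm]
      simpa [IntPartition.diagram] using this
    have hj : l.parts i ≤ j := by
      simpa [IntPartition.diagram] using h1
    have h2 : j < m.parts i := (hm' i j).2 (Or.inr ⟨rfl, rfl⟩)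
    have h3 : j = l.parts i := by
      by_contra hne
      have := (hm' i (l.parts i)).1 (by omega)
      omega
    refine ⟨h3, ?_⟩
    by_cases hi : i = 0
    · exact Or.inl hi
    · right
      have := m.antitone (Nat.sub_le i 1)
      have := (hm' (i - 1) j).1 (by omega)
      simp only
      omega
  · rintro ⟨h1, h2⟩
    simp only at h1 h2
    subst h1
    refine ⟨by simp [IntPartition.diagram], ⟨fun a => if a = i then l.parts i + 1 else l.parts a, ?_, ?_⟩, ?_⟩
    · apply antitone_nat_of_succ_le
      intro a
      have h3 := l.antitone (Nat.le_succ a)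
      simp only [Nat.succ_eq_add_one] at h3
      by_cases ha : a = i
      · subst ha
        simp; omega
      · by_cases ha' : a + 1 = i
        · subst ha'
          simp at h2 ⊢; omega
        · simp [ha, ha']; omega
    · obtain ⟨L, hL⟩ := l.finite_support
      refine ⟨L + i + 1, fun a ha => ?_⟩
      rw [if_neg (by omega), hL a (by omega)]
    · ext ⟨a, b⟩
      by_cases ha : a = i
      · subst ha
        simp [IntPartition.diagram]; omega
      · simp [IntPartition.diagram, ha]

theorem zeroGen_iff (n : ℕ) (l : IntPartition) :
    ZeroGenerated n l ↔ ∀ p : ℤ, p ∈ B (0, l) → p + 1 ∉ B (0, l) → ((n : ℤ) + 1) ∣ p + 1 := by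
  constructor
  · rintro h p ⟨i, rfl⟩ hp
    have h1 := h (i, l.parts i) ((addable_iff l _).2 ⟨rfl, by
      by_cases hi : i = 0
      · exact Or.inl hi
      · right
        have h2 := l.antitone (Nat.sub_le i 1)
        rcases Nat.lt_or_eq_of_le h2 with h3 | h3
        · exact h3
        · exfalso
          apply hp
          refine ⟨i - 1, ?_⟩
          simp only [bead]
          omega⟩)
    have h2 := Int.modEq_zero_iff_dvd.1 h1
    have : bead 0 l i + 1 = -((i : ℤ) - (l.parts i : ℤ)) := by simp only [bead]; ring
    change _ ∣ bead 0 l i + 1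
    rw [this]
    exact (dvd_neg).2 h2
  · rintro h ⟨i, j⟩ hc
    obtain ⟨h1, h2⟩ := (addable_iff l _).1 hc
    simp only at h1 h2
    subst h1
    have h3 := h (bead 0 l i) ⟨i, rfl⟩ (by
      rintro ⟨i', hi'⟩
      have hlt : i' < i := by
        have : bead 0 l i < bead 0 l i' := by
          change bead 0 l i' = _ at hi'
          omega
        exact (bead_strictAnti 0 l).lt_iff_gt.1 this
      have := l.antitone (show i' ≤ i - 1 by omega)
      simp only [bead] at hi'
      omega)
    have e : ((i : ℤ) - (l.parts i : ℤ)) = -(bead 0 l i + 1) := by simp only [bead]; ring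
    apply Int.modEq_zero_iff_dvd.2
    simp only
    rw [e]
    exact (dvd_neg).2 h3

theorem zeroGen_mono {n : ℕ} {l : IntPartition} {t} (h : R (n + 1) (0, l) t) :
    ZeroGenerated n l ↔ ∀ k, IsUpperSet {x | k ∈ B (t x)} := by
  rw [zeroGen_iff]
  constructor
  · intro H k x y hxy hx
    rw [Fin.le_def] at hxy
    obtain ⟨y, hy⟩ := y
    simp only at hxy
    induction y, hxy using Nat.le_induction with
    | base => exact hx
    | succ y hxy ih =>
      have h1 := ih (by omega)
      simp only [Set.mem_ofPred_eq, h k] at h1 ⊢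
      by_contra h2
      have h3 := H _ h1 (by push_cast at h2 ⊢; rwa [add_assoc])
      push_cast at h3
      rw [add_assoc, Int.dvd_add_right (dvd_mul_right _ _)] at h3
      have := Int.le_of_dvd (by omega) h3
      omega
  · intro H p hp hp1
    by_contra hd
    have hN' : (0 : ℤ) < (n : ℤ) + 1 := by omega
    have a1 := Int.emod_nonneg p hN'.ne'
    have a2 := Int.emod_lt_of_pos p hN'
    have a3 := Int.mul_ediv_add_emod p ((n : ℤ) + 1)
    have a4 : p % ((n : ℤ) + 1) ≠ n := by
      intro h0
      apply hd
      refine ⟨p / ((n : ℤ) + 1) + 1, ?_⟩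
      rw [h0] at a3
      linarith
    have h1 := h (p / ((n : ℤ) + 1)) ⟨(p % ((n : ℤ) + 1)).toNat, by omega⟩
    have h2 := h (p / ((n : ℤ) + 1)) ⟨(p % ((n : ℤ) + 1)).toNat + 1, by omega⟩
    push_cast at h1 h2
    rw [Int.toNat_of_nonneg a1] at h1 h2
    rw [← add_assoc] at h2
    rw [a3] at h1 h2
    apply hp1
    rw [← h2]
    exact H _ (show (⟨(p % ((n : ℤ) + 1)).toNat, by omega⟩ : Fin (n+1)) ≤ ⟨(p % ((n : ℤ) + 1)).toNat + 1, by omega⟩ by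
      rw [Fin.le_def]; simp) (h1.2 hp)

end ZG

namespace ZG
open Finset

theorem mul_parts_le (l : IntPartition) (i : ℕ) : (i + 1) * l.parts i ≤ l.size := by
  obtain ⟨L, hL⟩ := l.finite_support
  rw [size_eq l (L + i + 1) (fun j hj => hL j (by omega))]
  calc (i + 1) * l.parts i = ∑ j ∈ range (i + 1), l.parts i := by simp
    _ ≤ ∑ j ∈ range (i + 1), l.parts j :=
        sum_le_sum fun j hj => l.antitone (by have := mem_range.1 hj; omega)
    _ ≤ _ := sum_le_sum_of_subset (by intro j hj; simp only [mem_range] at *; omega)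

theorem finite_size (k : ℕ) : {l : IntPartition | l.size ≤ k}.Finite := by
  refine Set.Finite.of_injOn (f := fun l (i : Fin k) => l.parts i)
    (t := {f : Fin k → ℕ | ∀ i, f i ∈ Set.Iic k}) ?_ ?_ (Set.Finite.pi' fun _ => Set.finite_Iic k)
  · intro l hl i
    have h1 := mul_parts_le l i
    have h2 : l.size ≤ k := hl
    simp only [Set.mem_Iic]
    nlinarith [Nat.zero_le ((i : ℕ) * l.parts i)]
  · intro l hl l' hl' h
    apply part_ext
    funext i
    by_cases hi : i < k
    · exact congrFun h ⟨i, hi⟩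
    · have h0 : ∀ l : IntPartition, l.size ≤ k → l.parts i = 0 := by
        intro l hl
        have h1 := mul_parts_le l i
        by_contra hne
        have : 1 ≤ l.parts i := by omega
        nlinarith
      rw [h0 l hl, h0 l' hl']

/-- Families of charged partitions with total charge zero and energy `m`. -/
def Fam (N m : ℕ) : Set (Fin N → ℤ × IntPartition) :=
  {t | ∑ x, (t x).1 = 0 ∧ ∑ x, (t x).1 ^ 2 + 2 * ∑ x, ((t x).2.size : ℤ) = 2 * m}

theorem Fam_finite (N m : ℕ) : (Fam N m).Finite := by
  refine Set.Finite.subset (Set.Finite.pi' (t := fun _ : Fin N =>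
    Set.Icc (-(2 * m : ℤ)) (2 * m) ×ˢ {l : IntPartition | l.size ≤ m})
    fun _ => (Set.finite_Icc _ _).prod (finite_size m)) ?_
  rintro t ⟨-, h2⟩ x
  have a1 : (t x).1 ^ 2 ≤ ∑ x, (t x).1 ^ 2 :=
    single_le_sum (f := fun x => (t x).1 ^ 2) (fun _ _ => sq_nonneg _) (mem_univ x)
  have a2 : ((t x).2.size : ℤ) ≤ ∑ x, ((t x).2.size : ℤ) :=
    single_le_sum (f := fun x => ((t x).2.size : ℤ)) (fun _ _ => by positivity) (mem_univ x)
  have a3 : 0 ≤ ((t x).2.size : ℤ) := by positivity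
  have a4 := sq_nonneg (t x).1
  refine ⟨⟨?_, ?_⟩, ?_⟩
  · have : (t x).1 ^ 2 ≤ 2 * m := by linarith
    by_contra hc
    nlinarith
  · have : (t x).1 ^ 2 ≤ 2 * m := by linarith
    by_contra hc
    nlinarith
  · have : ((t x).2.size : ℤ) ≤ m := by linarith
    exact_mod_cast this

theorem main_sum (N m : ℕ) (ξ : ℂ) (hξ : IsPrimitiveRoot ξ (N + 1)) :
    ∑ t ∈ (Fam_finite N m).toFinset, ξ ^ (∑ x : Fin N, ((x : ℕ) : ℤ) * (t x).1)
      = ({t | t ∈ Fam N m ∧ ∀ k, IsUpperSet {x | k ∈ B (t x)}}.ncard : ℂ) := by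
  classical
  have hξ0 : ξ ≠ 0 := hξ.ne_zero (by omega)
  choose K0 hK0 using B_triv
  obtain ⟨K, hK⟩ : ∃ K, ∀ t ∈ Fam N m, ∀ x, Triv K (B (t x)) := by
    refine ⟨∑ t ∈ (Fam_finite N m).toFinset, ∑ x, K0 (t x), fun t ht x => (hK0 (t x)).mono ?_⟩
    have h1 : K0 (t x) ≤ ∑ x, K0 (t x) :=
      single_le_sum (f := fun x => K0 (t x)) (fun _ _ => Nat.zero_le _) (mem_univ x)
    have h2 : ∑ x, K0 (t x) ≤ ∑ t ∈ (Fam_finite N m).toFinset, ∑ x, K0 (t x) :=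
      single_le_sum (f := fun t : Fin N → ℤ × IntPartition => ∑ x, K0 (t x)) (fun _ _ => Nat.zero_le _)
        ((Set.Finite.mem_toFinset _).2 ht)
    exact h1.trans h2
  let W := {k : ℤ // k ∈ Finset.Ico (-(K : ℤ)) K}
  let gm : (Fin N → ℤ × IntPartition) → W → Finset (Fin N) := fun t k =>
    univ.filter (fun x => (k : ℤ) ∈ B (t x))
  let P : (W → ℕ) → Prop := fun c => ∑ k, (c k : ℤ) = N * K ∧
    2 * ∑ k : W, (k : ℤ) * (c k : ℤ) = 2 * m - N * (K ^ 2 + K)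
  have swap : ∀ (t : Fin N → ℤ × IntPartition) (F : ℤ → ℤ),
      ∑ k : W, F k * ((gm t k).card : ℤ) = ∑ x, ∑ k ∈ Finset.Ico (-(K : ℤ)) K with k ∈ B (t x), F k := by
    intro t F
    simp only [gm, card_filter, sum_filter]
    push_cast
    simp only [mul_sum, mul_ite, mul_one, mul_zero]
    rw [sum_comm]
    refine sum_congr rfl fun x _ => ?_
    exact Finset.sum_coe_sort (Finset.Ico (-(K : ℤ)) K) (fun k => if k ∈ B (t x) then F k else 0)
  have hP : ∀ t : Fin N → ℤ × IntPartition, (∀ x, Triv K (B (t x))) →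
      (P (fun k => (gm t k).card) ↔ t ∈ Fam N m) := by
    intro t ht
    have s1 := swap t (fun _ => 1)
    have s2 := swap t (fun k => k)
    rw [sum_congr rfl (fun x _ => (window_triv (t x).1 (t x).2 K (ht x)).1)] at s1
    have s3 : 2 * ∑ k : W, (k : ℤ) * ((gm t k).card : ℤ)
        = ∑ x, (2 * ((t x).2.size : ℤ) + (t x).1 ^ 2 - (t x).1 - K ^ 2 - K) := by
      rw [s2, mul_sum]
      exact sum_congr rfl (fun x _ => (window_triv (t x).1 (t x).2 K (ht x)).2)
    simp only [one_mul, sum_sub_distrib, sum_add_distrib, ← mul_sum, sum_const, card_univ, Fintype.card_fin,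
      nsmul_eq_mul] at s1 s3
    simp only [P, Fam, Set.mem_ofPred_eq]
    rw [s1, s3]
    constructor
    · rintro ⟨h1, h2⟩
      exact ⟨by linarith, by linarith⟩
    · rintro ⟨h1, h2⟩
      exact ⟨by linarith, by linarith⟩
  have bij : ∀ H : (W → Finset (Fin N)) → ℂ,
      ∑ t ∈ (Fam_finite N m).toFinset, H (gm t)
        = ∑ g : W → Finset (Fin N) with P (fun k => (g k).card), H g := by
    intro H
    refine Finset.sum_nbij gm ?_ ?_ ?_ (fun _ _ => rfl)
    · intro t ht
      rw [Set.Finite.mem_toFinset] at ht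
      simp only [mem_filter, mem_univ, true_and]
      exact (hP t (hK t ht)).2 ht
    · intro t ht t' ht' hg
      simp only [Set.Finite.coe_toFinset] at ht ht'
      funext x
      apply B_inj
      ext k
      by_cases hk : k ∈ Finset.Ico (-(K : ℤ)) K
      · have := congrFun hg ⟨k, hk⟩
        have := Finset.ext_iff.1 this x
        simpa [gm] using this
      · rw [Finset.mem_Ico] at hk
        by_cases hk' : k < -(K : ℤ)
        · exact iff_of_true ((hK t ht x).1 k hk') ((hK t' ht' x).1 k hk')
        · exact iff_of_false ((hK t ht x).2 k (by omega)) ((hK t' ht' x).2 k (by omega))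
    · intro g hg
      simp only [coe_filter, mem_univ, true_and, Set.mem_ofPred_eq] at hg
      let T : Fin N → Set ℤ := fun x => {k | if h : k ∈ Finset.Ico (-(K : ℤ)) K then x ∈ g ⟨k, h⟩ else k < 0}
      have hTt : ∀ x, Triv K (T x) := by
        intro x
        constructor
        · intro k hk
          have : k ∉ Finset.Ico (-(K : ℤ)) K := by rw [Finset.mem_Ico]; omega
          simp only [T, Set.mem_ofPred_eq, dif_neg this]
          omega
        · intro k hk
          have : k ∉ Finset.Ico (-(K : ℤ)) K := by rw [Finset.mem_Ico]; omega
          simp only [T, Set.mem_ofPred_eq, dif_neg this]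
          omega
      choose t ht using fun x => exists_of_triv K (T x) (hTt x)
      have hgm : gm t = g := by
        funext k
        ext x
        simp only [gm, mem_filter, mem_univ, true_and, ht, T, Set.mem_ofPred_eq]
        rw [dif_pos k.2]
      refine ⟨t, ?_, hgm⟩
      rw [Set.Finite.coe_toFinset]
      rw [← hP t (fun x => by rw [ht]; exact hTt x), hgm]
      exact hg
  let w : Finset (Fin N) → ℂ := fun s => ∏ x ∈ s, ξ ^ ((x : ℕ) + 1)
  let v : Finset (Fin N) → ℂ := fun s => if IsUpperSet (s : Set (Fin N)) then (-1 : ℂ) ^ s.card else 0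
  have hwv := swap_sum (N := N) (W := W) P w v (by
    intro c
    by_cases hc : c ≤ N
    · exact (esum N ξ hξ c hc).trans (usum N c hc).symm
    · rw [Finset.powersetCard_eq_empty.2 (by simpa using hc)]
      simp)
  rw [← bij (fun g => ∏ k, w (g k)), ← bij (fun g => ∏ k, v (g k))] at hwv
  have hfull : ∏ x : Fin N, ξ ^ ((x : ℕ) + 1) = (-1) ^ N := by
    have := esum N ξ hξ N le_rfl
    have h2 : powersetCard N (univ : Finset (Fin N)) = {univ} := by
      have := Finset.powersetCard_self (univ : Finset (Fin N))
      simpa using this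
    rw [h2, sum_singleton] at this
    exact this
  have hw : ∀ t ∈ (Fam_finite N m).toFinset, ∏ k, w (gm t k)
      = ((-1) ^ N) ^ K * ξ ^ (∑ x : Fin N, ((x : ℕ) : ℤ) * (t x).1) := by
    intro t ht
    rw [Set.Finite.mem_toFinset] at ht
    have h1 : ∏ k, w (gm t k) = ∏ x : Fin N, ∏ k ∈ Finset.Ico (-(K : ℤ)) K with k ∈ B (t x), ξ ^ ((x : ℕ) + 1) := by
      simp only [w, gm, prod_filter]
      rw [prod_comm]
      refine prod_congr rfl fun x _ => ?_
      exact Finset.prod_coe_sort (Finset.Ico (-(K : ℤ)) K) (fun k => if k ∈ B (t x) then ξ ^ ((x : ℕ) + 1) else 1)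
    have h2 : ∀ x : Fin N, ∏ k ∈ Finset.Ico (-(K : ℤ)) K with k ∈ B (t x), ξ ^ ((x : ℕ) + 1)
        = (ξ ^ ((x : ℕ) + 1)) ^ K * (ξ ^ (((x : ℕ) : ℤ) * (t x).1) * ξ ^ (t x).1) := by
      intro x
      have h3 := (window_triv (t x).1 (t x).2 K (hK t ht x)).1
      rw [prod_const]
      rw [sum_const, nsmul_eq_mul, mul_one] at h3
      change (((Finset.Ico (-(K : ℤ)) K).filter (· ∈ B (t x))).card : ℤ) = _ at h3
      rw [← zpow_natCast, h3, zpow_add₀ (pow_ne_zero _ hξ0), zpow_natCast, ← zpow_add₀ hξ0,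
        ← zpow_natCast ξ ((x : ℕ) + 1), ← zpow_mul]
      congr 2
      push_cast
      ring
    have hz : ∀ f : Fin N → ℤ, ∏ x, ξ ^ (f x) = ξ ^ (∑ x, f x) := by
      intro f
      have : ∀ s : Finset (Fin N), ∏ x ∈ s, ξ ^ (f x) = ξ ^ (∑ x ∈ s, f x) := by
        intro s
        induction s using Finset.induction_on with
        | empty => simp
        | insert a s ha ih => rw [prod_insert ha, sum_insert ha, ih, zpow_add₀ hξ0]
      exact this univ
    rw [h1, prod_congr rfl (fun x _ => h2 x), prod_mul_distrib, prod_mul_distrib, prod_pow, hfull,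
      hz, hz, ht.1]
    simp
  have hv : ∀ t ∈ (Fam_finite N m).toFinset, ∏ k, v (gm t k)
      = ((-1) ^ N) ^ K * (if ∀ k, IsUpperSet {x | k ∈ B (t x)} then 1 else 0) := by
    intro t ht
    rw [Set.Finite.mem_toFinset] at ht
    have hcoe : ∀ k : W, ((gm t k : Finset (Fin N)) : Set (Fin N)) = {x | (k : ℤ) ∈ B (t x)} := by
      intro k; ext x; simp [gm]
    split_ifs with hm
    · have h1 : ∀ k, v (gm t k) = (-1) ^ (gm t k).card := by
        intro k
        simp only [v, hcoe]
        rw [if_pos (hm k)]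
      rw [prod_congr rfl (fun k _ => h1 k), prod_pow_eq_pow_sum, mul_one, ← pow_mul]
      congr 1
      have := ((hP t (hK t ht)).2 ht).1
      exact_mod_cast this
    · rw [mul_zero]
      push Not at hm
      obtain ⟨k, hk⟩ := hm
      have hkW : k ∈ Finset.Ico (-(K : ℤ)) K := by
        by_contra hkn
        rw [Finset.mem_Ico] at hkn
        apply hk
        by_cases hk' : k < -(K : ℤ)
        · intro x y _ _
          exact (hK t ht y).1 k hk'
        · intro x y _ hx
          exact absurd hx ((hK t ht x).2 k (by omega))
      apply Finset.prod_eq_zero (mem_univ (⟨k, hkW⟩ : W))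
      simp only [v, hcoe]
      rw [if_neg hk]
  rw [sum_congr rfl hw, sum_congr rfl hv, ← mul_sum, ← mul_sum] at hwv
  have h0 : (((-1 : ℂ) ^ N) ^ K) ≠ 0 := by
    apply pow_ne_zero; apply pow_ne_zero; norm_num
  rw [mul_left_cancel₀ h0 hwv, ← sum_filter, sum_const, nsmul_eq_mul, mul_one, ← Set.ncard_coe_finset]
  congr 3
  ext t
  simp

theorem ncard_zeroGen (n m : ℕ) :
    {lam : IntPartition | ZeroGenerated n lam ∧ IntPartition.wt n 0 lam = m}.ncard
      = {t | t ∈ Fam (n + 1) m ∧ ∀ k, IsUpperSet {x | k ∈ B (t x)}}.ncard := by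
  choose Φ hΦ using fun l : IntPartition => R_exists_right (Nat.succ_pos n) (0, l)
  have hinj : Function.Injective Φ := by
    intro l l' h
    have h1 := hΦ l
    rw [h] at h1
    exact congrArg Prod.snd (R_inj_left (Nat.succ_pos n) h1 (hΦ l'))
  rw [← Set.ncard_image_of_injective _ hinj]
  have hmem : ∀ l, Φ l ∈ Fam (n + 1) m ↔ IntPartition.wt n 0 l = m := by
    intro l
    have h := R_facts (Nat.succ_pos n) (hΦ l)
    have h2 := h.2 rfl
    have h3 : ((IntPartition.wt n 0 l : ℕ) : ℤ) = (({q : ℕ × ℕ | q ∈ l.diagram ∧ ((q.1 : ℤ) - (q.2 : ℤ)) ≡ 0 [ZMOD ((n.succ : ℕ) : ℤ)]}.ncard : ℕ) : ℤ) := by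
      simp only [IntPartition.wt, Nat.succ_eq_add_one]
      push_cast
      rfl
    rw [← h3] at h2
    simp only [Fam, Set.mem_ofPred_eq]
    constructor
    · rintro ⟨_, b⟩
      have : (IntPartition.wt n 0 l : ℤ) = m := by linarith
      exact_mod_cast this
    · intro b
      refine ⟨h.1.symm, ?_⟩
      rw [b] at h2
      exact h2.symm
  congr 1
  ext t
  constructor
  · rintro ⟨l, ⟨h1, h2⟩, rfl⟩
    exact ⟨(hmem l).2 h2, (zeroGen_mono (hΦ l)).1 h1⟩
  · rintro ⟨h1, h2⟩
    obtain ⟨⟨c, l⟩, hs⟩ := R_exists_left (Nat.succ_pos n) t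
    have hc := (R_facts (Nat.succ_pos n) hs).1
    rw [h1.1] at hc
    subst hc
    have : Φ l = t := R_inj_right (hΦ l) hs
    refine ⟨l, ⟨(zeroGen_mono hs).2 h2, (hmem l).1 (this ▸ h1)⟩, this⟩

theorem rhs_sum (N m : ℕ) (ξ : ℂ) :
    ∑ᶠ (a : Fin N → ℤ) (k : ℕ)
          (_ : (∑ i, a i) = 0 ∧
            (1 / 2 : ℚ) * (∑ i, (a i : ℚ) ^ 2) + (k : ℚ) = (m : ℚ)),
          (({μ : Fin N → IntPartition | (∑ i, (μ i).size) = k}.ncard : ℂ) *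
            ξ ^ (∑ i : Fin N, ((i : ℕ) : ℤ) * a i))
      = ∑ t ∈ (Fam_finite N m).toFinset, ξ ^ (∑ x : Fin N, ((x : ℕ) : ℤ) * (t x).1) := by
  classical
  have hcond : ∀ (a : Fin N → ℤ) (k : ℕ), ((1 / 2 : ℚ) * (∑ i, (a i : ℚ) ^ 2) + (k : ℚ) = (m : ℚ))
      ↔ ∑ i, a i ^ 2 + 2 * (k : ℤ) = 2 * m := by
    intro a k
    have : ((∑ i, a i ^ 2 + 2 * (k : ℤ) : ℤ) : ℚ) = ((2 * m : ℤ) : ℚ) ↔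
      ∑ i, a i ^ 2 + 2 * (k : ℤ) = 2 * m := Int.cast_inj
    rw [← this]
    push_cast
    constructor <;> intro h <;> linarith
  have hinner : ∀ a : Fin N → ℤ, (∑ᶠ (k : ℕ)
          (_ : (∑ i, a i) = 0 ∧
            (1 / 2 : ℚ) * (∑ i, (a i : ℚ) ^ 2) + (k : ℚ) = (m : ℚ)),
          (({μ : Fin N → IntPartition | (∑ i, (μ i).size) = k}.ncard : ℂ) *
            ξ ^ (∑ i : Fin N, ((i : ℕ) : ℤ) * a i)))
      = ∑ t ∈ (Fam_finite N m).toFinset with (fun x => (t x).1) = a, ξ ^ (∑ x : Fin N, ((x : ℕ) : ℤ) * (t x).1) := by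
    intro a
    have hr : ∑ t ∈ (Fam_finite N m).toFinset with (fun x => (t x).1) = a, ξ ^ (∑ x : Fin N, ((x : ℕ) : ℤ) * (t x).1)
      = ({μ : Fin N → IntPartition | (fun x => (a x, μ x)) ∈ Fam N m}.ncard : ℂ) * ξ ^ (∑ i : Fin N, ((i : ℕ) : ℤ) * a i) := by
      rw [sum_congr rfl (g := fun _ => ξ ^ (∑ i : Fin N, ((i : ℕ) : ℤ) * a i))]
      · rw [sum_const, nsmul_eq_mul]
        congr 2
        rw [← Set.ncard_coe_finset]
        rw [← Set.ncard_image_of_injective (f := fun (μ : Fin N → IntPartition) (x : Fin N) => (a x, μ x))]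
        · congr 1
          ext t
          simp only [coe_filter, Set.Finite.mem_toFinset, Set.mem_ofPred_eq, Set.mem_image]
          constructor
          · rintro ⟨h1, rfl⟩
            exact ⟨fun x => (t x).2, h1, rfl⟩
          · rintro ⟨μ, h1, rfl⟩
            exact ⟨h1, rfl⟩
        · intro μ μ' h
          funext x
          exact congrArg Prod.snd (congrFun h x)
      · intro t ht
        obtain ⟨_, rfl⟩ := mem_filter.1 ht
        rfl
    rw [hr]
    by_cases hex : ∃ k : ℕ, (∑ i, a i) = 0 ∧ ∑ i, a i ^ 2 + 2 * (k : ℤ) = 2 * m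
    · obtain ⟨k, hk1, hk2⟩ := hex
      rw [finsum_eq_single _ k]
      · rw [finsum_eq_if, if_pos ⟨hk1, (hcond a k).2 hk2⟩]
        congr 3
        ext μ
        simp only [Set.mem_ofPred_eq, Fam]
        constructor
        · intro h
          refine ⟨hk1, ?_⟩
          rw [← hk2, ← h]
          push_cast
          rfl
        · rintro ⟨_, h⟩
          have : ∑ i, ((μ i).size : ℤ) = k := by linarith
          exact_mod_cast this
      · intro k' hk'
        rw [finsum_eq_if, if_neg]
        rintro ⟨_, h⟩
        rw [hcond] at h
        omega
    · have h0 : {μ : Fin N → IntPartition | (fun x => (a x, μ x)) ∈ Fam N m} = ∅ := by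
        ext μ
        simp only [Set.mem_ofPred_eq, Fam, Set.mem_empty_iff_false, iff_false]
        rintro ⟨h1, h2⟩
        apply hex
        refine ⟨∑ i, (μ i).size, h1, ?_⟩
        rw [← h2]
        push_cast
        rfl
      rw [h0]
      simp only [Set.ncard_empty, Nat.cast_zero, zero_mul]
      apply finsum_eq_zero_of_forall_eq_zero
      intro k
      rw [finsum_eq_if, if_neg]
      rintro ⟨h1, h2⟩
      exact hex ⟨k, h1, (hcond a k).1 h2⟩
  rw [finsum_congr hinner]
  rw [finsum_eq_sum_of_support_subset (s := (Fam_finite N m).toFinset.image (fun t x => (t x).1))]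
  · rw [Finset.sum_fiberwise_of_maps_to (fun t ht => mem_image_of_mem _ ht)]
  · intro a ha
    obtain ⟨t, ht, _⟩ := Finset.exists_ne_zero_of_sum_ne_zero ha
    obtain ⟨h1, rfl⟩ := mem_filter.1 ht
    exact mem_coe.2 (mem_image_of_mem _ h1)

end ZG

/-- the number of 0-generated partitions with `wt_0 = m` in terms of
cores (tuples `a` with `Σ a_s = 0`) and `(n+1)`-tuples of partitions.  Here the tuple
`a : Fin (n+1) → ℤ` records `(a_1, …, a_{n+1})` via `a_s = a ⟨s-1⟩`, so that
`Σ_{s=2}^{n+1} (s−1)·a_s = Σ_{i} i · a_i`. -/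
theorem stmt10 (n : ℕ) (hn : 1 ≤ n) (ξ : ℂ) (hξ : IsPrimitiveRoot ξ (n + 2)) (m : ℕ) :
    ({lam : IntPartition | ZeroGenerated n lam ∧ IntPartition.wt n 0 lam = m}.ncard : ℂ)
      = ∑ᶠ (a : Fin (n + 1) → ℤ) (k : ℕ)
          (_ : (∑ i, a i) = 0 ∧
            (1 / 2 : ℚ) * (∑ i, (a i : ℚ) ^ 2) + (k : ℚ) = (m : ℚ)),
          (({μ : Fin (n + 1) → IntPartition | (∑ i, (μ i).size) = k}.ncard : ℂ) *
            ξ ^ (∑ i : Fin (n + 1), ((i : ℕ) : ℤ) * a i)) := by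
  rw [ZG.rhs_sum, ZG.main_sum (n + 1) m ξ hξ, ZG.ncard_zeroGen]
end

section
/- Let R be a commutative ring and G a finite group acting on R by ring automorphisms, such that the order of G is invertible in R. Let R^G denote the subring of G-fixed elements. Then for every ideal I of R^G, the contraction of the extension of I equals I: (I·R) ∩ R^G = I, where I·R denotes the ideal of R generated by the image of I. -/
/-- The subring of `G`-fixed elements of `R`. -/
def fixedSubring (G R : Type*) [Monoid G] [Ring R] [MulSemiringAction G R] : Subring R where
  carrier := {r : R | ∀ g : G, g • r = r}
  zero_mem' := fun g => smul_zero g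
  one_mem' := fun g => smul_one g
  add_mem' := fun {a b} ha hb g => by rw [smul_add, ha g, hb g]
  mul_mem' := fun {a b} ha hb g => by rw [smul_mul', ha g, hb g]
  neg_mem' := fun {a} ha g => by rw [smul_neg, ha g]

/-- if a finite group `G`, whose order is invertible in `R`, acts on a
commutative ring `R`, then for every ideal `I` of `R^G` the contraction of the
extension of `I` equals `I`: `(I·R) ∩ R^G = I`. -/
theorem stmt12 (R : Type*) [CommRing R] (G : Type*) [Group G] [Fintype G]
    [MulSemiringAction G R] (hcard : IsUnit ((Fintype.card G : ℕ) : R))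
    (I : Ideal (fixedSubring G R)) :
    Ideal.comap (fixedSubring G R).subtype
      (Ideal.map (fixedSubring G R).subtype I) = I := by
  refine le_antisymm ?_ Ideal.le_comap_map
  have htr : ∀ x : R, ∀ h : G, h • (∑ g : G, g • x) = ∑ g : G, g • x := by
    intro x h
    rw [Finset.smul_sum]
    simp only [smul_smul]
    exact Fintype.sum_equiv (Equiv.mulLeft h) _ _ (fun g => rfl)
  have key : ∀ x ∈ Ideal.map (fixedSubring G R).subtype I, ∀ r : R,
      ∃ y ∈ I, (y : R) = ∑ g : G, g • (r * x) := by
    intro x hx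
    unfold Ideal.map at hx
    induction hx using Submodule.span_induction with
    | mem x hx =>
      obtain ⟨a, ha, rfl⟩ := hx
      intro r
      refine ⟨⟨∑ g : G, g • r, htr r⟩ * a, I.mul_mem_left _ ha, ?_⟩
      have hfix : ∀ g : G, g • (a : R) = a := a.2
      simp [smul_mul', hfix, Finset.sum_mul]
    | zero => exact fun r => ⟨0, I.zero_mem, by simp⟩
    | add x y _ _ hx hy =>
      intro r
      obtain ⟨a, ha, ha2⟩ := hx r
      obtain ⟨b, hb, hb2⟩ := hy r
      exact ⟨a + b, I.add_mem ha hb, by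
        simp [mul_add, smul_add, Finset.sum_add_distrib, ha2, hb2]⟩
    | smul c x _ hx =>
      intro r
      obtain ⟨a, ha, ha2⟩ := hx (r * c)
      exact ⟨a, ha, by rw [ha2, smul_eq_mul, mul_assoc]⟩
  intro x hx
  obtain ⟨u, hu⟩ := hcard.exists_left_inv
  have hufix : ∀ g : G, g • u = u := by
    intro g
    apply hcard.mul_right_cancel
    rw [hu]
    have h := congrArg (fun z => g • z) hu
    have hc : g • ((Fintype.card G : ℕ) : R) = ((Fintype.card G : ℕ) : R) :=
      map_natCast (MulSemiringAction.toRingHom G R g) _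
    simpa only [smul_mul', smul_one, hc] using h
  obtain ⟨y, hy, hy2⟩ := key x hx 1
  have hxfix : ∀ g : G, g • (x : R) = x := x.2
  have hxy : x = (⟨u, hufix⟩ : fixedSubring G R) * y := by
    apply Subtype.ext
    change (x : R) = u * (y : R)
    rw [hy2]
    simp only [one_mul, hxfix, Finset.sum_const, Finset.card_univ, nsmul_eq_mul]
    rw [← mul_assoc, hu, one_mul]
  rw [hxy]
  exact I.mul_mem_left _ hy
end
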